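/- Let K be a number field and let B and B' be central simple algebras over K with dim_K B = dim_K B'. Suppose that: (i) for every finite place v of K, B ⊗_K K_v and B' ⊗_K K_v are isomorphic as K_v-algebras; and (ii) for every real embedding σ : K → ℝ, the ℝ-algebras ℝ ⊗_{K,σ} B and ℝ ⊗_{K,σ} B' are isomorphic. Then B and B' are isomorphic as K-algebras. -/

import Mathlib

open scoped TensorProduct
open IsDedekindDomain NumberField

/-- Helper instance (`Algebra.to_smulCommClass`, which instance search fails to
find on its own for adic completions). -/
noncomputable instance (K : Type) [Field K] [NumberField K]
    (v : HeightOneSpectrum (𝓞 K)) :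
    SMulCommClass K (v.adicCompletion K) (v.adicCompletion K) :=
  Algebra.to_smulCommClass

set_option linter.unusedSectionVars false

section

open Polynomial

namespace AddMonoidHom

variable {A B C : Type*} [AddCommGroup A] [AddCommGroup B] [AddCommGroup C]

theorem card_ker_comp (f : B →+ C) (g : A →+ B) : Nat.card (f.comp g).ker =
    Nat.card g.ker * Nat.card (g.range ⊓ f.ker : AddSubgroup B) := by
  have hle : g.ker ≤ (f.comp g).ker := fun x hx => by
    simp [AddMonoidHom.mem_ker] at hx ⊢; simp [hx]
  have hmap : (f.comp g).ker.map g = g.range ⊓ f.ker := by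
    rw [← AddMonoidHom.comap_ker, AddSubgroup.map_comap_eq]
  have := AddSubgroup.relIndex_ker (f.comp g).ker g
  rw [hmap] at this
  rw [← this]
  have h := AddSubgroup.card_mul_index (g.ker.addSubgroupOf (f.comp g).ker)
  rw [← h, AddSubgroup.relIndex]
  congr 1
  exact Nat.card_congr (AddSubgroup.addSubgroupOfEquivOfLe hle).toEquiv

/-- The quotient `|coker| / |ker|` is multiplicative under composition. -/
theorem index_range_comp_mul (f : B →+ C) (g : A →+ B) [Finite f.ker] :
    (f.comp g).range.index * (Nat.card f.ker * Nat.card g.ker) =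
      f.range.index * g.range.index * Nat.card (f.comp g).ker := by
  have h1 : (f.comp g).range.index = (g.range ⊔ f.ker).index * f.range.index := by
    rw [AddMonoidHom.range_comp, AddSubgroup.index_map]
  have h2 := AddSubgroup.relIndex_mul_index (le_sup_left : g.range ≤ g.range ⊔ f.ker)
  have h3 : g.range.relIndex (g.range ⊔ f.ker) = g.range.relIndex f.ker := by
    rw [sup_comm, AddSubgroup.relIndex_sup_right]
  have h4 : Nat.card (g.range ⊓ f.ker : AddSubgroup B) * g.range.relIndex f.ker =
      Nat.card f.ker := by
    have := AddSubgroup.card_mul_index (g.range.addSubgroupOf f.ker)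
    rw [← this, AddSubgroup.relIndex]
    congr 1
    exact Nat.card_congr
      { toFun := fun x => ⟨⟨x.1, x.2.2⟩, AddSubgroup.mem_addSubgroupOf.2 x.2.1⟩
        invFun := fun x => ⟨x.1.1, AddSubgroup.mem_addSubgroupOf.1 x.2, x.1.2⟩
        left_inv := fun _ => rfl
        right_inv := fun _ => rfl }
  have h5 := card_ker_comp f g
  rw [h1, h5, ← h2, h3, ← h4]
  ring

end AddMonoidHom

section
variable {A : Type*} [AddCommGroup A]

theorem index_range_pow_mul (f : Module.End ℤ A) [Finite (f : A →+ A).ker] (n : ℕ) :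
    Finite ((f ^ n : Module.End ℤ A) : A →+ A).ker ∧
    ((f ^ n : Module.End ℤ A) : A →+ A).range.index * Nat.card (f : A →+ A).ker ^ n =
      (f : A →+ A).range.index ^ n * Nat.card ((f ^ n : Module.End ℤ A) : A →+ A).ker := by
  induction n with
  | zero =>
    have h1 : ((f ^ 0 : Module.End ℤ A) : A →+ A).ker = ⊥ := by
      ext x; simp [AddMonoidHom.mem_ker]
    have h2 : ((f ^ 0 : Module.End ℤ A) : A →+ A).range = ⊤ := by
      ext x; simp [AddMonoidHom.mem_range]
    rw [h1, h2]
    exact ⟨inferInstance, by simp⟩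
  | succ n ih =>
    obtain ⟨hf, ih⟩ := ih
    have e : ((f ^ (n + 1) : Module.End ℤ A) : A →+ A) =
        AddMonoidHom.comp ((f ^ n : Module.End ℤ A) : A →+ A) (f : A →+ A) := by
      rw [pow_succ]; rfl
    have h := AddMonoidHom.index_range_comp_mul ((f ^ n : Module.End ℤ A) : A →+ A) (f : A →+ A)
    have hc := AddMonoidHom.card_ker_comp ((f ^ n : Module.End ℤ A) : A →+ A) (f : A →+ A)
    rw [← e] at h hc
    have hfin : Finite ((f ^ (n + 1) : Module.End ℤ A) : A →+ A).ker := by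
      have : Finite ((f : A →+ A).range ⊓ ((f ^ n : Module.End ℤ A) : A →+ A).ker :
          AddSubgroup A) :=
        Finite.of_injective (fun x => (⟨x.1, x.2.2⟩ : ((f ^ n : Module.End ℤ A) : A →+ A).ker))
          fun x y h => Subtype.ext (congrArg Subtype.val h :)
      refine Nat.finite_of_card_ne_zero ?_
      rw [hc]
      exact mul_ne_zero Nat.card_pos.ne' Nat.card_pos.ne'
    refine ⟨hfin, ?_⟩
    have hpos : 0 < Nat.card ((f ^ n : Module.End ℤ A) : A →+ A).ker := Nat.card_pos
    apply Nat.eq_of_mul_eq_mul_right hpos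
    linear_combination (Nat.card (f : A →+ A).ker ^ n) * h +
      ((f : A →+ A).range.index * Nat.card ((f ^ (n + 1) : Module.End ℤ A) : A →+ A).ker) * ih

theorem finite_ker_nsmul [Module.Finite ℤ A] {n : ℕ} (hn : n ≠ 0) :
    Finite (nsmulAddMonoidHom (α := A) n).ker := by
  let K := (nsmulAddMonoidHom (α := A) n).ker.toIntSubmodule
  have : Module.Finite ℤ K := inferInstance
  have htors : Module.IsTorsion ℤ K := by
    rintro ⟨x, hx⟩
    refine ⟨⟨(n : ℤ), mem_nonZeroDivisors_of_ne_zero (by exact_mod_cast hn)⟩, ?_⟩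
    ext
    have : n • x = 0 := hx
    simpa [Submonoid.smul_def] using this
  exact Module.finite_of_fg_torsion K htors

theorem index_range_nsmul_eq [Module.Finite ℤ A] {n : ℕ} (hn : n ≠ 0) :
    (nsmulAddMonoidHom (α := A) n).range.index =
      n ^ Module.finrank ℤ A * Nat.card (nsmulAddMonoidHom (α := A) n).ker := by
  have hfg : AddGroup.FG A := Module.Finite.iff_addGroup_fg.mp inferInstance
  obtain ⟨r, ι, _, q, hq, e, ⟨φ⟩⟩ := AddCommGroup.equiv_free_prod_directSum_zmod A
  have : ∀ i, NeZero (q i ^ e i) := fun i => ⟨pow_ne_zero _ (hq i).ne_zero⟩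
  let T := DirectSum ι fun i => ZMod (q i ^ e i)
  have hT : Finite T := by
    classical
    have : Fintype ι := Fintype.ofFinite ι
    exact Finite.of_equiv _ (DirectSum.addEquivProd (fun i => ZMod (q i ^ e i))).symm.toEquiv
  have hTindex : (nsmulAddMonoidHom (α := T) n).range.index =
      Nat.card (nsmulAddMonoidHom (α := T) n).ker := by
    have h1 := AddSubgroup.card_mul_index (nsmulAddMonoidHom (α := T) n).ker
    have h2 := AddSubgroup.card_mul_index (nsmulAddMonoidHom (α := T) n).range
    rw [AddSubgroup.index_ker] at h1
    have : 0 < Nat.card (nsmulAddMonoidHom (α := T) n).range := Nat.card_pos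
    apply Nat.eq_of_mul_eq_mul_left this
    rw [h2, ← h1, mul_comm]
  let F := Fin r →₀ ℤ
  have hFindex := AddSubgroup.index_range_nsmul F n
  have hrank : Module.finrank ℤ A = Module.finrank ℤ F := by
    rw [LinearEquiv.finrank_eq φ.toIntLinearEquiv]
    change Module.finrank ℤ (F × T) = _
    have hTt : Module.finrank ℤ T = 0 := by
      rw [Module.finrank_eq_zero_iff]
      intro x
      refine ⟨Nat.card T, by exact_mod_cast Nat.card_pos.ne', ?_⟩
      rw [Nat.cast_smul_eq_nsmul]
      exact card_nsmul_eq_zero'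
    have := Submodule.finrank_quotient_add_finrank (LinearMap.ker (LinearMap.fst ℤ F T))
    have e1 := (LinearMap.quotKerEquivOfSurjective (LinearMap.fst ℤ F T) LinearMap.fst_surjective).finrank_eq
    have e2 : Module.finrank ℤ (LinearMap.ker (LinearMap.fst ℤ F T)) = 0 := by
      rw [LinearMap.ker_fst, ← hTt]
      exact (LinearEquiv.ofInjective (LinearMap.inr ℤ F T) LinearMap.inr_injective).finrank_eq.symm
    rw [← this, e1, e2, add_zero]
  have hindex : (nsmulAddMonoidHom (α := A) n).range.index =
      (nsmulAddMonoidHom (α := F × T) n).range.index := by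
    have : (nsmulAddMonoidHom (α := F × T) n).range =
        (nsmulAddMonoidHom (α := A) n).range.map φ.toAddMonoidHom := by
      ext x
      constructor
      · rintro ⟨y, rfl⟩
        exact ⟨n • φ.symm y, ⟨φ.symm y, rfl⟩, by simp⟩
      · rintro ⟨_, ⟨y, rfl⟩, rfl⟩
        exact ⟨φ y, by simp⟩
    rw [this]
    exact (AddSubgroup.index_map_equiv _ φ).symm
  have hker : Nat.card (nsmulAddMonoidHom (α := A) n).ker =
      Nat.card (nsmulAddMonoidHom (α := F × T) n).ker := by
    refine Nat.card_congr (φ.toEquiv.subtypeEquiv fun a => ?_)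
    change n • a = 0 ↔ n • φ a = 0
    rw [← map_nsmul, map_eq_zero_iff φ φ.injective]
  have hprodr : (nsmulAddMonoidHom (α := F × T) n).range =
      (nsmulAddMonoidHom (α := F) n).range.prod (nsmulAddMonoidHom (α := T) n).range := by
    ext ⟨x, y⟩
    constructor
    · rintro ⟨⟨a, b⟩, h⟩
      obtain ⟨rfl, rfl⟩ := Prod.mk.inj h
      exact ⟨⟨a, rfl⟩, ⟨b, rfl⟩⟩
    · rintro ⟨⟨a, ha⟩, ⟨b, hb⟩⟩
      exact ⟨(a, b), Prod.ext ha hb⟩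
  have hprodk : Nat.card (nsmulAddMonoidHom (α := F × T) n).ker =
      Nat.card (nsmulAddMonoidHom (α := T) n).ker := by
    refine Nat.card_congr
      { toFun := fun x => ⟨x.1.2, congrArg Prod.snd x.2⟩
        invFun := fun y => ⟨(0, y.1), Prod.ext (smul_zero n) y.2⟩
        left_inv := ?_
        right_inv := fun _ => rfl }
    rintro ⟨⟨a, b⟩, h⟩
    have : n • a = 0 := congrArg Prod.fst h
    have ha : a = 0 := by simpa [hn] using this
    simp [ha]
  rw [hindex, hprodr, AddSubgroup.index_prod, hFindex, hTindex, hrank, hker, hprodk]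

open Finset in
/-- `p` is `(1 - X) ^ (p - 1)` times a unit modulo `1 + X + ⋯ + X ^ (p - 1)`. -/
theorem exists_prime_eq_one_sub_X_pow_mul {p : ℕ} (hp : p.Prime) :
    ∃ u v w w' : ℤ[X], C (p : ℤ) = (1 - X) ^ (p - 1) * u + (∑ i ∈ range p, X ^ i) * w ∧
      u * v = 1 + (∑ i ∈ range p, X ^ i) * w' := by
  have := Fact.mk hp
  have hΦ : cyclotomic p ℤ = ∑ i ∈ range p, X ^ i := cyclotomic_prime ℤ p
  rw [← hΦ]
  have hirr := cyclotomic.irreducible (n := p) hp.pos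
  let R := AdjoinRoot (cyclotomic p ℤ)
  have hpr : Prime (cyclotomic p ℤ) := hirr.prime
  have : IsDomain R := AdjoinRoot.isDomain_of_prime hpr
  let ζ : R := AdjoinRoot.root _
  have hroot : ∑ i ∈ range p, ζ ^ i = 0 := by
    have : aeval ζ (cyclotomic p ℤ) = 0 := by
      rw [AdjoinRoot.aeval_eq, AdjoinRoot.mk_self]
    simpa [hΦ] using this
  have h1 : ζ ^ p = 1 := by
    have := mul_neg_geom_sum ζ p
    rw [hroot, mul_zero] at this
    exact (sub_eq_zero.mp this.symm).symm
  have hne : ζ ≠ 1 := by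
    intro h
    have hd : cyclotomic p ℤ ∣ X - 1 := by
      rw [← AdjoinRoot.mk_eq_zero]
      simpa [sub_eq_zero] using h
    obtain ⟨c, hc⟩ := hd
    have h2 := congrArg (eval 1) (congrArg derivative hc)
    have h3 := congrArg (eval 1) hc
    rw [hΦ] at h2 h3
    simp [eval_finsetSum, derivative_mul] at h2 h3
    have h4 : eval 1 c = 0 := by
      rcases h3 with h3 | h3
      · exact absurd h3 hp.ne_zero
      · exact h3
    rw [h4] at h2
    simp at h2
    have h5 : (p : ℤ) ∣ 1 := ⟨_, h2⟩
    exact hp.one_lt.ne' (by exact_mod_cast Int.eq_one_of_dvd_one (by positivity) h5)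
  have hprim : IsPrimitiveRoot ζ p := by
    have : orderOf ζ = p := orderOf_eq_prime h1 hne
    have h := IsPrimitiveRoot.orderOf ζ
    rwa [this] at h
  obtain ⟨n, rfl⟩ : ∃ n, p = n + 1 := ⟨p - 1, by have := hp.pos; omega⟩
  have hprod := hprim.prod_one_sub_pow_eq_order
  have hunit : IsUnit (∏ k ∈ range n, ∑ i ∈ range (k + 1), ζ ^ i) := by
    rw [IsUnit.prod_iff]
    intro k hk
    refine hprim.geom_sum_isUnit hp.two_le ?_
    exact (Nat.coprime_of_lt_prime (by omega) (by rw [mem_range] at hk; omega) hp).symm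
  obtain ⟨v0, hv0⟩ := hunit.exists_right_inv
  obtain ⟨v, rfl⟩ := AdjoinRoot.mk_surjective v0
  have hpe : ((n + 1 : ℕ) : R) = (1 - ζ) ^ n * ∏ k ∈ range n, ∑ i ∈ range (k + 1), ζ ^ i := by
    push_cast
    rw [← hprod]
    calc ∏ k ∈ range n, (1 - ζ ^ (k + 1))
        = ∏ k ∈ range n, ((1 - ζ) * ∑ i ∈ range (k + 1), ζ ^ i) :=
          prod_congr rfl fun k _ => (mul_neg_geom_sum ζ (k + 1)).symm
      _ = _ := by rw [prod_mul_distrib, prod_const, card_range]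
  have hmkX : AdjoinRoot.mk (cyclotomic (n + 1) ℤ) X = ζ := AdjoinRoot.mk_X
  obtain ⟨w, hw⟩ : cyclotomic (n + 1) ℤ ∣ C ((n + 1 : ℕ) : ℤ) -
      (1 - X) ^ n * ∏ k ∈ range n, ∑ i ∈ range (k + 1), X ^ i := by
    rw [← AdjoinRoot.mk_eq_zero]
    simp only [map_sub, map_mul, map_pow, map_prod, map_sum, hmkX, map_one]
    rw [sub_eq_zero, ← hpe]
    simp
  obtain ⟨w', hw'⟩ : cyclotomic (n + 1) ℤ ∣
      (∏ k ∈ range n, ∑ i ∈ range (k + 1), X ^ i) * v - 1 := by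
    rw [← AdjoinRoot.mk_eq_zero]
    simp only [map_sub, map_mul, map_pow, map_prod, map_sum, hmkX, map_one]
    rw [sub_eq_zero, hv0]
  refine ⟨∏ k ∈ range n, ∑ i ∈ range (k + 1), X ^ i, v, w, w', ?_, ?_⟩
  · rw [Nat.add_sub_cancel]; exact (sub_eq_iff_eq_add'.mp hw)
  · exact (sub_eq_iff_eq_add'.mp hw')

end

end

section

open Polynomial

section
variable {A : Type*} [AddCommGroup A]

theorem finrank_eq_zero_of_finite [Finite A] : Module.finrank ℤ A = 0 := by
  rw [Module.finrank_eq_zero_iff]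
  intro x
  refine ⟨Nat.card A, by exact_mod_cast Nat.card_pos.ne', ?_⟩
  rw [Nat.cast_smul_eq_nsmul]
  exact card_nsmul_eq_zero'

theorem finrank_range_add_finrank_ker_int {B : Type*} [AddCommGroup B] [Module.Finite ℤ A]
    (f : A →ₗ[ℤ] B) :
    Module.finrank ℤ (LinearMap.range f) + Module.finrank ℤ (LinearMap.ker f) =
      Module.finrank ℤ A := by
  rw [← f.quotKerEquivRange.finrank_eq]
  exact Submodule.finrank_quotient_add_finrank _

/-- If `σ` satisfies `1 + σ + ⋯ + σ ^ (p - 1) = 0`, the Herbrand quotient of `1 - σ` is determined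
by the rank. -/
theorem index_range_one_sub_pow [Module.Finite ℤ A] {p : ℕ} (hp : p.Prime) (σ : Module.End ℤ A)
    (hσ : ∑ i ∈ Finset.range p, σ ^ i = 0) [hfin : Finite ((1 - σ : Module.End ℤ A) : A →+ A).ker] :
    ((1 - σ : Module.End ℤ A) : A →+ A).range.index ^ (p - 1) =
      p ^ Module.finrank ℤ A * Nat.card ((1 - σ : Module.End ℤ A) : A →+ A).ker ^ (p - 1) := by
  obtain ⟨u, v, w, w', h1, h2⟩ := exists_prime_eq_one_sub_X_pow_mul hp
  have h1' := congrArg (aeval σ) h1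
  have h2' := congrArg (aeval σ) h2
  simp only [map_mul, map_add, map_sub, map_pow, map_one, aeval_X, map_sum, hσ, zero_mul,
    add_zero, aeval_C] at h1' h2'
  have h2'' : aeval σ v * aeval σ u = 1 := by rw [← map_mul, mul_comm, map_mul, h2']
  set f := (1 - σ) ^ (p - 1) with hf
  set U := aeval σ u
  set V := aeval σ v
  have hUV : ∀ x, U (V x) = x := fun x => by
    rw [← Module.End.mul_apply, h2', Module.End.one_apply]
  have hVU : ∀ x, V (U x) = x := fun x => by
    rw [← Module.End.mul_apply, h2'', Module.End.one_apply]
  have hpx : ∀ x : A, p • x = f (U x) := fun x => by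
    rw [← Module.End.mul_apply, ← h1']
    simp
  have hr : (nsmulAddMonoidHom (α := A) p).range = (f : A →+ A).range := by
    ext y
    constructor
    · rintro ⟨x, rfl⟩
      exact ⟨U x, (hpx x).symm⟩
    · rintro ⟨x, rfl⟩
      refine ⟨V x, ?_⟩
      change p • V x = f x
      rw [hpx, hUV]
  have hk : Nat.card (nsmulAddMonoidHom (α := A) p).ker = Nat.card (f : A →+ A).ker := by
    refine Nat.card_congr (Equiv.subtypeEquiv ⟨U, V, hVU, hUV⟩ fun a => ?_)
    change p • a = 0 ↔ f (U a) = 0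
    rw [hpx]
  have h := index_range_nsmul_eq (A := A) hp.ne_zero
  obtain ⟨hffin, h3⟩ := index_range_pow_mul (1 - σ) (p - 1)
  rw [hr, hk] at h
  rw [← hf] at h3
  rw [h] at h3
  have : 0 < Nat.card (f : A →+ A).ker := Nat.card_pos
  apply Nat.eq_of_mul_eq_mul_right this
  rw [← h3]
  ring

/-- The order of `Ĥ⁰` of a finitely generated module over a group of prime order with trivial
`Ĥ⁻¹`. -/
theorem relIndex_range_norm_pow [Module.Finite ℤ A] {p : ℕ} (hp : p.Prime) (σ : Module.End ℤ A)
    (hσ : σ ^ p = 1) (hH : ∀ x, (∑ i ∈ Finset.range p, σ ^ i) x = 0 → ∃ y, x = y - σ y) :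
    (((∑ i ∈ Finset.range p, σ ^ i : Module.End ℤ A) : A →+ A).range.relIndex
      ((1 - σ : Module.End ℤ A) : A →+ A).ker) ^ (p - 1) * p ^ Module.finrank ℤ A =
      p ^ (p * Module.finrank ℤ (LinearMap.ker (1 - σ : Module.End ℤ A))) := by
  set N : Module.End ℤ A := ∑ i ∈ Finset.range p, σ ^ i with hN
  set δ : Module.End ℤ A := 1 - σ with hδ
  have hNδ : N * δ = 0 := by
    rw [hN, hδ, geom_sum_mul_neg, hσ, sub_self]
  have hδN : δ * N = 0 := by
    rw [hN, hδ, mul_neg_geom_sum, hσ, sub_self]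
  have hcomm : Commute σ N := by
    rw [hN]; exact Commute.sum_right _ _ _ fun i _ => Commute.pow_right rfl i
  have hfix : ∀ x, δ x = 0 ↔ σ x = x := fun x => by
    rw [hδ, LinearMap.sub_apply, Module.End.one_apply, sub_eq_zero, eq_comm]
  have hNfix : ∀ x, δ x = 0 → N x = p • x := by
    intro x hx
    have hx := (hfix x).1 hx
    have : ∀ i, (σ ^ i) x = x := fun i => by
      induction i with
      | zero => simp
      | succ i ih => rw [pow_succ, Module.End.mul_apply, hx, ih]
    simp [hN, LinearMap.sum_apply, this]
  have hNd : ∀ x, δ (N x) = 0 := fun x => by rw [← Module.End.mul_apply, hδN]; rfl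
  have hdN : ∀ x, N (δ x) = 0 := fun x => by rw [← Module.End.mul_apply, hNδ]; rfl
  let Q := LinearMap.ker N
  let F := LinearMap.ker δ
  have hσQ : ∀ x ∈ Q, σ x ∈ Q := fun x hx => by
    rw [LinearMap.mem_ker] at hx ⊢
    rw [← Module.End.mul_apply, ← hcomm.eq, Module.End.mul_apply, hx, map_zero]
  let τ : Module.End ℤ Q := σ.restrict hσQ
  have hτpow : ∀ i (x : Q), ((τ ^ i) x : A) = (σ ^ i) x := fun i x => by
    induction i generalizing x with
    | zero => rfl
    | succ i ih => rw [pow_succ, pow_succ, Module.End.mul_apply, Module.End.mul_apply, ih]; rfl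
  have hτ : ∑ i ∈ Finset.range p, τ ^ i = 0 := by
    ext x
    rw [LinearMap.sum_apply, AddSubmonoidClass.coe_finsetSum]
    simp only [hτpow]
    have := x.2
    rw [LinearMap.mem_ker, hN, LinearMap.sum_apply] at this
    simpa using this
  have hτ1 : ∀ x : Q, (((1 - τ : Module.End ℤ Q) x : Q) : A) = δ x := fun x => rfl
  have hkfin := finite_ker_nsmul (A := F) hp.ne_zero
  -- the kernel of `1 - τ`
  let e : ((1 - τ : Module.End ℤ Q) : Q →+ Q).ker ≃ (nsmulAddMonoidHom (α := F) p).ker :=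
    { toFun := fun x => ⟨⟨x.1.1, by
          have := congrArg Subtype.val (show (1 - τ) x.1 = 0 from x.2)
          exact this⟩, by
          have h : δ x.1.1 = 0 := congrArg Subtype.val (show (1 - τ) x.1 = 0 from x.2)
          have h2 : N x.1.1 = 0 := x.1.2
          rw [hNfix _ h] at h2
          exact Subtype.ext h2⟩
      invFun := fun x => ⟨⟨x.1.1, by
          have h : δ x.1.1 = 0 := x.1.2
          have h2 : p • x.1.1 = 0 := congrArg Subtype.val (show p • x.1 = 0 from x.2)
          rw [LinearMap.mem_ker, hNfix _ h, h2]⟩, Subtype.ext x.1.2⟩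
      left_inv := fun _ => rfl
      right_inv := fun _ => rfl }
  have hfin : Finite ((1 - τ : Module.End ℤ Q) : Q →+ Q).ker := Finite.of_equiv _ e.symm
  have hI := index_range_one_sub_pow hp τ hτ
  rw [Nat.card_congr e] at hI
  -- identify the index of `1 - τ`
  let g : A →+ Q := (δ.codRestrict Q fun x => LinearMap.mem_ker.2 (hdN x) : A →ₗ[ℤ] Q)
  have hg : g.range = ⊤ := by
    rw [AddMonoidHom.range_eq_top]
    rintro ⟨x, hx⟩
    obtain ⟨y, hy⟩ := hH x hx
    exact ⟨y, Subtype.ext hy.symm⟩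
  have hgk : g.ker = (δ : A →+ A).ker := by
    ext x
    exact ⟨fun h => congrArg Subtype.val (show g x = 0 from h),
      fun h => Subtype.ext (show δ x = 0 from h)⟩
  have hDr : ((1 - τ : Module.End ℤ Q) : Q →+ Q).range = (N : A →+ A).ker.map g := by
    ext x
    constructor
    · rintro ⟨y, rfl⟩
      exact ⟨y.1, y.2, rfl⟩
    · rintro ⟨y, hy, rfl⟩
      exact ⟨⟨y, hy⟩, rfl⟩
  have hI1 : ((1 - τ : Module.End ℤ Q) : Q →+ Q).range.index =
      ((N : A →+ A).ker ⊔ (δ : A →+ A).ker).index := by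
    rw [hDr, AddSubgroup.index_map, hg, hgk, AddSubgroup.index_top, mul_one]
  have hI2 : ((δ : A →+ A).ker.map (N : A →+ A)).relIndex (N : A →+ A).range =
      ((N : A →+ A).ker ⊔ (δ : A →+ A).ker).index := by
    rw [AddMonoidHom.range_eq_map, AddSubgroup.relIndex_map_map, top_sup_eq,
      AddSubgroup.relIndex_top_right, sup_comm]
  have hle1 : (δ : A →+ A).ker.map (N : A →+ A) ≤ (N : A →+ A).range :=
    fun _ ⟨y, _, h⟩ => ⟨y, h⟩
  have hle2 : (N : A →+ A).range ≤ (δ : A →+ A).ker := by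
    rintro _ ⟨x, rfl⟩
    exact hNd x
  have hmul := AddSubgroup.relIndex_mul_relIndex _ _ _ hle1 hle2
  have hpF : ((δ : A →+ A).ker.map (N : A →+ A)).relIndex (δ : A →+ A).ker =
      (nsmulAddMonoidHom (α := F) p).range.index := by
    have : (nsmulAddMonoidHom (α := F) p).range =
        ((δ : A →+ A).ker.map (N : A →+ A)).addSubgroupOf (δ : A →+ A).ker := by
      ext ⟨x, hx⟩
      constructor
      · rintro ⟨⟨y, hy⟩, h⟩
        refine AddSubgroup.mem_addSubgroupOf.2 ⟨y, hy, ?_⟩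
        have h3 : p • y = x := congrArg Subtype.val h
        exact (hNfix y hy).trans h3
      · intro h
        obtain ⟨y, hy, h⟩ := AddSubgroup.mem_addSubgroupOf.1 h
        refine ⟨⟨y, hy⟩, Subtype.ext ?_⟩
        exact (hNfix y hy).symm.trans h
    rw [this]; rfl
  have hpF' := index_range_nsmul_eq (A := F) hp.ne_zero
  rw [hpF, hpF', hI2, ← hI1] at hmul
  -- ranks
  have hrk := finrank_range_add_finrank_ker_int N
  have hrF : Module.finrank ℤ (LinearMap.range N) = Module.finrank ℤ F := by
    apply le_antisymm
    · exact Submodule.finrank_mono (by rintro _ ⟨x, rfl⟩; exact hNd x)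
    · have h1 := finrank_range_add_finrank_ker_int (LinearMap.lsmul ℤ F (p : ℤ))
      have h2 : Finite (LinearMap.ker (LinearMap.lsmul ℤ F (p : ℤ))) := by
        refine Finite.of_injective
          (fun x => (⟨x.1, ?_⟩ : (nsmulAddMonoidHom (α := F) p).ker))
          fun x y h => Subtype.ext (congrArg Subtype.val h :)
        have := x.2
        rw [LinearMap.mem_ker, LinearMap.lsmul_apply, Nat.cast_smul_eq_nsmul] at this
        exact this
      rw [finrank_eq_zero_of_finite (A := LinearMap.ker (LinearMap.lsmul ℤ F (p : ℤ))),
        add_zero] at h1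
      rw [← h1, LinearEquiv.finrank_eq (Submodule.equivMapOfInjective F.subtype
        F.injective_subtype (LinearMap.range (LinearMap.lsmul ℤ F (p : ℤ))))]
      refine Submodule.finrank_mono ?_
      rintro _ ⟨_, ⟨x, rfl⟩, rfl⟩
      refine ⟨x.1, ?_⟩
      rw [hNfix _ x.2]
      simp
  obtain ⟨n, rfl⟩ : ∃ n, p = n + 1 := ⟨p - 1, by have := hp.pos; omega⟩
  rw [Nat.add_sub_cancel] at hI ⊢
  set J := (N : A →+ A).range.relIndex (δ : A →+ A).ker
  set I := ((1 - τ : Module.End ℤ Q) : Q →+ Q).range.index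
  set c := Nat.card (nsmulAddMonoidHom (α := F) (n + 1)).ker
  have hc : 0 < c := Nat.card_pos
  have h5 : (n + 1) ^ Module.finrank ℤ Q * J ^ n = (n + 1) ^ (n * Module.finrank ℤ F) := by
    apply Nat.eq_of_mul_eq_mul_right (pow_pos hc n)
    have := congrArg (· ^ n) hmul
    simp only [mul_pow, hI] at this
    rw [pow_mul', ← this]; ring
  rw [← hrk, hrF, pow_add, add_mul, pow_add, ← h5, one_mul]
  change _ * (_ * (n + 1) ^ Module.finrank ℤ Q) = _
  ring

end

end

section

open IsDedekindDomain NumberField WithZero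

section
variable {K : Type*} [Field K] [NumberField K]

/-- The normalized additive valuation on `Kˣ` attached to a finite place. -/
noncomputable def ordv (v : HeightOneSpectrum (𝓞 K)) (x : Kˣ) : ℤ :=
  -(v.valuationOfNeZero x).toAdd

theorem valuation_eq_exp_ordv (v : HeightOneSpectrum (𝓞 K)) (x : Kˣ) :
    v.valuation K (x : K) = exp (-ordv v x) := by
  rw [← v.valuationOfNeZero_eq, ordv, neg_neg]; rfl

theorem ordv_mul (v : HeightOneSpectrum (𝓞 K)) (x y : Kˣ) :
    ordv v (x * y) = ordv v x + ordv v y := by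
  simp [ordv]; ring

@[simp] theorem ordv_one (v : HeightOneSpectrum (𝓞 K)) : ordv v 1 = 0 := by
  simp [ordv]

theorem ordv_inv (v : HeightOneSpectrum (𝓞 K)) (x : Kˣ) : ordv v x⁻¹ = - ordv v x := by
  simp [ordv]

theorem ordv_pow (v : HeightOneSpectrum (𝓞 K)) (x : Kˣ) (n : ℕ) :
    ordv v (x ^ n) = n * ordv v x := by
  simp [ordv]

theorem ordv_zpow (v : HeightOneSpectrum (𝓞 K)) (x : Kˣ) (n : ℤ) :
    ordv v (x ^ n) = n * ordv v x := by
  simp [ordv]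

theorem ordv_eq_zero_iff {v : HeightOneSpectrum (𝓞 K)} {x : Kˣ} :
    ordv v x = 0 ↔ v.valuation K (x : K) = 1 := by
  rw [valuation_eq_exp_ordv, ← exp_zero, exp_inj]; omega

theorem ordv_eq_iff {v : HeightOneSpectrum (𝓞 K)} {x : Kˣ} {n : ℤ} :
    ordv v x = n ↔ v.valuation K (x : K) = exp (-n) := by
  rw [valuation_eq_exp_ordv, exp_inj]; omega

theorem exists_ordv_eq_one (v : HeightOneSpectrum (𝓞 K)) : ∃ x : Kˣ, ordv v x = 1 := by
  obtain ⟨π, hπ⟩ := v.valuation_exists_uniformizer K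
  refine ⟨Units.mk0 π ?_, ?_⟩
  · rintro rfl
    rw [map_zero] at hπ
    exact exp_ne_zero hπ.symm
  · rw [ordv_eq_iff]; simpa using hπ

theorem finite_ordv_ne_zero (x : Kˣ) : {v : HeightOneSpectrum (𝓞 K) | ordv v x ≠ 0}.Finite := by
  refine ((HeightOneSpectrum.Support.finite (𝓞 K) (x : K)).union
    (HeightOneSpectrum.Support.finite (𝓞 K) ((x⁻¹ : Kˣ) : K))).subset ?_
  intro v hv
  simp only [Set.mem_ofPred_eq] at hv
  simp only [Set.mem_union, HeightOneSpectrum.Support, Set.mem_ofPred_eq,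
    valuation_eq_exp_ordv, ordv_inv]
  rw [← exp_zero, exp_lt_exp, exp_lt_exp]
  omega

theorem mem_of_ordv_nonneg {x : Kˣ} (h : ∀ v : HeightOneSpectrum (𝓞 K), 0 ≤ ordv v x) :
    ∃ y : 𝓞 K, algebraMap (𝓞 K) K y = x := by
  obtain ⟨y, hy⟩ := HeightOneSpectrum.mem_integers_of_valuation_le_one (R := 𝓞 K) K (x : K)
    (fun v => by
      rw [valuation_eq_exp_ordv, ← exp_zero, exp_le_exp]
      have := h v
      omega)
  exact ⟨y, hy⟩

/-- The group of `S`-units. -/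
def sUnits (S : Finset (HeightOneSpectrum (𝓞 K))) : Subgroup Kˣ where
  carrier := {x | ∀ v ∉ S, ordv v x = 0}
  one_mem' := by simp
  mul_mem' := by
    intro x y hx hy v hv
    rw [ordv_mul, hx v hv, hy v hv, add_zero]
  inv_mem' := by
    intro x hx v hv
    rw [ordv_inv, hx v hv, neg_zero]

theorem mem_sUnits {S : Finset (HeightOneSpectrum (𝓞 K))} {x : Kˣ} :
    x ∈ sUnits S ↔ ∀ v ∉ S, ordv v x = 0 := Iff.rfl

theorem sUnits_mono {S T : Finset (HeightOneSpectrum (𝓞 K))} (h : S ⊆ T) :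
    sUnits S ≤ sUnits T := fun _ hx v hv => hx v (fun h' => hv (h h'))

theorem mem_sUnits_of_pow {S : Finset (HeightOneSpectrum (𝓞 K))} {x : Kˣ} {n : ℕ} (hn : n ≠ 0)
    (h : x ^ n ∈ sUnits S) : x ∈ sUnits S := by
  intro v hv
  have := h v hv
  rw [ordv_pow] at this
  simpa [hn] using this

/-- The vector of valuations of an `S`-unit at the places of `S`. -/
noncomputable def sUnitsOrd (S : Finset (HeightOneSpectrum (𝓞 K))) :
    Additive (sUnits S) →ₗ[ℤ] (S → ℤ) :=
  AddMonoidHom.toIntLinearMap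
    { toFun := fun x v => ordv v.1 (x.toMul : Kˣ)
      map_zero' := by ext; simp
      map_add' := by intro x y; ext; simp [ordv_mul] }

theorem sUnitsOrd_apply (S : Finset (HeightOneSpectrum (𝓞 K))) (x : Additive (sUnits S)) (v : S) :
    sUnitsOrd S x v = ordv v.1 (x.toMul : Kˣ) := rfl

theorem ordv_unit (v : HeightOneSpectrum (𝓞 K)) (u : (𝓞 K)ˣ) :
    ordv v (Units.map (algebraMap (𝓞 K) K : 𝓞 K →* K) u) = 0 := by
  rw [ordv, HeightOneSpectrum.valuation_of_unit_eq]; simp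

/-- Units of the ring of integers as `S`-units. -/
noncomputable def unitsToSUnits (S : Finset (HeightOneSpectrum (𝓞 K))) :
    Additive (𝓞 K)ˣ →ₗ[ℤ] Additive (sUnits S) :=
  AddMonoidHom.toIntLinearMap (MonoidHom.toAdditive
    ((Units.map (algebraMap (𝓞 K) K : 𝓞 K →* K)).codRestrict (sUnits S)
      (fun u v _ => ordv_unit v u)))

theorem unitsToSUnits_injective (S : Finset (HeightOneSpectrum (𝓞 K))) :
    Function.Injective (unitsToSUnits S) := by
  intro x y h
  have h1 : (((unitsToSUnits S x).toMul : Kˣ) : K) = ((unitsToSUnits S y).toMul : Kˣ) := by rw [h]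
  apply Additive.toMul.injective
  apply Units.ext
  exact FaithfulSMul.algebraMap_injective (𝓞 K) K h1

theorem range_unitsToSUnits (S : Finset (HeightOneSpectrum (𝓞 K))) :
    LinearMap.range (unitsToSUnits S) = LinearMap.ker (sUnitsOrd S) := by
  apply le_antisymm
  · rintro _ ⟨u, rfl⟩
    rw [LinearMap.mem_ker]
    ext v
    exact ordv_unit v.1 u.toMul
  · intro x hx
    rw [LinearMap.mem_ker] at hx
    have h0 : ∀ v, ordv v (x.toMul : Kˣ) = 0 := by
      intro v
      by_cases hv : v ∈ S
      · exact congrFun hx ⟨v, hv⟩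
      · exact x.toMul.2 v hv
    obtain ⟨y, hy⟩ := mem_of_ordv_nonneg (x := (x.toMul : Kˣ)) (fun v => (h0 v).ge)
    obtain ⟨z, hz⟩ := mem_of_ordv_nonneg (x := (x.toMul : Kˣ)⁻¹)
      (fun v => by rw [ordv_inv, h0, neg_zero])
    have hyz : y * z = 1 := by
      apply FaithfulSMul.algebraMap_injective (𝓞 K) K
      rw [map_mul, hy, hz, map_one]; simp
    refine ⟨Additive.ofMul ⟨y, z, hyz, by rw [mul_comm, hyz]⟩, ?_⟩
    apply Additive.toMul.injective
    apply Subtype.ext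
    apply Units.ext
    exact hy

theorem mem_asIdeal_iff_ordv_pos {v : HeightOneSpectrum (𝓞 K)} {c : 𝓞 K} {x : Kˣ}
    (h : algebraMap (𝓞 K) K c = x) : c ∈ v.asIdeal ↔ 0 < ordv v x := by
  have e : v.valuation K (algebraMap (𝓞 K) K c) < 1 ↔ c ∈ v.asIdeal :=
    v.valuation_lt_one_iff_mem c
  rw [← e, h, valuation_eq_exp_ordv, ← exp_zero, exp_lt_exp]
  omega

theorem ordv_nonneg_of_integer {v : HeightOneSpectrum (𝓞 K)} {c : 𝓞 K} {x : Kˣ}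
    (h : algebraMap (𝓞 K) K c = x) : 0 ≤ ordv v x := by
  have : v.valuation K (algebraMap (𝓞 K) K c) ≤ 1 := v.valuation_le_one c
  rw [h, valuation_eq_exp_ordv, ← exp_zero, exp_le_exp] at this
  omega

theorem mem_pow_iff_le_ordv {v : HeightOneSpectrum (𝓞 K)} {c : 𝓞 K} {x : Kˣ}
    (h : algebraMap (𝓞 K) K c = x) (n : ℕ) : c ∈ v.asIdeal ^ n ↔ n ≤ ordv v x := by
  have e : v.valuation K (algebraMap (𝓞 K) K c) = v.intValuation c := v.valuation_of_algebraMap c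
  rw [← v.intValuation_le_pow_iff_mem, ← e, h,
    valuation_eq_exp_ordv, exp_le_exp]
  omega

/-- A power of every prime is principal. -/
theorem exists_unit_ordv_pos (v : HeightOneSpectrum (𝓞 K)) :
    ∃ c : Kˣ, 0 < ordv v c ∧ ∀ u, u ≠ v → ordv u c = 0 := by
  have hv0 : v.asIdeal ≠ ⊥ := v.ne_bot
  have h1 : (ClassGroup.mk0 ⟨v.asIdeal, mem_nonZeroDivisors_of_ne_zero hv0⟩) ^
      (Fintype.card (ClassGroup (𝓞 K))) = 1 := pow_card_eq_one
  rw [← map_pow, ClassGroup.mk0_eq_one_iff] at h1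
  obtain ⟨c, hc⟩ := h1.principal
  set h := Fintype.card (ClassGroup (𝓞 K)) with hh
  have hpos : h ≠ 0 := Fintype.card_ne_zero
  simp only [SubmonoidClass.mk_pow, Ideal.submodule_span_eq] at hc
  have hc0 : c ≠ 0 := by
    rintro rfl
    rw [Ideal.span_singleton_eq_bot.mpr rfl] at hc
    exact pow_ne_zero h hv0 hc
  refine ⟨Units.mk0 (algebraMap (𝓞 K) K c) (by simpa using hc0), ?_, ?_⟩
  · rw [← mem_asIdeal_iff_ordv_pos (c := c) rfl]
    have : c ∈ v.asIdeal ^ h := hc ▸ Ideal.mem_span_singleton_self c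
    exact Ideal.pow_le_self hpos this
  · intro u hu
    have h2 : ¬ c ∈ u.asIdeal := by
      intro hcu
      have : v.asIdeal ^ h ≤ u.asIdeal := by
        rw [hc, Ideal.span_singleton_le_iff_mem]; exact hcu
      have h3 := u.isPrime.le_of_pow_le this
      exact hu (HeightOneSpectrum.ext (v.isMaximal.eq_of_le u.isPrime.ne_top h3).symm)
    rw [mem_asIdeal_iff_ordv_pos (c := c) (x := Units.mk0 (algebraMap (𝓞 K) K c)
      (by simpa using hc0)) rfl] at h2
    have := ordv_nonneg_of_integer (v := u) (c := c) (x := Units.mk0 (algebraMap (𝓞 K) K c)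
      (by simpa using hc0)) rfl
    omega

instance finite_sUnits (S : Finset (HeightOneSpectrum (𝓞 K))) :
    Module.Finite ℤ (Additive (sUnits S)) := by
  have h1 : Module.Finite ℤ (LinearMap.ker (sUnitsOrd S)) := by
    rw [← range_unitsToSUnits]; infer_instance
  have h2 : Module.Finite ℤ (LinearMap.range (sUnitsOrd S)) :=
    Module.Finite.of_fg (IsNoetherian.noetherian _)
  exact ⟨Submodule.fg_of_fg_map_of_fg_inf_ker (sUnitsOrd S)
    (by rw [Submodule.map_top]; exact IsNoetherian.noetherian _)
    (by rw [top_inf_eq]; exact Module.Finite.iff_fg.mp h1)⟩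

/-- The rank of the group of `S`-units. -/
theorem finrank_sUnits (S : Finset (HeightOneSpectrum (𝓞 K))) :
    Module.finrank ℤ (Additive (sUnits S)) + 1 = Fintype.card (InfinitePlace K) + S.card := by
  classical
  have h1 := finrank_range_add_finrank_ker_int (sUnitsOrd S)
  rw [← range_unitsToSUnits, LinearMap.finrank_range_of_inj (unitsToSUnits_injective S),
    NumberField.Units.finrank_eq, NumberField.Units.rank] at h1
  have h2 : Module.finrank ℤ (LinearMap.range (sUnitsOrd S)) = S.card := by
    apply le_antisymm
    · refine (Submodule.finrank_le _).trans ?_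
      simp
    · choose c hc hc' using fun v : HeightOneSpectrum (𝓞 K) => exists_unit_ordv_pos v
      have hmem : ∀ v : S, c v ∈ sUnits S := fun v u hu => hc' v u (by
        rintro rfl; exact hu v.2)
      let g : (S → ℤ) →ₗ[ℤ] LinearMap.range (sUnitsOrd S) :=
        ∑ v : S, (LinearMap.toSpanSingleton ℤ _ (⟨sUnitsOrd S (Additive.ofMul ⟨c v, hmem v⟩),
          LinearMap.mem_range_self _ _⟩ : LinearMap.range (sUnitsOrd S))) ∘ₗ LinearMap.proj v
      have hg : ∀ z u, (g z : S → ℤ) u = z u * ordv u.1 (c u) := by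
        intro z u
        simp only [g, LinearMap.sum_apply, LinearMap.comp_apply, LinearMap.proj_apply,
          LinearMap.toSpanSingleton_apply, Submodule.coe_sum, Submodule.coe_smul,
          Finset.sum_apply, Pi.smul_apply, sUnitsOrd_apply, smul_eq_mul, toMul_ofMul]
        refine (Finset.sum_eq_single u ?_ (by simp)).trans rfl
        intro w _ hw
        rw [hc' w u (fun h => hw (Subtype.ext h.symm)), mul_zero]
      have hinj : Function.Injective g := by
        intro z z' h
        ext u
        have := hg z u
        rw [h, hg] at this
        exact (mul_right_cancel₀ (hc u).ne' this).symm
      have := LinearMap.finrank_le_finrank_of_injective hinj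
      simpa using this
  have h3 : 0 < Fintype.card (InfinitePlace K) := Fintype.card_pos
  omega

/-- After enlarging a finite set of places, all primes outside become principal up to it. -/
theorem exists_finset_class_trivial (K : Type*) [Field K] [NumberField K] :
    ∃ S₀ : Finset (HeightOneSpectrum (𝓞 K)), ∀ v ∉ S₀, ∃ c : Kˣ,
      ordv v c = 1 ∧ ∀ u, u ∉ S₀ → u ≠ v → ordv u c = 0 := by
  classical
  choose J hJ using fun c : ClassGroup (𝓞 K) => ClassGroup.mk0_surjective c
  have hfin : ∀ c, {v : HeightOneSpectrum (𝓞 K) | (J c : Ideal (𝓞 K)) ≤ v.asIdeal}.Finite := by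
    intro c
    have := Ideal.finite_factors (I := (J c : Ideal (𝓞 K))) (nonZeroDivisors.coe_ne_zero _)
    refine this.subset ?_
    intro v hv
    exact Ideal.dvd_iff_le.mpr hv
  refine ⟨Finset.univ.biUnion fun c => (hfin c).toFinset, ?_⟩
  intro v hv
  have hS : ∀ u ∉ (Finset.univ.biUnion fun c => (hfin c).toFinset), ∀ c,
      ¬ (J c : Ideal (𝓞 K)) ≤ u.asIdeal := by
    intro u hu c hc
    apply hu
    simp only [Finset.mem_biUnion, Finset.mem_univ, true_and, Set.Finite.mem_toFinset]
    exact ⟨c, hc⟩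
  have hv0 : v.asIdeal ≠ ⊥ := v.ne_bot
  set V : nonZeroDivisors (Ideal (𝓞 K)) := ⟨v.asIdeal, mem_nonZeroDivisors_of_ne_zero hv0⟩
  set C := (ClassGroup.mk0 V)⁻¹ with hC
  have h1 : ClassGroup.mk0 (V * J C) = 1 := by
    rw [map_mul, hJ, hC, mul_inv_cancel]
  rw [ClassGroup.mk0_eq_one_iff] at h1
  obtain ⟨c, hc⟩ := h1.principal
  have hc : v.asIdeal * (J C : Ideal (𝓞 K)) = Ideal.span {c} := hc
  have hle : ∀ I : Ideal (𝓞 K), v.asIdeal * (J C : Ideal (𝓞 K)) ≤ I ↔ c ∈ I := fun I => by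
    rw [hc]; exact Ideal.span_singleton_le_iff_mem I
  have hc0 : c ≠ 0 := by
    rintro rfl
    rw [Ideal.span_singleton_eq_bot.mpr rfl] at hc
    exact mul_ne_zero hv0 (nonZeroDivisors.coe_ne_zero (J C)) hc
  set x : Kˣ := Units.mk0 (algebraMap (𝓞 K) K c) (by simpa using hc0) with hx
  have hxc : algebraMap (𝓞 K) K c = x := rfl
  refine ⟨x, ?_, ?_⟩
  · have h2 : 0 < ordv v x := (mem_asIdeal_iff_ordv_pos hxc).mp ((hle _).mp Ideal.mul_le_left)
    have h3 : ¬ ((2 : ℕ) : ℤ) ≤ ordv v x := by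
      rw [← mem_pow_iff_le_ordv hxc]
      intro h
      have h4 : v.asIdeal * (J C : Ideal (𝓞 K)) ≤ v.asIdeal ^ 2 := (hle _).mpr h
      rw [← Ideal.dvd_iff_le, pow_two] at h4
      exact hS v hv C (Ideal.dvd_iff_le.mp ((mul_dvd_mul_iff_left hv0).mp h4))
    push_cast at h3
    omega
  · intro u hu huv
    have h2 : ¬ c ∈ u.asIdeal := by
      intro hcu
      have h5 : v.asIdeal * (J C : Ideal (𝓞 K)) ≤ u.asIdeal := (hle _).mpr hcu
      rcases (u.isPrime.mul_le).mp h5 with h | h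
      · exact huv (HeightOneSpectrum.ext (v.isMaximal.eq_of_le u.isPrime.ne_top h).symm)
      · exact hS u hu C h
    rw [mem_asIdeal_iff_ordv_pos hxc] at h2
    have := ordv_nonneg_of_integer (v := u) hxc
    omega

end

end

section

open IsDedekindDomain NumberField WithZero
open scoped Pointwise

section
variable (K : Type*) {L : Type*} [Field K] [NumberField K] [Field L] [NumberField L] [Algebra K L]

/-- The place of `K` below a place of `L`. -/
def placeBelow (P : HeightOneSpectrum (𝓞 L)) : HeightOneSpectrum (𝓞 K) where
  asIdeal := P.asIdeal.under (𝓞 K)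
  isPrime := inferInstance
  ne_bot := fun h => P.ne_bot (Ideal.eq_bot_of_comap_eq_bot h)

instance liesOver_placeBelow (P : HeightOneSpectrum (𝓞 L)) :
    P.asIdeal.LiesOver (placeBelow K P).asIdeal := ⟨rfl⟩

variable {K}

theorem liesOver_iff_placeBelow {P : HeightOneSpectrum (𝓞 L)} {v : HeightOneSpectrum (𝓞 K)} :
    P.asIdeal.LiesOver v.asIdeal ↔ placeBelow K P = v := by
  constructor
  · intro h
    exact HeightOneSpectrum.ext h.over.symm
  · rintro rfl
    infer_instance

theorem exists_placeBelow_eq (v : HeightOneSpectrum (𝓞 K)) :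
    ∃ P : HeightOneSpectrum (𝓞 L), placeBelow K P = v := by
  obtain ⟨Q, hQ, hQ'⟩ := Ideal.exists_maximal_ideal_liesOver_of_isIntegral (S := 𝓞 L) v.asIdeal
  have h0 : Q ≠ ⊥ := Ideal.ne_bot_of_liesOver_of_ne_bot v.ne_bot Q
  exact ⟨⟨Q, hQ.isPrime, h0⟩, liesOver_iff_placeBelow.mp hQ'⟩

/-- The places above `v` as primes over the ideal of `v`. -/
theorem image_asIdeal_placeBelow (v : HeightOneSpectrum (𝓞 K)) :
    HeightOneSpectrum.asIdeal '' {P : HeightOneSpectrum (𝓞 L) | placeBelow K P = v} =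
      Ideal.primesOver v.asIdeal (𝓞 L) := by
  ext Q
  constructor
  · rintro ⟨P, hP, rfl⟩
    exact ⟨P.isPrime, liesOver_iff_placeBelow.mpr hP⟩
  · rintro ⟨h1, h2⟩
    have h0 : Q ≠ ⊥ := Ideal.ne_bot_of_liesOver_of_ne_bot v.ne_bot Q
    exact ⟨⟨Q, h1, h0⟩, liesOver_iff_placeBelow.mp h2, rfl⟩

theorem asIdeal_injective {R : Type*} [CommRing R] :
    Function.Injective (HeightOneSpectrum.asIdeal : HeightOneSpectrum R → Ideal R) :=
  fun _ _ h => HeightOneSpectrum.ext h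

theorem finite_placeBelow_eq (v : HeightOneSpectrum (𝓞 K)) :
    {P : HeightOneSpectrum (𝓞 L) | placeBelow K P = v}.Finite := by
  apply Set.Finite.of_finite_image _ asIdeal_injective.injOn
  rw [image_asIdeal_placeBelow]
  exact Algebra.QuasiFinite.finite_primesOver _

theorem ncard_placeBelow_eq (v : HeightOneSpectrum (𝓞 K)) :
    {P : HeightOneSpectrum (𝓞 L) | placeBelow K P = v}.ncard =
      (Ideal.primesOver v.asIdeal (𝓞 L)).ncard := by
  rw [← image_asIdeal_placeBelow, Set.ncard_image_of_injective _ asIdeal_injective]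

/-- The inclusion on unit groups. -/
noncomputable abbrev unitsIncl (K L : Type*) [Field K] [Field L] [Algebra K L] : Kˣ →* Lˣ :=
  Units.map (algebraMap K L : K →* L)

variable (K) in
/-- The ramification index over `K`. -/
noncomputable abbrev ramK (P : HeightOneSpectrum (𝓞 L)) : ℕ := P.asIdeal.ramificationIdx (𝓞 K)

variable (K) in
/-- The inertia degree over `K`. -/
noncomputable abbrev inertK (P : HeightOneSpectrum (𝓞 L)) : ℕ := P.asIdeal.inertiaDeg (𝓞 K)

theorem valuation_algebraMap_eq (P : HeightOneSpectrum (𝓞 L)) (x : K) :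
    P.valuation L (algebraMap K L x) = (placeBelow K P).valuation K x ^ ramK K P := by
  rw [ramK, ← Ideal.ramificationIdx'_eq_ramificationIdx (placeBelow K P).asIdeal P.asIdeal
    (placeBelow K P).ne_bot]
  exact (HeightOneSpectrum.valuation_liesOver L (placeBelow K P) P x).symm

theorem ordv_unitsIncl (P : HeightOneSpectrum (𝓞 L)) (x : Kˣ) :
    ordv P (unitsIncl K L x) = ramK K P * ordv (placeBelow K P) x := by
  rw [ordv_eq_iff]
  have := valuation_algebraMap_eq P (x : K)
  rw [valuation_eq_exp_ordv, ← exp_nsmul] at this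
  rw [show ((unitsIncl K L x : Lˣ) : L) = algebraMap K L x from rfl, this]
  simp

theorem ramK_ne_zero (P : HeightOneSpectrum (𝓞 L)) : ramK K P ≠ 0 := by
  rw [ramK, ← Ideal.ramificationIdx'_eq_ramificationIdx (placeBelow K P).asIdeal P.asIdeal
    (placeBelow K P).ne_bot]
  exact Ideal.IsDedekindDomain.ramificationIdx'_ne_zero_of_liesOver P.asIdeal (placeBelow K P).ne_bot

theorem ordv_unitsIncl_eq_zero_iff (P : HeightOneSpectrum (𝓞 L)) (x : Kˣ) :
    ordv P (unitsIncl K L x) = 0 ↔ ordv (placeBelow K P) x = 0 := by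
  rw [ordv_unitsIncl]
  simp [ramK_ne_zero]

theorem card_quotient_eq (P : HeightOneSpectrum (𝓞 L)) :
    Ideal.absNorm P.asIdeal = Ideal.absNorm (placeBelow K P).asIdeal ^ inertK K P := by
  rw [inertK, ← Ideal.inertiaDeg'_eq_inertiaDeg (placeBelow K P).asIdeal P.asIdeal]
  exact Ideal.absNorm_eq_pow_inertiaDeg'_of_liesOver _ _ (placeBelow K P).isPrime
    (placeBelow K P).ne_bot

/-- With residue degree one, residues come from the base field. -/
theorem exists_sub_mem_of_inertK_eq_one {P : HeightOneSpectrum (𝓞 L)} (h : inertK K P = 1)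
    (x : 𝓞 L) : ∃ c : 𝓞 K, x - algebraMap (𝓞 K) (𝓞 L) c ∈ P.asIdeal := by
  rw [inertK, Ideal.inertiaDeg_eq_of_isMaximal (placeBelow K P).asIdeal P.asIdeal] at h
  let := Ideal.Quotient.field (placeBelow K P).asIdeal
  have h1 := Subalgebra.bot_eq_top_of_finrank_eq_one h
  have h2 : (Ideal.Quotient.mk P.asIdeal x) ∈ (⊤ : Subalgebra (𝓞 K ⧸ (placeBelow K P).asIdeal)
    (𝓞 L ⧸ P.asIdeal)) := trivial
  rw [← h1, Algebra.mem_bot] at h2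
  obtain ⟨c, hc⟩ := h2
  obtain ⟨c, rfl⟩ := Ideal.Quotient.mk_surjective c
  refine ⟨c, ?_⟩
  rw [← Ideal.Quotient.eq, ← hc]
  rfl

/-- The action of a field automorphism on units. -/
abbrev galU (σ : Gal(L/K)) : Lˣ →* Lˣ := Units.map (σ : L →* L)

theorem exists_ratio (x : Lˣ) : ∃ r s : 𝓞 L, ∃ r' s' : Lˣ, algebraMap (𝓞 L) L r = r' ∧
    algebraMap (𝓞 L) L s = s' ∧ x = r' * s'⁻¹ := by
  obtain ⟨r, s, hs, h⟩ := IsFractionRing.div_surjective (A := 𝓞 L) (x : L)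
  have hs0 : algebraMap (𝓞 L) L s ≠ 0 := by
    simpa using nonZeroDivisors.ne_zero hs
  have hr0 : algebraMap (𝓞 L) L r ≠ 0 := by
    intro h0
    rw [h0, zero_div] at h
    exact x.ne_zero h.symm
  refine ⟨r, s, Units.mk0 _ hr0, Units.mk0 _ hs0, rfl, rfl, ?_⟩
  ext
  rw [← h]
  simp [div_eq_mul_inv]

theorem ordv_eq_of_forall_mem {P Q : HeightOneSpectrum (𝓞 L)} (σ : Gal(L/K))
    (h : ∀ (n : ℕ) (r : 𝓞 L), r ∈ Q.asIdeal ^ n ↔ σ • r ∈ P.asIdeal ^ n) (y : Lˣ) :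
    ordv Q y = ordv P (galU σ y) := by
  have key : ∀ (r : 𝓞 L) (r' : Lˣ), algebraMap (𝓞 L) L r = r' →
      ordv Q r' = ordv P (galU σ r') := by
    intro r r' hr
    have hr' : algebraMap (𝓞 L) L (σ • r) = (galU σ r' : Lˣ) := by
      have : algebraMap (𝓞 L) L (σ • r) = σ (algebraMap (𝓞 L) L r) := rfl
      rw [this, hr]; rfl
    have h1 := ordv_nonneg_of_integer (v := Q) hr
    have h2 := ordv_nonneg_of_integer (v := P) hr'
    have h3 := fun n => (mem_pow_iff_le_ordv (v := Q) hr n).symm.trans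
      ((h n r).trans (mem_pow_iff_le_ordv (v := P) hr' n))
    have h4 := (h3 (ordv Q r').toNat).mp (by omega)
    have h5 := (h3 (ordv P (galU σ r')).toNat).mpr (by omega)
    omega
  obtain ⟨r, s, a, b, hr, hs, rfl⟩ := exists_ratio y
  rw [map_mul, map_inv, ordv_mul, ordv_mul, ordv_inv, ordv_inv, key r a hr, key s b hs]

/-- The place obtained by composing with an automorphism. -/
theorem exists_ordv_galU [IsGalois K L] (σ : Gal(L/K)) (P : HeightOneSpectrum (𝓞 L)) :
    ∃ Q : HeightOneSpectrum (𝓞 L), placeBelow K Q = placeBelow K P ∧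
      ∀ y, ordv Q y = ordv P (galU σ y) := by
  have := (inferInstance : IsGaloisGroup Gal(L/K) (𝓞 K) (𝓞 L)).commutes
  have h1 : (σ⁻¹ • P.asIdeal).LiesOver (placeBelow K P).asIdeal := Ideal.LiesOver.smul _
  have h0 : σ⁻¹ • P.asIdeal ≠ ⊥ :=
    Ideal.ne_bot_of_liesOver_of_ne_bot (placeBelow K P).ne_bot _
  refine ⟨⟨σ⁻¹ • P.asIdeal, inferInstance, h0⟩, liesOver_iff_placeBelow.mp h1, ?_⟩
  apply ordv_eq_of_forall_mem
  intro n r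
  change r ∈ (σ⁻¹ • P.asIdeal) ^ n ↔ _
  rw [← smul_pow', Ideal.mem_inv_pointwise_smul_iff]

/-- The Galois group acts transitively on places above a given one. -/
theorem exists_galU_of_placeBelow_eq [IsGalois K L] {P Q : HeightOneSpectrum (𝓞 L)}
    (h : placeBelow K Q = placeBelow K P) :
    ∃ σ : Gal(L/K), ∀ y, ordv Q y = ordv P (galU σ y) := by
  have h1 : Q.asIdeal.LiesOver (placeBelow K P).asIdeal := liesOver_iff_placeBelow.mpr h
  obtain ⟨τ, hτ⟩ := Ideal.exists_smul_eq_of_isGaloisGroup (placeBelow K P).asIdeal P.asIdeal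
    Q.asIdeal (Gal(L/K))
  refine ⟨τ⁻¹, ?_⟩
  apply ordv_eq_of_forall_mem
  intro n r
  rw [← hτ, ← smul_pow', Ideal.mem_pointwise_smul_iff_inv_smul_mem]

/-- Decomposition types in a Galois extension of prime degree. -/
theorem prime_degree_cases [IsGalois K L] {p : ℕ} (hp : p.Prime) (hL : Module.finrank K L = p)
    (v : HeightOneSpectrum (𝓞 K)) :
    ({P : HeightOneSpectrum (𝓞 L) | placeBelow K P = v}.ncard = p ∧
      ∀ P : HeightOneSpectrum (𝓞 L), placeBelow K P = v → ramK K P = 1 ∧ inertK K P = 1) ∨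
    ((∀ P Q : HeightOneSpectrum (𝓞 L), placeBelow K P = v → placeBelow K Q = v → P = Q) ∧
      ∀ P : HeightOneSpectrum (𝓞 L), placeBelow K P = v →
        (ramK K P = p ∧ inertK K P = 1) ∨ (ramK K P = 1 ∧ inertK K P = p)) := by
  have h := Ideal.ncard_primesOver_mul_ramificationIdxIn_mul_inertiaDegIn v.asIdeal (𝓞 L)
    (Gal(L/K))
  rw [IsGalois.card_aut_eq_finrank, hL, ← ncard_placeBelow_eq] at h
  have h1 : ∀ P : HeightOneSpectrum (𝓞 L), placeBelow K P = v →
      ramK K P = v.asIdeal.ramificationIdxIn (𝓞 L) ∧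
      inertK K P = v.asIdeal.inertiaDegIn (𝓞 L) := by
    intro P hP
    have : P.asIdeal.LiesOver v.asIdeal := liesOver_iff_placeBelow.mpr hP
    exact ⟨(Ideal.ramificationIdxIn_eq_ramificationIdx v.asIdeal P.asIdeal Gal(L/K)).symm,
      (Ideal.inertiaDegIn_eq_inertiaDeg v.asIdeal P.asIdeal Gal(L/K)).symm⟩
  rcases (Nat.dvd_prime hp).mp (Dvd.intro _ h) with h2 | h2
  · right
    refine ⟨?_, ?_⟩
    · obtain ⟨a, ha⟩ := Set.ncard_eq_one.mp h2
      intro P Q hP hQ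
      have hP' : P ∈ ({a} : Set _) := ha ▸ hP
      have hQ' : Q ∈ ({a} : Set _) := ha ▸ hQ
      exact hP'.trans hQ'.symm
    · intro P hP
      rw [(h1 P hP).1, (h1 P hP).2]
      rw [h2, one_mul] at h
      rcases (Nat.dvd_prime hp).mp (Dvd.intro _ h) with h3 | h3
      · right
        rw [h3, one_mul] at h
        exact ⟨h3, h⟩
      · left
        rw [h3] at h
        exact ⟨h3, by simpa [hp.ne_zero] using h⟩
  · left
    refine ⟨h2, ?_⟩
    intro P hP
    rw [(h1 P hP).1, (h1 P hP).2]
    rw [h2] at h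
    have h3 : v.asIdeal.ramificationIdxIn (𝓞 L) * v.asIdeal.inertiaDegIn (𝓞 L) = 1 := by
      simpa [hp.ne_zero] using h
    exact mul_eq_one.mp h3

end

end

section

open IsDedekindDomain NumberField WithZero

section
variable {K L : Type*} [Field K] [NumberField K] [Field L] [NumberField L] [Algebra K L]

/-- The units which are close to `1` at the place `v`. -/
def unitBall (v : HeightOneSpectrum (𝓞 K)) (r : ℤᵐ⁰) : Subgroup Kˣ where
  carrier := {x | v.valuation K ((x : K) - 1) < 1 ∧ v.valuation K ((x : K) - 1) < r ∨ x = 1}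
  one_mem' := Or.inr rfl
  mul_mem' := by
    rintro x y (⟨hx, hx'⟩ | rfl) (⟨hy, hy'⟩ | rfl)
    · left
      have h1 : ((x * y : Kˣ) : K) - 1 = (x - 1) * (y - 1) + ((x - 1) + (y - 1)) := by
        push_cast; ring
      rw [h1]
      have h2 : v.valuation K (((x : K) - 1) * (y - 1)) ≤ v.valuation K ((x : K) - 1) := by
        rw [map_mul]
        exact mul_le_of_le_one_right' hy.le
      exact ⟨Valuation.map_add_lt _ (h2.trans_lt hx) (Valuation.map_add_lt _ hx hy),
        Valuation.map_add_lt _ (h2.trans_lt hx') (Valuation.map_add_lt _ hx' hy')⟩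
    · left; simpa using ⟨hx, hx'⟩
    · left; simpa using ⟨hy, hy'⟩
    · right; simp
  inv_mem' := by
    rintro x (⟨hx, hx'⟩ | rfl)
    · left
      have h0 : v.valuation K (x : K) = 1 := by
        have := Valuation.map_one_add_of_lt _ hx
        simpa using this
      have h1 : ((x⁻¹ : Kˣ) : K) - 1 = - ((x : K) - 1) * (x : K)⁻¹ := by
        rw [Units.val_inv_eq_inv_val]
        field_simp
        ring
      rw [h1, map_mul, Valuation.map_neg, map_inv₀, h0]
      simpa using ⟨hx, hx'⟩
    · right; simp

theorem mem_unitBall {v : HeightOneSpectrum (𝓞 K)} {r : ℤᵐ⁰} (hr : r ≤ 1) (hr0 : r ≠ 0) {x : Kˣ} :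
    x ∈ unitBall v r ↔ v.valuation K ((x : K) - 1) < r := by
  constructor
  · rintro (⟨_, h⟩ | rfl)
    · exact h
    · simpa using zero_lt_iff.mpr hr0
  · exact fun h => Or.inl ⟨h.trans_le hr, h⟩

theorem ordv_eq_zero_of_mem_unitBall {v : HeightOneSpectrum (𝓞 K)} {r : ℤᵐ⁰} {x : Kˣ}
    (h : x ∈ unitBall v r) : ordv v x = 0 := by
  rcases h with ⟨h, _⟩ | rfl
  · rw [ordv_eq_zero_iff]
    have := Valuation.map_one_add_of_lt _ h
    simpa using this
  · simp

/-- The local group at `v` of elements which are `p`-th powers up to a factor close to `1`. -/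
noncomputable def locPow (p : ℕ) (ζ : Kˣ) (v : HeightOneSpectrum (𝓞 K)) : Subgroup Kˣ :=
  unitBall v (v.valuation K (1 - ζ) ^ p) ⊔ (powMonoidHom p : Kˣ →* Kˣ).range

theorem pow_mem_locPow {p : ℕ} (ζ : Kˣ) (v : HeightOneSpectrum (𝓞 K)) (x : Kˣ) :
    x ^ p ∈ locPow p ζ v := Subgroup.mem_sup_right ⟨x, rfl⟩

theorem exists_of_mem_locPow {p : ℕ} {ζ : Kˣ} {v : HeightOneSpectrum (𝓞 K)} {x : Kˣ}
    (h : x ∈ locPow p ζ v) : ∃ u ∈ unitBall v (v.valuation K (1 - ζ) ^ p), ∃ z : Kˣ,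
      x = u * z ^ p := by
  obtain ⟨u, hu, _, ⟨z, rfl⟩, rfl⟩ := Subgroup.mem_sup.mp h
  exact ⟨u, hu, z, rfl⟩

theorem dvd_ordv_of_mem_locPow {p : ℕ} {ζ : Kˣ} {v : HeightOneSpectrum (𝓞 K)} {x : Kˣ}
    (h : x ∈ locPow p ζ v) : (p : ℤ) ∣ ordv v x := by
  obtain ⟨u, hu, z, rfl⟩ := exists_of_mem_locPow h
  rw [ordv_mul, ordv_eq_zero_of_mem_unitBall hu, ordv_pow, zero_add]
  exact Dvd.intro _ rfl

/-- A Kummer extension of prime degree, with a chosen generator and automorphism. -/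
structure IsKummer (p : ℕ) (ζ x : Kˣ) (ξ : Lˣ) (σ : Gal(L/K)) : Prop where
  prime : p.Prime
  prim : IsPrimitiveRoot ζ p
  pow_eq : ξ ^ p = unitsIncl K L x
  galU_eq : galU σ ξ = unitsIncl K L ζ * ξ
  finrank_eq : Module.finrank K L = p
  isGalois : IsGalois K L

theorem galU_unitsIncl (σ : Gal(L/K)) (x : Kˣ) : galU σ (unitsIncl K L x) = unitsIncl K L x := by
  ext; simp

theorem galU_mul_apply (σ τ : Gal(L/K)) (y : Lˣ) : galU (σ * τ) y = galU σ (galU τ y) := rfl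

/-- The norm on unit groups. -/
noncomputable abbrev normU (K L : Type*) [Field K] [Field L] [Algebra K L] : Lˣ →* Kˣ :=
  Units.map (Algebra.norm K : L →* K)

theorem unitsIncl_normU [IsGalois K L] (y : Lˣ) :
    unitsIncl K L (normU K L y) = ∏ τ : Gal(L/K), galU τ y := by
  ext
  simp [Algebra.norm_eq_prod_automorphisms]

/-- `v` does not split in `L`. -/
def IsNonsplit (L : Type*) [Field L] [NumberField L] [Algebra K L]
    (v : HeightOneSpectrum (𝓞 K)) : Prop :=
  ∀ P Q : HeightOneSpectrum (𝓞 L), placeBelow K P = v → placeBelow K Q = v → P = Q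

theorem ordv_galU_of_isNonsplit [IsGalois K L] {v : HeightOneSpectrum (𝓞 K)}
    (h : IsNonsplit L v) {P : HeightOneSpectrum (𝓞 L)} (hP : placeBelow K P = v) (σ : Gal(L/K))
    (y : Lˣ) : ordv P (galU σ y) = ordv P y := by
  obtain ⟨Q, hQ, hQ'⟩ := exists_ordv_galU σ P
  rw [← hQ', h Q P (hQ.trans hP) hP]

theorem valuation_gal_of_isNonsplit [IsGalois K L] {v : HeightOneSpectrum (𝓞 K)}
    (h : IsNonsplit L v) {P : HeightOneSpectrum (𝓞 L)} (hP : placeBelow K P = v) (σ : Gal(L/K))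
    (y : L) : P.valuation L (σ y) = P.valuation L y := by
  by_cases hy : y = 0
  · simp [hy]
  · have := ordv_galU_of_isNonsplit h hP σ (Units.mk0 y hy)
    have h1 := valuation_eq_exp_ordv P (galU σ (Units.mk0 y hy))
    rw [this, ← valuation_eq_exp_ordv] at h1
    exact h1

theorem ordv_normU_of_isNonsplit [IsGalois K L] {v : HeightOneSpectrum (𝓞 K)}
    (h : IsNonsplit L v) {P : HeightOneSpectrum (𝓞 L)} (hP : placeBelow K P = v) (y : Lˣ) :
    ramK K P * ordv v (normU K L y) = Module.finrank K L * ordv P y := by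
  have h1 := congrArg (ordv P) (unitsIncl_normU (K := K) y)
  rw [ordv_unitsIncl, hP] at h1
  rw [h1]
  have h2 : ∀ s : Finset Gal(L/K), ordv P (∏ τ ∈ s, galU τ y) = s.card * ordv P y := by
    classical
    intro s
    induction s using Finset.induction_on with
    | empty => simp
    | insert a s ha ih =>
      rw [Finset.prod_insert ha, ordv_mul, ih, ordv_galU_of_isNonsplit h hP,
        Finset.card_insert_of_notMem ha]
      push_cast; ring
  rw [h2, ← IsGalois.card_aut_eq_finrank, Finset.card_univ, Nat.card_eq_fintype_card]

theorem exists_valuation_sub_lt_of_inertK_eq_one {P : HeightOneSpectrum (𝓞 L)}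
    (h : inertK K P = 1) {y : L} (hy : P.valuation L y ≤ 1) :
    ∃ d : 𝓞 K, P.valuation L (y - algebraMap K L d) < 1 := by
  obtain ⟨r, hr⟩ := P.exists_valuation_sub_lt_of_integer (γ := 1) hy
  obtain ⟨d, hd⟩ := exists_sub_mem_of_inertK_eq_one h r
  refine ⟨d, ?_⟩
  have h1 : P.valuation L (algebraMap (𝓞 L) L (r - algebraMap (𝓞 K) (𝓞 L) d)) < 1 :=
    (P.valuation_lt_one_iff_mem _).mpr hd
  have h2 : y - algebraMap K L d = (y - algebraMap (𝓞 L) L r) +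
      algebraMap (𝓞 L) L (r - algebraMap (𝓞 K) (𝓞 L) d) := by
    have h3 : algebraMap (𝓞 L) L (algebraMap (𝓞 K) (𝓞 L) d) =
      algebraMap K L (algebraMap (𝓞 K) K d) := rfl
    rw [map_sub, h3]
    ring
  rw [h2]
  refine Valuation.map_add_lt _ ?_ h1
  rw [Valuation.map_sub_swap]
  simpa using hr

namespace IsKummer
variable {p : ℕ} {ζ x : Kˣ} {ξ : Lˣ} {σ : Gal(L/K)}

theorem pow_galU (h : IsKummer p ζ x ξ σ) (i : ℕ) :
    galU (σ ^ i) ξ = unitsIncl K L (ζ ^ i) * ξ := by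
  induction i with
  | zero => ext; simp
  | succ n ih =>
    rw [pow_succ, galU_mul_apply, h.galU_eq, map_mul, galU_unitsIncl, ih, pow_succ, map_mul]
    rw [← mul_assoc, mul_comm (unitsIncl K L ζ)]

theorem valuation_one_sub_ne_zero (h : IsKummer p ζ x ξ σ) (v : HeightOneSpectrum (𝓞 K)) :
    v.valuation K (1 - ζ) ≠ 0 := by
  rw [Valuation.ne_zero_iff, sub_ne_zero]
  intro h1
  exact h.prim.ne_one h.prime.one_lt (Units.ext h1.symm)

theorem ordv_root (h : IsKummer p ζ x ξ σ) (v : HeightOneSpectrum (𝓞 K)) : ordv v ζ = 0 := by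
  have h1 := ordv_pow v ζ p
  rw [h.prim.pow_eq_one, ordv_one] at h1
  have := h.prime.ne_zero
  simpa [this] using h1

theorem valuation_one_sub_le_one (h : IsKummer p ζ x ξ σ) (v : HeightOneSpectrum (𝓞 K)) :
    v.valuation K (1 - ζ) ≤ 1 := by
  refine (Valuation.map_sub _ _ _).trans ?_
  rw [ordv_eq_zero_iff.mp (h.ordv_root v)]
  simp

/-- Elements locally close to `p`-th powers have split Kummer extensions. -/
theorem not_isNonsplit_of_mem_locPow (h : IsKummer p ζ x ξ σ) {v : HeightOneSpectrum (𝓞 K)}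
    (hx : x ∈ locPow p ζ v) : ¬ IsNonsplit L v := by
  intro hns
  have := h.isGalois
  obtain ⟨P, hP⟩ := exists_placeBelow_eq (L := L) v
  obtain ⟨u, hu, z, rfl⟩ := exists_of_mem_locPow hx
  have hu0 := ordv_eq_zero_of_mem_unitBall hu
  rw [mem_unitBall (pow_le_one' (h.valuation_one_sub_le_one v) p)
    (pow_ne_zero _ (h.valuation_one_sub_ne_zero v))] at hu
  set η : Lˣ := ξ * (unitsIncl K L z)⁻¹ with hη
  have h1 : η ^ p = unitsIncl K L u := by
    rw [hη, mul_pow, h.pow_eq, map_mul, map_pow, inv_pow, mul_inv_cancel_right]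
  have h2 : ∀ i : ℕ, galU (σ ^ i) η = unitsIncl K L (ζ ^ i) * η := by
    intro i
    rw [hη, map_mul, map_inv, galU_unitsIncl, h.pow_galU, mul_assoc]
  have hη0 : P.valuation L (η : L) = 1 := by
    rw [← ordv_eq_zero_iff]
    have h3 := congrArg (ordv P) h1
    rw [ordv_pow, ordv_unitsIncl, hP, hu0, mul_zero] at h3
    simpa [h.prime.ne_zero] using h3
  have h4 : ∀ i : ℕ, P.valuation L (1 - algebraMap K L ((ζ ^ i : Kˣ) : K) * η) =
      P.valuation L (1 - (η : L)) := by
    intro i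
    have h0 : (σ ^ i) (η : L) = algebraMap K L ((ζ ^ i : Kˣ) : K) * η := congrArg Units.val (h2 i)
    have h0' : (σ ^ i) (1 - (η : L)) = 1 - algebraMap K L ((ζ ^ i : Kˣ) : K) * η := by
      rw [← h0, map_sub, map_one]
    rw [← valuation_gal_of_isNonsplit hns hP (σ ^ i) (1 - (η : L)), h0']
  have hprim : IsPrimitiveRoot (algebraMap K L ζ) p :=
    (IsPrimitiveRoot.coe_units_iff.mpr h.prim).map_of_injective (algebraMap K L).injective
  have h5 : (1 : L) - algebraMap K L u = ∏ μ ∈ Polynomial.nthRootsFinset p (1 : L), (1 - μ * η) := by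
    have h6 := hprim.pow_sub_pow_eq_prod_sub_mul (1 : L) η h.prime.pos
    rw [one_pow] at h6
    rw [← h6]
    have := congrArg Units.val h1
    simp only [Units.coe_map, Units.val_pow_eq_pow_val] at this
    rw [this]; rfl
  have h7 : P.valuation L (1 - algebraMap K L (u : K)) = P.valuation L (1 - (η : L)) ^ p := by
    have h6 : P.valuation L (1 - (η : L)) ^ p =
        ∏ _μ ∈ Polynomial.nthRootsFinset p (1 : L), P.valuation L (1 - (η : L)) := by
      rw [Finset.prod_const, hprim.card_nthRootsFinset]
    rw [h5, map_prod, h6]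
    apply Finset.prod_congr rfl
    intro μ hμ
    rw [Polynomial.mem_nthRootsFinset h.prime.pos] at hμ
    have : NeZero p := ⟨h.prime.ne_zero⟩
    obtain ⟨i, _, hi⟩ := hprim.eq_pow_of_pow_eq_one hμ
    rw [← h4 i, ← hi]
    simp
  have h8 : P.valuation L (1 - (η : L)) ^ p < P.valuation L (algebraMap K L (1 - ζ)) ^ p := by
    rw [← h7, ← map_one (algebraMap K L), ← map_sub, valuation_algebraMap_eq, hP,
      valuation_algebraMap_eq, hP, Valuation.map_sub_swap, ← pow_mul, mul_comm, pow_mul]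
    exact pow_lt_pow_left₀ hu zero_le (ramK_ne_zero P)
  have h9 := lt_of_pow_lt_pow_left₀ p zero_le h8
  have h10 : algebraMap K L (1 - ζ) * η =
      (1 - algebraMap K L ((ζ ^ 1 : Kˣ) : K) * η) - (1 - (η : L)) := by
    simp; ring
  have h11 := Valuation.map_sub (P.valuation L) (1 - algebraMap K L ((ζ ^ 1 : Kˣ) : K) * η)
    (1 - (η : L))
  rw [← h10, map_mul, hη0, mul_one, h4, max_self] at h11
  exact absurd h9 (not_lt.mpr h11)

/-- A place away from `p` at which `x` has valuation divisible by `p` is unramified. -/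
theorem ramK_eq_one (h : IsKummer p ζ x ξ σ) {v : HeightOneSpectrum (𝓞 K)}
    (hv : v.valuation K (1 - ζ) = 1) (hx : (p : ℤ) ∣ ordv v x) {P : HeightOneSpectrum (𝓞 L)}
    (hP : placeBelow K P = v) : ramK K P = 1 := by
  have := h.isGalois
  rcases prime_degree_cases h.prime h.finrank_eq v with ⟨_, h1⟩ | ⟨hns, h1⟩
  · exact (h1 P hP).1
  · rcases h1 P hP with ⟨_, hf⟩ | ⟨he, _⟩
    · exfalso
      obtain ⟨k, hk⟩ := hx
      obtain ⟨π, hπ⟩ := exists_ordv_eq_one v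
      set η : Lˣ := ξ * (unitsIncl K L (π ^ k))⁻¹ with hη
      have hη1 : ordv P η = 0 := by
        have h3 := congrArg (ordv P) h.pow_eq
        rw [ordv_pow, ordv_unitsIncl, hP, hk] at h3
        rw [hη, ordv_mul, ordv_inv, ordv_unitsIncl, hP, ordv_zpow, hπ, mul_one]
        have hp0 : (p : ℤ) ≠ 0 := by exact_mod_cast h.prime.ne_zero
        have : (p : ℤ) * (ordv P ξ - ramK K P * k) = 0 := by rw [mul_sub, h3]; ring
        rcases mul_eq_zero.mp this with h4 | h4
        · exact absurd h4 hp0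
        · linarith
      rw [ordv_eq_zero_iff] at hη1
      have h2 : σ (η : L) = algebraMap K L ζ * η := by
        have : galU σ η = unitsIncl K L ζ * η := by
          rw [hη, map_mul, map_inv, galU_unitsIncl, h.galU_eq, mul_assoc]
        exact congrArg Units.val this
      obtain ⟨d, hd⟩ := exists_valuation_sub_lt_of_inertK_eq_one hf hη1.le
      have hd' := hd
      rw [← valuation_gal_of_isNonsplit hns hP σ, map_sub, AlgEquiv.commutes, h2] at hd'
      have h3 : algebraMap K L (1 - ζ) * η = ((η : L) - algebraMap K L d) -
          (algebraMap K L ζ * η - algebraMap K L d) := by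
        simp; ring
      have h4 := Valuation.map_sub_lt (P.valuation L) hd hd'
      rw [← h3, map_mul, hη1, mul_one, valuation_algebraMap_eq, hP, hv, one_pow] at h4
      exact lt_irrefl _ h4
    · exact he

end IsKummer
end

end

section

open IsDedekindDomain NumberField WithZero

section
variable {G : Type*} [CommGroup G]

theorem relIndex_le_card_of {T : Type*} [Finite T] (H U : Subgroup G) (f : G → T)
    (hf : ∀ x ∈ U, ∀ y ∈ U, f x = f y → x⁻¹ * y ∈ H) :
    H.relIndex U ≠ 0 ∧ H.relIndex U ≤ Nat.card T := by
  have hinj : Function.Injective (fun q : U ⧸ H.subgroupOf U => f (Quotient.out q : U)) := by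
    intro a b hab
    have := hf _ (Quotient.out a : U).2 _ (Quotient.out b : U).2 hab
    rw [← Quotient.out_eq a, ← Quotient.out_eq b]
    exact QuotientGroup.eq.mpr this
  have := Finite.of_injective _ hinj
  exact ⟨Nat.card_pos.ne', Nat.card_le_card_of_injective _ hinj⟩

theorem index_sup_range_pow (p : ℕ) (B : Subgroup G) (hB : B.index ≠ 0) :
    (B ⊔ (powMonoidHom p : G →* G).range).index =
      B.relIndex (B.comap (powMonoidHom p)) := by
  set R := (powMonoidHom p : G →* G).range
  set C := B.comap (powMonoidHom p)
  have hBC : B ≤ C := fun x hx => Subgroup.pow_mem _ hx _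
  have h1 := Subgroup.relIndex_mul_index (le_sup_left : B ≤ B ⊔ R)
  have h2 := Subgroup.relIndex_mul_index hBC
  rw [Subgroup.relIndex_sup_left, ← Subgroup.index_comap] at h1
  have h3 : C.index ≠ 0 := fun h => hB (by rw [← h2, h, mul_zero])
  refine Nat.eq_of_mul_eq_mul_left (Nat.pos_of_ne_zero h3) ?_
  rw [h1, mul_comm, h2]

/-- A proper subgroup containing all `p`-th powers has index at least `p`. -/
theorem le_relIndex_of_pow_mem {p : ℕ} (hp : p.Prime) {H U : Subgroup G}
    (hpow : ∀ x ∈ U, x ^ p ∈ H) {x : G} (hx : x ∈ U) (hxH : x ∉ H) (h0 : H.relIndex U ≠ 0) :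
    p ≤ H.relIndex U := by
  have : Finite (U ⧸ H.subgroupOf U) := Nat.finite_of_card_ne_zero h0
  have : Fact p.Prime := ⟨hp⟩
  have h1 : orderOf (QuotientGroup.mk ⟨x, hx⟩ : U ⧸ H.subgroupOf U) = p := by
    apply orderOf_eq_prime
    · rw [← QuotientGroup.mk_pow, QuotientGroup.eq_one_iff]
      exact hpow x hx
    · rw [Ne, QuotientGroup.eq_one_iff]
      exact hxH
  rw [← h1]
  exact Nat.le_of_dvd (Nat.pos_of_ne_zero h0) (orderOf_dvd_natCard _)

/-- Independent conditions multiply indices. -/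
theorem pow_card_le_relIndex_iInf {ι : Type*} {p : ℕ} (hp : p.Prime) (s : Finset ι)
    (N : ι → Subgroup G) (U : Subgroup G) (hpow : ∀ i ∈ s, ∀ x ∈ U, x ^ p ∈ N i)
    (h0 : (⨅ i ∈ s, N i).relIndex U ≠ 0)
    (hy : ∀ i ∈ s, ∃ y ∈ U, y ∉ N i ∧ ∀ j ∈ s, j ≠ i → y ∈ N j) :
    p ^ s.card ≤ (⨅ i ∈ s, N i).relIndex U := by
  classical
  induction s using Finset.induction_on with
  | empty => simp at h0 ⊢
  | insert a s ha ih =>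
    rw [Finset.iInf_insert] at h0 ⊢
    have h1 : (⨅ i ∈ s, N i).relIndex U ≠ 0 := fun h =>
      h0 (Subgroup.relIndex_eq_zero_of_le_left inf_le_right h)
    have h2 := ih (fun i hi => hpow i (Finset.mem_insert_of_mem hi)) h1 fun i hi => by
      obtain ⟨y, h, h', h''⟩ := hy i (Finset.mem_insert_of_mem hi)
      exact ⟨y, h, h', fun j hj => h'' j (Finset.mem_insert_of_mem hj)⟩
    rw [← Subgroup.relIndex_inf_mul_relIndex] at h0 ⊢
    obtain ⟨y, h, h', h''⟩ := hy a (Finset.mem_insert_self _ _)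
    have h3 : p ≤ (N a).relIndex ((⨅ i ∈ s, N i) ⊓ U) := by
      refine le_relIndex_of_pow_mem hp (x := y) ?_ ?_ h' (left_ne_zero_of_mul h0)
      · exact fun x hx => hpow a (Finset.mem_insert_self _ _) x hx.2
      · refine ⟨?_, h⟩
        exact Subgroup.mem_iInf.mpr fun i => Subgroup.mem_iInf.mpr fun hi =>
          h'' i (Finset.mem_insert_of_mem hi) (by rintro rfl; exact ha hi)
    rw [Finset.card_insert_of_notMem ha, pow_succ']
    exact Nat.mul_le_mul h3 h2

end

section
variable {K : Type*} [Field K] [NumberField K]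

/-- Elements of valuation `0`. -/
def unitsAt (v : HeightOneSpectrum (𝓞 K)) : Subgroup Kˣ where
  carrier := {x | ordv v x = 0}
  one_mem' := ordv_one v
  mul_mem' := by
    intro x y hx hy
    simp only [Set.mem_ofPred_eq] at *
    rw [ordv_mul, hx, hy, add_zero]
  inv_mem' := by
    intro x hx
    simp only [Set.mem_ofPred_eq] at *
    rw [ordv_inv, hx, neg_zero]

theorem mem_unitsAt {v : HeightOneSpectrum (𝓞 K)} {x : Kˣ} : x ∈ unitsAt v ↔ ordv v x = 0 :=
  Iff.rfl

theorem card_quotient_pow (v : HeightOneSpectrum (𝓞 K)) (j : ℕ) :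
    Finite (𝓞 K ⧸ v.asIdeal ^ j) ∧
      Nat.card (𝓞 K ⧸ v.asIdeal ^ j) = Ideal.absNorm v.asIdeal ^ j := by
  have h0 : v.asIdeal ^ j ≠ 0 := pow_ne_zero _ v.ne_bot
  have h1 : Ideal.absNorm (v.asIdeal ^ j) ≠ 0 := by
    rw [Ne, Ideal.absNorm_eq_zero_iff]; exact h0
  have h2 : Nat.card (𝓞 K ⧸ v.asIdeal ^ j) = Ideal.absNorm (v.asIdeal ^ j) := by
    rw [Ideal.absNorm_apply, Submodule.cardQuot_apply]
  exact ⟨Nat.finite_of_card_ne_zero (h2 ▸ h1), by rw [h2, map_pow]⟩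

theorem valuation_sub_le_of_mk_eq (v : HeightOneSpectrum (𝓞 K)) (j : ℕ) {c d : 𝓞 K}
    (h : (Ideal.Quotient.mk (v.asIdeal ^ j) c) = Ideal.Quotient.mk _ d) :
    v.valuation K ((c : K) - d) ≤ exp (-(j : ℤ)) := by
  rw [Ideal.Quotient.eq] at h
  rw [← map_sub]
  have e : v.valuation K (algebraMap (𝓞 K) K (c - d)) = v.intValuation (c - d) :=
    v.valuation_of_algebraMap _
  have h1 := (v.intValuation_le_pow_iff_mem (c - d) j).mpr h
  exact e ▸ h1

/-- A residue class `mod v ^ j` for integral elements. -/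
theorem exists_residue (v : HeightOneSpectrum (𝓞 K)) (j : ℕ) : ∃ f : K → 𝓞 K ⧸ v.asIdeal ^ j,
    ∀ x y, v.valuation K x ≤ 1 → v.valuation K y ≤ 1 → f x = f y →
      v.valuation K (x - y) ≤ exp (-(j : ℤ)) := by
  have h1 : ∀ x : K, ∃ d : 𝓞 K, v.valuation K x ≤ 1 → v.valuation K ((d : K) - x) < exp (-(j : ℤ)) := by
    intro x
    by_cases hx : v.valuation K x ≤ 1
    · obtain ⟨d, hd⟩ := v.exists_valuation_sub_lt_of_integer
        (γ := Units.mk0 (exp (-(j : ℤ))) (by simp)) hx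
      exact ⟨d, fun _ => hd⟩
    · exact ⟨0, fun h => absurd h hx⟩
  choose d hd using h1
  refine ⟨fun x => Ideal.Quotient.mk _ (d x), fun x y hx hy h => ?_⟩
  have h2 := valuation_sub_le_of_mk_eq v j h
  have h3 : x - y = -((d x : K) - x) + ((d x - d y) + ((d y : K) - y)) := by ring
  rw [h3]
  refine Valuation.map_add_le _ ?_ (Valuation.map_add_le _ h2 (hd y hy).le)
  rw [Valuation.map_neg]
  exact (hd x hx).le

theorem unitBall_relIndex_unitsAt (v : HeightOneSpectrum (𝓞 K)) (n : ℕ) :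
    (unitBall v (exp (-(n : ℤ)))).relIndex (unitsAt v) ≠ 0 := by
  obtain ⟨f, hf⟩ := exists_residue v (n + 1)
  have := (card_quotient_pow v (n + 1)).1
  refine (relIndex_le_card_of _ _ (fun x : Kˣ => f x) fun x hx y hy hxy => ?_).1
  rw [mem_unitsAt, ordv_eq_zero_iff] at hx hy
  rw [mem_unitBall (by rw [← exp_zero, exp_le_exp]; lia) (by simp)]
  have h1 : ((x⁻¹ * y : Kˣ) : K) - 1 = (x : K)⁻¹ * -((x : K) - y) := by
    push_cast; field_simp; ring
  rw [h1, map_mul, map_inv₀, hx, Valuation.map_neg, inv_one, one_mul]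
  refine (hf x y hx.le hy.le hxy).trans_lt ?_
  rw [exp_lt_exp]; push_cast; lia

theorem unitBall_relIndex_unitBall_le (v : HeightOneSpectrum (𝓞 K)) (n j : ℕ) :
    (unitBall v (exp (-((n + j : ℕ) : ℤ)))).relIndex (unitBall v (exp (-(n : ℤ)))) ≤
      Ideal.absNorm v.asIdeal ^ j := by
  obtain ⟨f, hf⟩ := exists_residue v j
  obtain ⟨π, hπ⟩ := exists_ordv_eq_one v
  have hπ' : v.valuation K ((π : K) ^ (n + 1)) = exp (-((n + 1 : ℕ) : ℤ)) := by
    rw [map_pow, valuation_eq_exp_ordv, hπ, ← exp_nsmul]; simp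
  have h := (card_quotient_pow v j)
  have := h.1
  rw [← h.2]
  refine (relIndex_le_card_of _ _ (fun x : Kˣ => f ((x - 1) * ((π : K) ^ (n + 1))⁻¹))
    fun x hx y hy hxy => ?_).2
  have hx0 := ordv_eq_zero_iff.mp (ordv_eq_zero_of_mem_unitBall hx)
  rw [mem_unitBall (by rw [← exp_zero, exp_le_exp]; lia) (by simp)] at hx hy ⊢
  have key : ∀ z : Kˣ, v.valuation K ((z : K) - 1) < exp (-(n : ℤ)) →
      v.valuation K (((z : K) - 1) * ((π : K) ^ (n + 1))⁻¹) ≤ 1 := by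
    intro z hz
    rw [map_mul, map_inv₀, hπ']
    by_cases hz1 : (z : K) - 1 = 0
    · simp [hz1]
    · have h2 := valuation_eq_exp_ordv v (Units.mk0 _ hz1)
      rw [Units.val_mk0] at h2
      rw [h2] at hz ⊢
      rw [exp_lt_exp] at hz
      rw [← exp_neg, ← exp_add, ← exp_zero, exp_le_exp]
      push_cast; lia
  have h1 : ((x⁻¹ * y : Kˣ) : K) - 1 = (x : K)⁻¹ * -((π : K) ^ (n + 1) *
      ((x - 1) * ((π : K) ^ (n + 1))⁻¹ - (y - 1) * ((π : K) ^ (n + 1))⁻¹)) := by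
    push_cast; field_simp; ring
  rw [h1, map_mul, map_inv₀, hx0, Valuation.map_neg, inv_one, one_mul, map_mul, hπ']
  calc _ ≤ exp (-((n + 1 : ℕ) : ℤ)) * exp (-(j : ℤ)) :=
        mul_le_mul_right (hf _ _ (key x hx) (key y hy) hxy) _
    _ < _ := by rw [← exp_add, exp_lt_exp]; push_cast; lia

section
variable {p : ℕ} {ζ : Kˣ}

theorem valuation_root_eq_one (hp : p ≠ 0) (hζ : IsPrimitiveRoot ζ p)
    (v : HeightOneSpectrum (𝓞 K)) : v.valuation K (ζ : K) = 1 := by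
  rw [← ordv_eq_zero_iff]
  have h1 := ordv_pow v ζ p
  rw [hζ.pow_eq_one, ordv_one] at h1
  simpa [hp] using h1

/-- The order of `1 - ζ` at `v`. -/
theorem exists_valuation_one_sub_eq (hp : p.Prime) (hζ : IsPrimitiveRoot ζ p)
    (v : HeightOneSpectrum (𝓞 K)) : ∃ k : ℕ, v.valuation K (1 - (ζ : K)) = exp (-(k : ℤ)) := by
  have h0 : (1 : K) - ζ ≠ 0 := by
    rw [sub_ne_zero]
    intro h1
    exact hζ.ne_one hp.one_lt (Units.ext h1.symm)
  have h1 : v.valuation K (1 - (ζ : K)) ≤ 1 := by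
    refine (Valuation.map_sub _ _ _).trans ?_
    rw [valuation_root_eq_one hp.ne_zero hζ]
    simp
  have h2 := valuation_eq_exp_ordv v (Units.mk0 _ h0)
  rw [Units.val_mk0] at h2
  rw [h2, ← exp_zero, exp_le_exp] at h1
  refine ⟨(ordv v (Units.mk0 _ h0)).toNat, ?_⟩
  rw [h2, exp_inj]
  lia

theorem valuation_nat_prime (hp : p.Prime) (hζ : IsPrimitiveRoot ζ p)
    (v : HeightOneSpectrum (𝓞 K)) :
    v.valuation K (p : K) = v.valuation K (1 - (ζ : K)) ^ (p - 1) := by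
  have hprim : IsPrimitiveRoot (ζ : K) p := IsPrimitiveRoot.coe_units_iff.mpr hζ
  have hle : ∀ μ ν : K, IsPrimitiveRoot μ p → IsPrimitiveRoot ν p →
      v.valuation K (1 - ν) ≤ v.valuation K (1 - μ) := by
    intro μ ν hμ hν
    have : NeZero p := ⟨hp.ne_zero⟩
    obtain ⟨i, hi, rfl⟩ := hμ.eq_pow_of_pow_eq_one hν.pow_eq_one
    have h1 : v.valuation K μ = 1 :=
      valuation_root_eq_one hp.ne_zero
        (IsPrimitiveRoot.coe_units_iff.mp (show IsPrimitiveRoot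
          ((Units.mk0 μ (hμ.ne_zero hp.ne_zero) : Kˣ) : K) p from hμ)) v
    have h2 : (1 : K) - μ ^ i = (∑ j ∈ Finset.range i, μ ^ j) * (1 - μ) := by
      rw [← geom_sum_mul_neg]
    rw [h2, map_mul]
    refine mul_le_of_le_one_left' (Valuation.map_sum_le _ fun j _ => ?_)
    rw [map_pow, h1, one_pow]
  have h1 := Polynomial.cyclotomic_eq_prod_X_sub_primitiveRoots hprim
  have : Fact p.Prime := ⟨hp⟩
  have h2 := congrArg (Polynomial.eval 1) h1
  rw [Polynomial.eval_one_cyclotomic_prime, Polynomial.eval_prod] at h2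
  rw [h2, map_prod, Finset.prod_congr rfl (g := fun _ => v.valuation K (1 - (ζ : K))),
    Finset.prod_const, hprim.card_primitiveRoots, Nat.totient_prime hp]
  intro μ hμ
  have hμ' := (mem_primitiveRoots hp.pos).mp hμ
  simp only [Polynomial.eval_sub, Polynomial.eval_X, Polynomial.eval_C]
  exact le_antisymm (hle _ _ hprim hμ') (hle _ _ hμ' hprim)

theorem locPow_subgroupOf (v : HeightOneSpectrum (𝓞 K)) (hp : p ≠ 0) :
    (locPow p ζ v).subgroupOf (unitsAt v) =
      (unitBall v (v.valuation K (1 - ζ) ^ p)).subgroupOf (unitsAt v) ⊔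
        (powMonoidHom p : unitsAt v →* unitsAt v).range := by
  ext ⟨x, hx⟩
  rw [Subgroup.mem_subgroupOf, Subgroup.mem_sup]
  constructor
  · intro h
    obtain ⟨u, hu, z, hz⟩ := exists_of_mem_locPow h
    have hu0 := ordv_eq_zero_of_mem_unitBall hu
    have hz0 : ordv v z = 0 := by
      rw [mem_unitsAt] at hx
      change x = _ at hz
      rw [hz, ordv_mul, hu0, ordv_pow] at hx
      simpa [hp] using hx
    refine ⟨⟨u, hu0⟩, hu, _, ⟨⟨z, hz0⟩, rfl⟩, ?_⟩
    ext1
    exact hz.symm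
  · rintro ⟨⟨u, hu0⟩, hu, _, ⟨z, rfl⟩, h⟩
    have h' : x = u * (z : Kˣ) ^ p := (congrArg Subtype.val h).symm
    change x ∈ _
    rw [h']
    exact mul_mem (Subgroup.mem_sup_left hu) (pow_mem_locPow ζ v _)

theorem relIndex_locPow_unitsAt (hp : p.Prime) (hζ : IsPrimitiveRoot ζ p)
    (v : HeightOneSpectrum (𝓞 K)) {k : ℕ} (hk : v.valuation K (1 - (ζ : K)) = exp (-(k : ℤ))) :
    (locPow p ζ v).relIndex (unitsAt v) ≠ 0 ∧ (locPow p ζ v).relIndex (unitsAt v) ≤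
      p * Ideal.absNorm v.asIdeal ^ ((p - 1) * k) := by
  have hkp : v.valuation K (1 - (ζ : K)) ^ p = exp (-((p * k : ℕ) : ℤ)) := by
    rw [hk, ← exp_nsmul]; simp
  set B := (unitBall v (v.valuation K (1 - ζ) ^ p)).subgroupOf (unitsAt v) with hB
  have hB0 : B.index ≠ 0 := by
    rw [hB, hkp]
    exact unitBall_relIndex_unitsAt v _
  set C := B.comap (powMonoidHom p : unitsAt v →* unitsAt v) with hC
  set B' := (unitBall v (exp (-(k : ℤ)))).subgroupOf (unitsAt v) with hB'
  have hindex : (locPow p ζ v).relIndex (unitsAt v) = B.relIndex C := by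
    rw [Subgroup.relIndex, locPow_subgroupOf v hp.ne_zero, index_sup_range_pow p _ hB0]
  have hBC : B ≤ C := fun x hx => Subgroup.pow_mem _ hx _
  have hBB' : B ≤ B' := by
    intro x hx
    rw [hB, hkp, Subgroup.mem_subgroupOf,
      mem_unitBall (by rw [← exp_zero, exp_le_exp]; lia) (by simp)] at hx
    rw [hB', Subgroup.mem_subgroupOf,
      mem_unitBall (by rw [← exp_zero, exp_le_exp]; lia) (by simp)]
    refine hx.trans_le ?_
    rw [exp_le_exp]
    have : k ≤ p * k := Nat.le_mul_of_pos_left _ hp.pos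
    lia
  have h1 : B'.relIndex C ≤ p := by
    have key : ∀ x : unitsAt v, x ∈ C → ∃ i : Fin p,
        v.valuation K (1 - ((ζ ^ (i : ℕ) : Kˣ) : K) * ((x : Kˣ) : K)) < exp (-(k : ℤ)) := by
      intro x hx
      by_contra! hcon
      rw [hC, Subgroup.mem_comap, hB, Subgroup.mem_subgroupOf, hkp,
        mem_unitBall (by rw [← exp_zero, exp_le_exp]; lia) (by simp)] at hx
      have h2 : (((powMonoidHom p x : unitsAt v) : Kˣ) : K) = ((x : Kˣ) : K) ^ p := by simp
      have hprim : IsPrimitiveRoot (ζ : K) p := IsPrimitiveRoot.coe_units_iff.mpr hζ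
      have h6 := hprim.pow_sub_pow_eq_prod_sub_mul (1 : K) (x : Kˣ) hp.pos
      rw [h2, Valuation.map_sub_swap, ← one_pow p, h6, map_prod] at hx
      have h7 : exp (-((p * k : ℕ) : ℤ)) =
          ∏ _μ ∈ Polynomial.nthRootsFinset p (1 : K), exp (-(k : ℤ)) := by
        rw [Finset.prod_const, hprim.card_nthRootsFinset, ← exp_nsmul]; simp
      rw [h7] at hx
      refine absurd hx (not_lt.mpr (Finset.prod_le_prod (fun _ _ => zero_le) ?_))
      intro μ hμ
      rw [Polynomial.mem_nthRootsFinset hp.pos] at hμ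
      have : NeZero p := ⟨hp.ne_zero⟩
      obtain ⟨i, hi, rfl⟩ := hprim.eq_pow_of_pow_eq_one hμ
      simpa using hcon ⟨i, hi⟩
    have : NeZero p := ⟨hp.ne_zero⟩
    choose! f hf using key
    have h3 := (relIndex_le_card_of B' C f fun x hx y hy hxy => ?_).2
    · simpa using h3
    · have hx' := hf x hx
      have hy' := hf y hy
      rw [← hxy] at hy'
      rw [hB', Subgroup.mem_subgroupOf,
        mem_unitBall (by rw [← exp_zero, exp_le_exp]; lia) (by simp)]
      have hx0 := ordv_eq_zero_iff.mp x.2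
      have h4 : (((x⁻¹ * y : unitsAt v) : Kˣ) : K) - 1 =
        (((ζ ^ (f x : ℕ) : Kˣ) : K))⁻¹ * ((x : Kˣ) : K)⁻¹ *
        ((1 - ((ζ ^ (f x : ℕ) : Kˣ) : K) * ((x : Kˣ) : K)) -
          (1 - ((ζ ^ (f x : ℕ) : Kˣ) : K) * ((y : Kˣ) : K))) := by
        push_cast; field_simp; ring
      rw [h4, map_mul, map_mul, map_inv₀, map_inv₀, hx0, Units.val_pow_eq_pow_val, map_pow,
        valuation_root_eq_one hp.ne_zero hζ, one_pow, inv_one, one_mul, one_mul]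
      exact Valuation.map_sub_lt _ (by simpa using hx') (by simpa using hy')
  have h2 : B.relIndex B' ≤ Ideal.absNorm v.asIdeal ^ ((p - 1) * k) := by
    have h3 := unitBall_relIndex_unitBall_le v k ((p - 1) * k)
    have h4 : k + (p - 1) * k = p * k := by
      obtain ⟨q, rfl⟩ := Nat.exists_eq_add_of_lt hp.pos
      simp; ring
    rw [h4, ← hkp] at h3
    rw [hB, hB', Subgroup.relIndex_subgroupOf]
    · exact h3
    · intro x hx; exact ordv_eq_zero_of_mem_unitBall hx
  have h3 : B.relIndex (B' ⊓ C) ≤ B.relIndex B' :=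
    Subgroup.relIndex_le_of_le_right inf_le_left fun h => hB0 (by
      have := Subgroup.relIndex_mul_index hBB'
      rw [h, zero_mul] at this
      exact this.symm)
  have h4 := Subgroup.relIndex_inf_mul_relIndex B B' C
  rw [inf_eq_left.mpr hBB'] at h4
  rw [hindex]
  refine ⟨fun h => hB0 ?_, ?_⟩
  · rw [← Subgroup.relIndex_mul_index hBC, h, zero_mul]
  · rw [← h4, mul_comm]
    exact Nat.mul_le_mul h1 (h3.trans h2)

theorem index_locPow (hp : p.Prime) (hζ : IsPrimitiveRoot ζ p)
    (v : HeightOneSpectrum (𝓞 K)) {k : ℕ} (hk : v.valuation K (1 - (ζ : K)) = exp (-(k : ℤ))) :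
    (locPow p ζ v).index ≠ 0 ∧
      (locPow p ζ v).index ≤ p ^ 2 * Ideal.absNorm v.asIdeal ^ ((p - 1) * k) := by
  have h1 := relIndex_locPow_unitsAt hp hζ v hk
  have h2 := Subgroup.relIndex_mul_index (le_sup_left : locPow p ζ v ≤ locPow p ζ v ⊔ unitsAt v)
  rw [Subgroup.relIndex_sup_left] at h2
  have : NeZero p := ⟨hp.ne_zero⟩
  have h3 := relIndex_le_card_of (T := ZMod p) (locPow p ζ v ⊔ unitsAt v) ⊤
    (fun x : Kˣ => (ordv v x : ZMod p)) fun x _ y _ hxy => ?_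
  · rw [Subgroup.relIndex_top_right, Nat.card_zmod] at h3
    rw [← h2]
    refine ⟨mul_ne_zero h1.1 h3.1, ?_⟩
    calc _ ≤ (p * Ideal.absNorm v.asIdeal ^ ((p - 1) * k)) * p := Nat.mul_le_mul h1.2 h3.2
      _ = _ := by ring
  · obtain ⟨c, hc⟩ := (ZMod.intCast_eq_intCast_iff_dvd_sub _ _ _).mp hxy
    obtain ⟨π, hπ⟩ := exists_ordv_eq_one v
    have h4 : x⁻¹ * y = (π ^ c) ^ p * (x⁻¹ * y * ((π ^ c) ^ p)⁻¹) := by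
      rw [mul_comm ((π ^ c) ^ p), inv_mul_cancel_right]
    rw [h4]
    refine Subgroup.mul_mem_sup (pow_mem_locPow ζ v _) ?_
    rw [mem_unitsAt]
    simp only [ordv_mul, ordv_inv, ordv_pow, ordv_zpow, hπ]
    linarith

end
end

end

section

open IsDedekindDomain NumberField WithZero

section
variable {K : Type*} [Field K] [NumberField K] {p : ℕ} {ζ : Kˣ}

theorem prod_absNorm_pow_le (hp : p ≠ 0) (S : Finset (HeightOneSpectrum (𝓞 K)))
    (e : HeightOneSpectrum (𝓞 K) → ℕ)
    (he : ∀ v ∈ S, v.valuation K (p : K) ≤ exp (-(e v : ℤ))) :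
    ∏ v ∈ S, Ideal.absNorm v.asIdeal ^ e v ≤ p ^ Module.finrank ℚ K := by
  have h1 : ∏ v ∈ S, v.asIdeal ^ e v ∣ Ideal.span {(p : 𝓞 K)} := by
    apply Finset.prod_dvd_of_coprime
    · intro v _ w _ hvw
      apply IsCoprime.pow
      rw [Ideal.isCoprime_iff_sup_eq]
      exact v.isMaximal.coprime_of_ne w.isMaximal fun h => hvw (asIdeal_injective h)
    · intro v hv
      have h2 := he v hv
      have h3 : v.valuation K (algebraMap (𝓞 K) K (p : 𝓞 K)) = v.intValuation (p : 𝓞 K) :=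
        v.valuation_of_algebraMap _
      rw [map_natCast] at h3
      rw [h3, v.intValuation_le_pow_iff_mem] at h2
      rw [Ideal.dvd_span_singleton]
      exact h2
  have h2 := map_dvd Ideal.absNorm h1
  rw [Ideal.absNorm_span_natCast, RingOfIntegers.rank, map_prod] at h2
  simp only [map_pow] at h2
  exact Nat.le_of_dvd (pow_pos (Nat.pos_of_ne_zero hp) _) h2

/-- Elements which are positive at all real embeddings. -/
def posAt (K : Type*) [Field K] : Subgroup Kˣ where
  carrier := {x | ∀ σ : K →+* ℝ, 0 < σ x}
  one_mem' := by simp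
  mul_mem' := by
    intro x y hx hy σ
    simpa using mul_pos (hx σ) (hy σ)
  inv_mem' := by
    intro x hx σ
    simpa using hx σ

theorem mem_posAt {x : Kˣ} : x ∈ posAt K ↔ ∀ σ : K →+* ℝ, 0 < σ x := Iff.rfl

instance finite_realEmbeddings : Finite (K →+* ℝ) :=
  Finite.of_injective (fun σ : K →+* ℝ => Complex.ofRealHom.comp σ)
    fun _ _ h => RingHom.ext fun x => Complex.ofReal_injective (RingHom.congr_fun h x)

theorem card_realEmbeddings_le : Nat.card (K →+* ℝ) ≤ InfinitePlace.nrRealPlaces K := by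
  classical
  rw [← InfinitePlace.card_real_embeddings, ← Nat.card_eq_fintype_card]
  refine Nat.card_le_card_of_injective
    (fun σ : K →+* ℝ => ⟨Complex.ofRealHom.comp σ, ?_⟩)
    fun _ _ h => RingHom.ext fun x =>
      Complex.ofReal_injective (RingHom.congr_fun (Subtype.ext_iff.mp h) x)
  rw [ComplexEmbedding.isReal_iff]
  ext x
  simp [ComplexEmbedding.conjugate]

theorem index_posAt (hp : p.Prime) :
    (posAt K).index ≠ 0 ∧ (posAt K).index ≤ p ^ InfinitePlace.nrRealPlaces K := by
  classical
  have h := relIndex_le_card_of (posAt K) ⊤ (fun x : Kˣ => fun σ : K →+* ℝ => decide (0 < σ x))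
    fun x _ y _ hxy σ => ?_
  · rw [Subgroup.relIndex_top_right] at h
    refine ⟨h.1, h.2.trans ?_⟩
    rw [Nat.card_fun]
    rw [Nat.card_eq_fintype_card (α := Bool), Fintype.card_bool]
    exact (Nat.pow_le_pow_left hp.two_le _).trans
      (Nat.pow_le_pow_right hp.pos card_realEmbeddings_le)
  · have h1 := congrFun hxy σ
    simp only [decide_eq_decide] at h1
    have hx : σ x ≠ 0 := by simp
    have hy : σ y ≠ 0 := by simp
    push_cast
    rw [map_mul, map_inv₀]
    rcases lt_or_gt_of_ne hx with h2 | h2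
    · have : σ y < 0 := lt_of_le_of_ne (not_lt.mp fun h => absurd (h1.mpr h) (not_lt.mpr h2.le)) hy
      exact mul_pos_of_neg_of_neg (inv_neg''.mpr h2) this
    · exact mul_pos (inv_pos.mpr h2) (h1.mp h2)

/-- Elements that are locally `p`-th powers on `S` and positive at the real embeddings. -/
noncomputable def locPowOn (p : ℕ) (ζ : Kˣ) (S : Finset (HeightOneSpectrum (𝓞 K))) : Subgroup Kˣ :=
  (⨅ v ∈ S, locPow p ζ v) ⊓ posAt K

theorem mem_locPowOn {S : Finset (HeightOneSpectrum (𝓞 K))} {x : Kˣ} :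
    x ∈ locPowOn p ζ S ↔ (∀ v ∈ S, x ∈ locPow p ζ v) ∧ ∀ σ : K →+* ℝ, 0 < σ x := by
  rw [locPowOn, Subgroup.mem_inf, mem_posAt]
  simp only [Subgroup.mem_iInf]

theorem index_locPowOn (hp : p.Prime) (hζ : IsPrimitiveRoot ζ p)
    (S : Finset (HeightOneSpectrum (𝓞 K))) : (locPowOn p ζ S).index ≠ 0 ∧
      (locPowOn p ζ S).index ≤ p ^ (2 * (Fintype.card (InfinitePlace K) + S.card)) := by
  classical
  choose k hk using fun v => exists_valuation_one_sub_eq hp hζ v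
  have h1 : ∀ S : Finset (HeightOneSpectrum (𝓞 K)), (⨅ v ∈ S, locPow p ζ v).index ≠ 0 ∧
      (⨅ v ∈ S, locPow p ζ v).index ≤
        ∏ v ∈ S, p ^ 2 * Ideal.absNorm v.asIdeal ^ ((p - 1) * k v) := by
    intro S
    induction S using Finset.induction_on with
    | empty => simp
    | insert a S ha ih =>
      have h2 := index_locPow hp hζ a (hk a)
      rw [Finset.iInf_insert, Finset.prod_insert ha]
      exact ⟨Subgroup.index_inf_ne_zero h2.1 ih.1,
        Subgroup.index_inf_le.trans (Nat.mul_le_mul h2.2 ih.2)⟩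
  have h3 := index_posAt (K := K) hp
  refine ⟨Subgroup.index_inf_ne_zero (h1 S).1 h3.1,
    (Subgroup.index_inf_le.trans (Nat.mul_le_mul (h1 S).2 h3.2)).trans ?_⟩
  have h4 := prod_absNorm_pow_le hp.ne_zero S (fun v => (p - 1) * k v) fun v _ => by
    rw [valuation_nat_prime hp hζ, hk, ← exp_nsmul]
    simp
  rw [Finset.prod_mul_distrib, Finset.prod_const, ← InfinitePlace.card_add_two_mul_card_eq_rank]
    at *
  rw [InfinitePlace.card_eq_nrRealPlaces_add_nrComplexPlaces]
  calc _ ≤ (p ^ 2) ^ S.card * p ^ (InfinitePlace.nrRealPlaces K +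
        2 * InfinitePlace.nrComplexPlaces K) * p ^ InfinitePlace.nrRealPlaces K := by gcongr
    _ = _ := by rw [← pow_mul, ← pow_add, ← pow_add]; congr 1; ring

end

end

section

open IsDedekindDomain NumberField WithZero

section
variable {K : Type*} [Field K] [NumberField K] {p : ℕ} {ζ : Kˣ}

theorem mem_locPow_of_valuation_sub_lt {v : HeightOneSpectrum (𝓞 K)}
    (hv : v.valuation K (1 - (ζ : K)) = 1) {x : Kˣ} (hx : ordv v x = 0) {d : K} (hp : p ≠ 0)
    (h : v.valuation K ((x : K) - d ^ p) < 1) : x ∈ locPow p ζ v := by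
  rw [ordv_eq_zero_iff] at hx
  have h1 : v.valuation K (d ^ p) = 1 := by
    rw [Valuation.map_sub_swap] at h
    have := Valuation.map_add_eq_of_lt_left (v.valuation K) (h.trans_eq hx.symm)
    rw [add_sub_cancel] at this
    exact this.trans hx
  have hd : d ≠ 0 := by
    rintro rfl
    simp [hp] at h1
  have h2 : x = (x * ((Units.mk0 d hd) ^ p)⁻¹) * (Units.mk0 d hd) ^ p := by
    rw [inv_mul_cancel_right]
  rw [h2]
  refine mul_mem (Subgroup.mem_sup_left ?_) (pow_mem_locPow ζ v _)
  rw [hv, one_pow, mem_unitBall le_rfl one_ne_zero]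
  have h3 : ((x * ((Units.mk0 d hd) ^ p)⁻¹ : Kˣ) : K) - 1 = (d ^ p)⁻¹ * (x - d ^ p) := by
    push_cast
    rw [Units.val_mk0]
    field_simp
  rw [h3, map_mul, map_inv₀, h1, inv_one, one_mul]
  exact h

theorem exists_notMem_locPow (hp : p.Prime) (hζ : IsPrimitiveRoot ζ p)
    {v : HeightOneSpectrum (𝓞 K)} (hv : v.valuation K (1 - (ζ : K)) = 1) :
    ∃ u : Kˣ, ordv v u = 0 ∧ u ∉ locPow p ζ v := by
  by_contra! hcon
  set B := (unitBall v (v.valuation K (1 - ζ) ^ p)).subgroupOf (unitsAt v) with hB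
  have hB0 : B.index ≠ 0 := by
    have := unitBall_relIndex_unitsAt v 0
    rw [hB, hv, one_pow]
    rwa [Nat.cast_zero, neg_zero, exp_zero] at this
  have h1 := index_sup_range_pow p B hB0
  have h2 : B ⊔ (powMonoidHom p : unitsAt v →* unitsAt v).range = ⊤ := by
    rw [hB, ← locPow_subgroupOf v hp.ne_zero, Subgroup.subgroupOf_eq_top]
    exact fun u hu => hcon u hu
  rw [h2, Subgroup.index_top, eq_comm, Subgroup.relIndex_eq_one] at h1
  have h3 : ordv v ζ = 0 := ordv_eq_zero_iff.mpr (valuation_root_eq_one hp.ne_zero hζ v)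
  have h4 : (⟨ζ, h3⟩ : unitsAt v) ∈ B := by
    apply h1
    rw [Subgroup.mem_comap]
    have : powMonoidHom p (⟨ζ, h3⟩ : unitsAt v) = 1 := Subtype.ext hζ.pow_eq_one
    rw [this]
    exact one_mem _
  rw [hB, Subgroup.mem_subgroupOf, hv, one_pow, mem_unitBall le_rfl one_ne_zero,
    Valuation.map_sub_swap, hv] at h4
  exact lt_irrefl _ h4

end

section
variable {K L : Type*} [Field K] [NumberField K] [Field L] [NumberField L] [Algebra K L]
variable {p : ℕ} {ζ x : Kˣ} {ξ : Lˣ} {σ : Gal(L/K)}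

theorem unitsIncl_mem_locPow {v : HeightOneSpectrum (𝓞 K)} {P : HeightOneSpectrum (𝓞 L)}
    (hP : placeBelow K P = v) (h1 : v.valuation K (1 - (ζ : K)) = 1) {y : Kˣ}
    (hy : y ∈ locPow p ζ v) : unitsIncl K L y ∈ locPow p (unitsIncl K L ζ) P := by
  obtain ⟨u, hu, z, rfl⟩ := exists_of_mem_locPow hy
  rw [map_mul, map_pow]
  refine mul_mem (Subgroup.mem_sup_left ?_) (pow_mem_locPow _ _ _)
  have h2 : P.valuation L (1 - (unitsIncl K L ζ : L)) = 1 := by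
    have := valuation_algebraMap_eq P (1 - (ζ : K))
    rw [hP, h1, one_pow] at this
    simpa using this
  rw [h2, one_pow, mem_unitBall le_rfl one_ne_zero]
  rw [h1, one_pow, mem_unitBall le_rfl one_ne_zero] at hu
  have := valuation_algebraMap_eq P ((u : K) - 1)
  rw [hP, map_sub, map_one] at this
  refine (this.trans_lt ?_)
  exact pow_lt_one₀ zero_le hu (ramK_ne_zero P)

/-- The group generated by norms and local `p`-th powers. -/
noncomputable def normLoc (p : ℕ) (ζ : Kˣ) (L : Type*) [Field L] [NumberField L] [Algebra K L]
    (v : HeightOneSpectrum (𝓞 K)) : Subgroup Kˣ :=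
  locPow p ζ v ⊔ (normU K L).range

theorem exists_of_mem_normLoc {v : HeightOneSpectrum (𝓞 K)} {y : Kˣ} (h : y ∈ normLoc p ζ L v) :
    ∃ u ∈ locPow p ζ v, ∃ z : Lˣ, y = u * normU K L z := by
  obtain ⟨u, hu, _, ⟨z, rfl⟩, rfl⟩ := Subgroup.mem_sup.mp h
  exact ⟨u, hu, z, rfl⟩

namespace IsKummer

theorem dvd_ordv_of_mem_normLoc (h : IsKummer p ζ x ξ σ) {v : HeightOneSpectrum (𝓞 K)}
    (hv : v.valuation K (1 - (ζ : K)) = 1) (hx : (p : ℤ) ∣ ordv v x) (hns : IsNonsplit L v)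
    {y : Kˣ} (hy : y ∈ normLoc p ζ L v) : (p : ℤ) ∣ ordv v y := by
  have := h.isGalois
  obtain ⟨u, hu, z, rfl⟩ := exists_of_mem_normLoc hy
  obtain ⟨P, hP⟩ := exists_placeBelow_eq (L := L) v
  rw [ordv_mul]
  refine dvd_add (dvd_ordv_of_mem_locPow hu) ?_
  have h1 := ordv_normU_of_isNonsplit hns hP z
  rw [h.ramK_eq_one hv hx hP, h.finrank_eq] at h1
  exact ⟨_, by simpa using h1⟩

theorem mem_locPow_of_mem_normLoc (h : IsKummer p ζ x ξ σ) {v : HeightOneSpectrum (𝓞 K)}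
    (hv : v.valuation K (1 - (ζ : K)) = 1) (hx : ¬ (p : ℤ) ∣ ordv v x) (hns : IsNonsplit L v)
    {y : Kˣ} (hy : y ∈ normLoc p ζ L v) (hpy : (p : ℤ) ∣ ordv v y) : y ∈ locPow p ζ v := by
  have := h.isGalois
  obtain ⟨u, hu, z, rfl⟩ := exists_of_mem_normLoc hy
  obtain ⟨P, hP⟩ := exists_placeBelow_eq (L := L) v
  have hp0 : (p : ℤ) ≠ 0 := by exact_mod_cast h.prime.ne_zero
  have hram : ramK K P = p ∧ inertK K P = 1 := by
    have h3 : ramK K P ≠ 1 := by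
      intro he
      have h3 := congrArg (ordv P) h.pow_eq
      rw [ordv_pow, ordv_unitsIncl, hP, he] at h3
      exact hx ⟨_, by simpa using h3.symm⟩
    rcases prime_degree_cases h.prime h.finrank_eq v with ⟨_, h1⟩ | ⟨_, h1⟩
    · exact absurd (h1 P hP).1 h3
    · rcases h1 P hP with h2 | ⟨h2, _⟩
      · exact h2
      · exact absurd h2 h3
  refine mul_mem hu ?_
  rw [ordv_mul] at hpy
  obtain ⟨k, hk⟩ := (Int.dvd_add_right (dvd_ordv_of_mem_locPow hu)).mp hpy
  have h1 := ordv_normU_of_isNonsplit hns hP z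
  rw [hram.1, h.finrank_eq, hk] at h1
  have h2 : ordv P z = p * k := (mul_left_cancel₀ hp0 h1).symm
  obtain ⟨π, hπ⟩ := exists_ordv_eq_one v
  set ω : Lˣ := z * (unitsIncl K L (π ^ k))⁻¹ with hω
  have hω0 : ordv P ω = 0 := by
    rw [hω, ordv_mul, ordv_inv, ordv_unitsIncl, hP, ordv_zpow, hπ, h2, hram.1]
    ring
  have hz : normU K L z = normU K L ω * (π ^ k) ^ p := by
    have h3 : normU K L (unitsIncl K L (π ^ k)) = (π ^ k) ^ p := by
      ext
      have := Algebra.norm_algebraMap (S := L) ((π ^ k : Kˣ) : K)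
      rw [h.finrank_eq] at this
      exact this
    rw [← h3, ← map_mul, hω, inv_mul_cancel_right]
  rw [hz]
  refine mul_mem ?_ (pow_mem_locPow _ _ _)
  have hω1 := ordv_eq_zero_iff.mp hω0
  obtain ⟨d, hd⟩ := exists_valuation_sub_lt_of_inertK_eq_one hram.2 hω1.le
  have hn0 : ordv v (normU K L ω) = 0 := by
    have h4 := ordv_normU_of_isNonsplit hns hP ω
    rw [hram.1, hω0, mul_zero] at h4
    exact (mul_eq_zero.mp h4).resolve_left hp0
  refine mem_locPow_of_valuation_sub_lt hv hn0 (d := (d : K)) h.prime.ne_zero ?_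
  have h5 := valuation_algebraMap_eq P ((normU K L ω : K) - (d : K) ^ p)
  have h6 : P.valuation L (algebraMap K L ((normU K L ω : K) - (d : K) ^ p)) < 1 := by
    have h7 : algebraMap K L (normU K L ω : K) = ∏ τ : Gal(L/K), τ (ω : L) :=
      Algebra.norm_eq_prod_automorphisms K (ω : L)
    have h8 : algebraMap K L (d : K) ^ p = ∏ τ : Gal(L/K), algebraMap K L (d : K) := by
      rw [Finset.prod_const, Finset.card_univ, ← Nat.card_eq_fintype_card,
        IsGalois.card_aut_eq_finrank, h.finrank_eq]
    rw [map_sub, map_pow, h7, h8]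
    have h9 : ∀ s : Finset Gal(L/K), P.valuation L
        (∏ τ ∈ s, τ (ω : L) - ∏ τ ∈ s, algebraMap K L (d : K)) < 1 := by
      classical
      intro s
      induction s using Finset.induction_on with
      | empty => simp
      | insert a s ha ih =>
        rw [Finset.prod_insert ha, Finset.prod_insert ha]
        have e : a (ω : L) * ∏ τ ∈ s, τ (ω : L) - algebraMap K L (d : K) *
            ∏ τ ∈ s, algebraMap K L (d : K) = a (ω : L) * (∏ τ ∈ s, τ (ω : L) -
            ∏ τ ∈ s, algebraMap K L (d : K)) + (a ((ω : L) - algebraMap K L (d : K))) *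
            ∏ τ ∈ s, algebraMap K L (d : K) := by
          rw [map_sub, AlgEquiv.commutes]; ring
        rw [e]
        refine Valuation.map_add_lt _ ?_ ?_
        · rw [map_mul, valuation_gal_of_isNonsplit hns hP, hω1, one_mul]
          exact ih
        · rw [map_mul, valuation_gal_of_isNonsplit hns hP, map_prod]
          refine mul_lt_one_of_lt_of_le hd (Finset.prod_le_one' fun τ _ => ?_)
          exact P.valuation_le_one (algebraMap (𝓞 K) (𝓞 L) d)
    exact h9 _
  rw [h5, hP] at h6
  exact (pow_lt_one_iff_of_nonneg zero_le (ramK_ne_zero P)).mp h6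

theorem normLoc_ne_top (h : IsKummer p ζ x ξ σ) {v : HeightOneSpectrum (𝓞 K)}
    (hv : v.valuation K (1 - (ζ : K)) = 1) (hns : IsNonsplit L v) : ∃ y, y ∉ normLoc p ζ L v := by
  by_cases hx : (p : ℤ) ∣ ordv v x
  · obtain ⟨π, hπ⟩ := exists_ordv_eq_one v
    refine ⟨π, fun hc => ?_⟩
    have := h.dvd_ordv_of_mem_normLoc hv hx hns hc
    rw [hπ] at this
    exact h.prime.one_lt.ne' (by exact_mod_cast Int.eq_one_of_dvd_one (by positivity) this)
  · obtain ⟨u, hu, hu'⟩ := exists_notMem_locPow h.prime h.prim hv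
    refine ⟨u, fun hc => hu' (h.mem_locPow_of_mem_normLoc hv hx hns hc ?_)⟩
    rw [hu]; exact dvd_zero _

theorem mem_locPow_of_inertK_eq_one (h : IsKummer p ζ x ξ σ) {v : HeightOneSpectrum (𝓞 K)}
    (hv : v.valuation K (1 - (ζ : K)) = 1) (hx : ordv v x = 0) {P : HeightOneSpectrum (𝓞 L)}
    (hP : placeBelow K P = v) (hf : inertK K P = 1) : x ∈ locPow p ζ v := by
  have hξ : P.valuation L (ξ : L) = 1 := by
    rw [← ordv_eq_zero_iff]
    have h3 := congrArg (ordv P) h.pow_eq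
    rw [ordv_pow, ordv_unitsIncl, hP, hx, mul_zero] at h3
    simpa [h.prime.ne_zero] using h3
  obtain ⟨d, hd⟩ := exists_valuation_sub_lt_of_inertK_eq_one hf hξ.le
  refine mem_locPow_of_valuation_sub_lt hv hx (d := (d : K)) h.prime.ne_zero ?_
  have h5 : P.valuation L (algebraMap K L ((x : K) - (d : K) ^ p)) = _ :=
    valuation_algebraMap_eq P ((x : K) - (d : K) ^ p)
  have h6 : algebraMap K L (x : K) = (ξ : L) ^ p := by
    have := congrArg Units.val h.pow_eq
    simpa using this.symm
  have hd1 : P.valuation L (algebraMap K L (d : K)) ≤ 1 :=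
    P.valuation_le_one (algebraMap (𝓞 K) (𝓞 L) d)
  rw [map_sub, map_pow, h6, ← (Commute.all _ _).geom_sum₂_mul, map_mul, hP] at h5
  refine (pow_lt_one_iff_of_nonneg zero_le (ramK_ne_zero (K := K) P)).mp ?_
  rw [← h5]
  refine (mul_le_of_le_one_left' ?_).trans_lt hd
  refine (Valuation.map_sum_le _ fun i _ => ?_)
  rw [map_mul, map_pow, map_pow, hξ, one_pow, one_mul]
  exact pow_le_one' hd1 _

/-- Units at `v` become locally `p`-th powers at a place of residue degree `p`. -/
theorem unitsIncl_mem_locPow_of_inertK_eq (hp : p.Prime) (hζ : IsPrimitiveRoot ζ p)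
    {v : HeightOneSpectrum (𝓞 K)}
    (hv : v.valuation K (1 - (ζ : K)) = 1) {u : Kˣ} (hu : ordv v u = 0)
    {P : HeightOneSpectrum (𝓞 L)} (hP : placeBelow K P = v) (hf : inertK K P = p) :
    unitsIncl K L u ∈ locPow p (unitsIncl K L ζ) P := by
  have hPv : P.asIdeal.LiesOver v.asIdeal := hP ▸ liesOver_placeBelow K P
  have hmem : ∀ a : 𝓞 K, a ∈ v.asIdeal ↔ algebraMap (𝓞 K) (𝓞 L) a ∈ P.asIdeal := fun a =>
    Ideal.mem_of_liesOver P.asIdeal v.asIdeal a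
  have := v.isMaximal
  have := P.isMaximal
  let _ : Field (𝓞 K ⧸ v.asIdeal) := Ideal.Quotient.field _
  let _ : Field (𝓞 L ⧸ P.asIdeal) := Ideal.Quotient.field _
  have hq : Nat.card (𝓞 K ⧸ v.asIdeal) = Ideal.absNorm v.asIdeal := by
    rw [Ideal.absNorm_apply, Submodule.cardQuot_apply]
  have hqP : Nat.card (𝓞 L ⧸ P.asIdeal) = Ideal.absNorm P.asIdeal := by
    rw [Ideal.absNorm_apply, Submodule.cardQuot_apply]
  have : Finite (𝓞 K ⧸ v.asIdeal) := Ring.HasFiniteQuotients.finiteQuotient v.ne_bot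
  have : Finite (𝓞 L ⧸ P.asIdeal) := Ring.HasFiniteQuotients.finiteQuotient P.ne_bot
  have hcard := card_quotient_eq (K := K) P
  rw [hP, hf] at hcard
  set q := Ideal.absNorm v.asIdeal
  have happrox : ∀ y : Kˣ, ordv v y = 0 → ∃ d : 𝓞 K, v.valuation K ((d : K) - y) < 1 ∧
      (Ideal.Quotient.mk v.asIdeal d) ≠ 0 := by
    intro y hy
    rw [ordv_eq_zero_iff] at hy
    obtain ⟨d, hd⟩ := v.exists_valuation_sub_lt_of_integer (γ := 1) hy.le
    refine ⟨d, by simpa using hd, fun h0 => ?_⟩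
    rw [Ideal.Quotient.eq_zero_iff_mem, ← v.valuation_lt_one_iff_mem (K := K)] at h0
    have := Valuation.map_sub_lt _ h0 hd
    rw [sub_sub_cancel, hy] at this
    exact lt_irrefl _ this
  have hqcard : Nat.card (𝓞 K ⧸ v.asIdeal)ˣ = q - 1 := by
    rw [Nat.card_units, hq]
  have hpq : p ∣ q - 1 := by
    obtain ⟨d, hd, hd0⟩ := happrox ζ (ordv_eq_zero_iff.mpr (valuation_root_eq_one hp.ne_zero hζ v))
    rw [← hqcard]
    have : Fact p.Prime := ⟨hp⟩
    have h1 : orderOf (Units.mk0 _ hd0) = p := by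
      apply orderOf_eq_prime
      · ext
        simp only [Units.val_pow_eq_pow_val, Units.val_mk0, Units.val_one]
        rw [← map_pow, ← map_one (Ideal.Quotient.mk _), Ideal.Quotient.eq,
          ← v.valuation_lt_one_iff_mem (K := K)]
        have e : algebraMap (𝓞 K) K (d ^ p - 1) = (d : K) ^ p - 1 := by simp
        change v.valuation K (algebraMap (𝓞 K) K (d ^ p - 1)) < 1
        rw [e]
        have hz : ((ζ : K)) ^ p = 1 := by
          have := congrArg Units.val hζ.pow_eq_one
          simpa using this
        rw [← hz, ← (Commute.all _ _).geom_sum₂_mul, map_mul]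
        refine (mul_le_of_le_one_left' ?_).trans_lt hd
        refine (Valuation.map_sum_le _ fun i _ => ?_)
        rw [map_mul, map_pow, map_pow, valuation_root_eq_one hp.ne_zero hζ, one_pow, mul_one]
        exact pow_le_one' (v.valuation_le_one d) _
      · intro h1
        have h1 := congrArg Units.val h1
        rw [Units.val_mk0, Units.val_one, ← map_one (Ideal.Quotient.mk _), Ideal.Quotient.eq,
          ← v.valuation_lt_one_iff_mem (K := K)] at h1
        have e : algebraMap (𝓞 K) K (d - 1) = (d : K) - 1 := by simp
        change v.valuation K (algebraMap (𝓞 K) K (d - 1)) < 1 at h1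
        rw [e] at h1
        have := Valuation.map_sub_lt _ hd h1
        rw [sub_sub_sub_cancel_left, hv] at this
        exact lt_irrefl _ this
    rw [← h1]
    exact orderOf_dvd_natCard _
  obtain ⟨d, hd, hd0⟩ := happrox u hu
  have hdP : Ideal.Quotient.mk P.asIdeal (algebraMap (𝓞 K) (𝓞 L) d) ≠ 0 := by
    rwa [Ne, Ideal.Quotient.eq_zero_iff_mem, ← hmem, ← Ideal.Quotient.eq_zero_iff_mem]
  have hy1 : (Units.mk0 _ hdP) ^ (q - 1) = 1 := by
    have h1 : (Units.mk0 _ hd0) ^ (q - 1) = 1 := by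
      rw [← hqcard]; exact pow_card_eq_one'
    have h2 := congrArg Units.val h1
    simp only [Units.val_pow_eq_pow_val, Units.val_mk0, Units.val_one] at h2
    rw [← map_pow, ← map_one (Ideal.Quotient.mk _), Ideal.Quotient.eq, hmem] at h2
    ext
    simp only [Units.val_pow_eq_pow_val, Units.val_mk0, Units.val_one]
    rw [← map_pow, ← map_one (Ideal.Quotient.mk _), Ideal.Quotient.eq]
    simpa using h2
  have hgeom : p ∣ ∑ i ∈ Finset.range p, q ^ i := by
    have hq0 : 1 ≤ q := by
      rw [← hq]; exact Nat.card_pos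
    have h1 : (q : ZMod p) = 1 := by
      have := (ZMod.natCast_eq_zero_iff _ _).mpr hpq
      rw [Nat.cast_sub hq0, Nat.cast_one, sub_eq_zero] at this
      exact this
    rw [← ZMod.natCast_eq_zero_iff]
    simp [h1]
  obtain ⟨m, hm⟩ := hgeom
  have hcardP : Nat.card (𝓞 L ⧸ P.asIdeal)ˣ = p * (m * (q - 1)) := by
    have hq0 : 1 ≤ q := by
      rw [← hq]; exact Nat.card_pos
    rw [Nat.card_units, hqP, hcard, ← mul_assoc, ← hm]
    zify [hq0, Nat.one_le_pow p q hq0]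
    rw [geom_sum_mul]
  obtain ⟨g, hg⟩ := IsCyclic.exists_generator (α := (𝓞 L ⧸ P.asIdeal)ˣ)
  obtain ⟨j, hj⟩ := Subgroup.mem_zpowers_iff.mp (hg (Units.mk0 _ hdP))
  have hpos : 0 < m * (q - 1) := by
    have : 0 < p * (m * (q - 1)) := hcardP ▸ Nat.card_pos
    exact Nat.pos_of_mul_pos_left this
  have hpj : (p : ℤ) ∣ j := by
    have h1 : g ^ (j * ((m * (q - 1) : ℕ) : ℤ)) = 1 := by
      rw [zpow_mul, hj, zpow_natCast, mul_comm, pow_mul, hy1, one_pow]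
    rw [← orderOf_dvd_iff_zpow_eq_one, orderOf_eq_card_of_forall_mem_zpowers hg, hcardP] at h1
    rw [Nat.cast_mul] at h1
    exact Int.dvd_of_mul_dvd_mul_right (by exact_mod_cast hpos.ne') h1
  obtain ⟨i, rfl⟩ := hpj
  obtain ⟨e, he⟩ := Ideal.Quotient.mk_surjective ((g ^ i : (𝓞 L ⧸ P.asIdeal)ˣ) : 𝓞 L ⧸ P.asIdeal)
  have h3 : algebraMap (𝓞 K) (𝓞 L) d - e ^ p ∈ P.asIdeal := by
    rw [← Ideal.Quotient.eq, map_pow, he, ← Units.val_pow_eq_pow_val, ← zpow_natCast, ← zpow_mul,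
      mul_comm i, hj]
    rfl
  have hv' : P.valuation L (1 - (unitsIncl K L ζ : L)) = 1 := by
    have := valuation_algebraMap_eq P (1 - (ζ : K))
    rw [hP, hv, one_pow] at this
    simpa using this
  refine mem_locPow_of_valuation_sub_lt hv' (d := (e : L)) ?_ hp.ne_zero ?_
  · rw [ordv_unitsIncl, hP, hu, mul_zero]
  · have h4 := valuation_algebraMap_eq P ((d : K) - u)
    rw [hP] at h4
    have h5 : P.valuation L (algebraMap K L ((d : K) - u)) < 1 :=
      h4.trans_lt (pow_lt_one₀ zero_le hd (ramK_ne_zero P))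
    have h6 : P.valuation L (algebraMap (𝓞 L) L (algebraMap (𝓞 K) (𝓞 L) d - e ^ p)) < 1 :=
      (P.valuation_lt_one_iff_mem _).mpr h3
    have h7 := Valuation.map_sub_lt _ h6 h5
    convert h7 using 2
    rw [map_sub, map_sub, map_pow, ← IsScalarTower.algebraMap_apply,
      IsScalarTower.algebraMap_apply (𝓞 K) K L]
    simp

end IsKummer
end

end

section

open IsDedekindDomain NumberField WithZero

section
variable {K L : Type} [Field K] [NumberField K] [Field L] [NumberField L] [Algebra K L]

theorem exists_ordv_eq_of_finite {S : Finset (HeightOneSpectrum (𝓞 K))}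
    (hS : ∀ v ∉ S, ∃ c : Kˣ, ordv v c = 1 ∧ ∀ u, u ∉ S → u ≠ v → ordv u c = 0)
    (n : HeightOneSpectrum (𝓞 K) → ℤ) (hn : {v | v ∉ S ∧ n v ≠ 0}.Finite) :
    ∃ c : Kˣ, ∀ v ∉ S, ordv v c = n v := by
  classical
  choose! c hc hc' using hS
  have key : ∀ T : Finset (HeightOneSpectrum (𝓞 K)), (∀ v ∈ T, v ∉ S) →
      ∀ u ∉ S, ordv u (∏ v ∈ T, c v ^ n v) = if u ∈ T then n u else 0 := by
    intro T
    induction T using Finset.induction_on with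
    | empty => intro _ u _; simp
    | insert a T ha ih =>
      intro hT u hu
      rw [Finset.prod_insert ha, ordv_mul, ordv_zpow,
        ih (fun v hv => hT v (Finset.mem_insert_of_mem hv)) u hu]
      have ha' := hT a (Finset.mem_insert_self _ _)
      by_cases hua : u = a
      · subst hua
        simp [ha, hc u hu]
      · rw [hc' a ha' u hu hua]
        simp [hua]
  refine ⟨∏ v ∈ hn.toFinset, c v ^ n v, fun v hv => ?_⟩
  rw [key _ (fun v hv => by simpa using (hn.mem_toFinset.mp hv).1) v hv]
  by_cases h : n v = 0
  · simp [h]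
  · rw [if_pos (hn.mem_toFinset.mpr ⟨hv, h⟩)]

theorem finite_placeBelow_mem (S : Finset (HeightOneSpectrum (𝓞 K))) :
    {P : HeightOneSpectrum (𝓞 L) | placeBelow K P ∈ S}.Finite := by
  refine (S.finite_toSet.biUnion fun v _ => finite_placeBelow_eq (L := L) v).subset ?_
  intro P hP
  simpa using hP

/-- The places of `L` above a finite set of places of `K`. -/
noncomputable def placesOver (L : Type) [Field L] [NumberField L] [Algebra K L]
    (S : Finset (HeightOneSpectrum (𝓞 K))) : Finset (HeightOneSpectrum (𝓞 L)) :=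
  (finite_placeBelow_mem (L := L) S).toFinset

@[simp] theorem mem_placesOver {S : Finset (HeightOneSpectrum (𝓞 K))}
    {P : HeightOneSpectrum (𝓞 L)} : P ∈ placesOver L S ↔ placeBelow K P ∈ S := by
  simp [placesOver]

theorem unitsIncl_mem_sUnits_iff {S : Finset (HeightOneSpectrum (𝓞 K))} {x : Kˣ} :
    unitsIncl K L x ∈ sUnits (placesOver L S) ↔ x ∈ sUnits S := by
  simp only [mem_sUnits, mem_placesOver]
  constructor
  · intro h v hv
    obtain ⟨P, rfl⟩ := exists_placeBelow_eq (L := L) v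
    exact (ordv_unitsIncl_eq_zero_iff P x).mp (h P hv)
  · intro h P hP
    exact (ordv_unitsIncl_eq_zero_iff P x).mpr (h _ hP)

theorem galU_mem_sUnits [IsGalois K L] {S : Finset (HeightOneSpectrum (𝓞 K))} (σ : Gal(L/K))
    {y : Lˣ} (hy : y ∈ sUnits (placesOver L S)) : galU σ y ∈ sUnits (placesOver L S) := by
  simp only [mem_sUnits, mem_placesOver] at hy ⊢
  intro P hP
  obtain ⟨Q, hQ, hQ'⟩ := exists_ordv_galU σ P
  rw [← hQ', hy Q (hQ ▸ hP)]

open Classical in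
theorem card_placesOver [IsGalois K L] {p : ℕ} (hp : p.Prime) (hL : Module.finrank K L = p)
    (S : Finset (HeightOneSpectrum (𝓞 K))) :
    (placesOver L S).card + (p - 1) * (S.filter (IsNonsplit L)).card = p * S.card := by
  have h1 : (placesOver L S).card =
      ∑ v ∈ S, {P : HeightOneSpectrum (𝓞 L) | placeBelow K P = v}.ncard := by
    rw [Finset.card_eq_sum_card_fiberwise (f := placeBelow K) (t := S) (by intro P; simp)]
    refine Finset.sum_congr rfl fun v hv => ?_
    rw [← Set.ncard_coe_finset]
    congr 1
    ext P
    simp only [Finset.coe_filter, mem_placesOver, Set.mem_ofPred_eq]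
    exact ⟨fun h => h.2, fun h => ⟨h ▸ hv, h⟩⟩
  have h2 : ∀ v : HeightOneSpectrum (𝓞 K), {P : HeightOneSpectrum (𝓞 L) | placeBelow K P = v}.ncard
      + (if IsNonsplit L v then p - 1 else 0) = p := by
    intro v
    have hp1 := hp.one_lt
    rcases prime_degree_cases hp hL v with ⟨h, _⟩ | ⟨h, _⟩
    · rw [h, if_neg, add_zero]
      intro hns
      have : {P : HeightOneSpectrum (𝓞 L) | placeBelow K P = v}.ncard ≤ 1 := by
        rw [Set.ncard_le_one_iff (finite_placeBelow_eq v)]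
        intro P Q hP hQ
        exact hns P Q hP hQ
      lia
    · have h' : IsNonsplit L v := h
      rw [if_pos h']
      obtain ⟨P, hP⟩ := exists_placeBelow_eq (L := L) v
      have : {P : HeightOneSpectrum (𝓞 L) | placeBelow K P = v} = {P} := by
        ext Q
        exact ⟨fun hQ => h Q P hQ hP, fun hQ => by rw [Set.mem_singleton_iff.mp hQ]; exact hP⟩
      rw [this, Set.ncard_singleton]
      lia
  have h3 : ∑ v ∈ S, (if IsNonsplit L v then p - 1 else 0) =
      (p - 1) * (S.filter (IsNonsplit L)).card := by
    rw [← Finset.sum_filter, Finset.sum_const, smul_eq_mul, mul_comm]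
  rw [h1, ← h3, ← Finset.sum_add_distrib, Finset.sum_congr rfl fun v _ => h2 v,
    Finset.sum_const, smul_eq_mul, mul_comm]

namespace IsKummer
variable {p : ℕ} {ζ x : Kˣ} {ξ : Lˣ} {σ : Gal(L/K)}

theorem ne_one (h : IsKummer p ζ x ξ σ) : σ ≠ 1 := by
  rintro rfl
  have h1 := h.galU_eq
  have h2 : galU (1 : Gal(L/K)) ξ = ξ := by ext; simp
  rw [h2, eq_comm, mul_eq_right, map_eq_one_iff] at h1
  · exact h.prim.ne_one h.prime.one_lt h1
  · intro a b hab
    ext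
    exact (algebraMap K L).injective (congrArg Units.val hab)

theorem card_gal (h : IsKummer p ζ x ξ σ) : Nat.card Gal(L/K) = p := by
  have := h.isGalois
  rw [IsGalois.card_aut_eq_finrank, h.finrank_eq]

theorem mem_zpowers (h : IsKummer p ζ x ξ σ) (τ : Gal(L/K)) : τ ∈ Subgroup.zpowers σ := by
  have : Fact p.Prime := ⟨h.prime⟩
  exact mem_zpowers_of_prime_card h.card_gal h.ne_one

theorem orderOf_eq (h : IsKummer p ζ x ξ σ) : orderOf σ = p := by
  rw [← h.card_gal]
  exact orderOf_eq_card_of_forall_mem_zpowers h.mem_zpowers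

theorem prod_galU (h : IsKummer p ζ x ξ σ) (y : Lˣ) :
    ∏ i ∈ Finset.range p, galU (σ ^ i) y = unitsIncl K L (normU K L y) := by
  have := h.isGalois
  classical
  rw [unitsIncl_normU, ← h.orderOf_eq, ← Finset.prod_image (g := fun i => σ ^ i)
    (f := fun τ => galU τ y)]
  · congr 1
    rw [IsCyclic.image_range_orderOf h.mem_zpowers]
  · intro i hi j hj hij
    exact pow_injOn_Iio_orderOf (by simpa using hi) (by simpa using hj) hij

theorem isUnramifiedAtInfinitePlaces (h : IsKummer p ζ x ξ σ)
    (hx : ∀ τ : K →+* ℝ, 0 < τ x) : IsUnramifiedAtInfinitePlaces K L := by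
  have := h.isGalois
  refine ⟨fun w => ?_⟩
  rw [← InfinitePlace.mk_embedding w, InfinitePlace.isUnramified_mk_iff_forall_isConj]
  intro g hg
  by_contra hg1
  have h2 : orderOf g = 2 := ComplexEmbedding.orderOf_isConj_two_of_ne_one hg hg1
  have hp2 : p = 2 := by
    have h3 := orderOf_dvd_natCard g
    rw [h.card_gal, h2, h.prime.dvd_iff_eq (by norm_num)] at h3
    exact h3
  have hreal := hg.isReal_comp
  have hpos := hx hreal.embedding
  have hxi : algebraMap K L (x : K) = (ξ : L) ^ 2 := by
    have := congrArg Units.val h.pow_eq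
    rw [← hp2]
    simpa using this.symm
  have h4 : w.embedding (ξ : L) ^ 2 = ((hreal.embedding x : ℝ) : ℂ) := by
    rw [ComplexEmbedding.IsReal.coe_embedding_apply, RingHom.comp_apply, hxi, map_pow]
  have h5 : star (w.embedding (ξ : L)) = w.embedding (ξ : L) := by
    obtain ⟨r, hr⟩ : ∃ r : ℝ, w.embedding (ξ : L) = r := by
      have h6 : w.embedding (ξ : L) ^ 2 = ((Real.sqrt (hreal.embedding x) : ℝ) : ℂ) ^ 2 := by
        rw [h4, ← Complex.ofReal_pow, Real.sq_sqrt hpos.le]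
      rcases sq_eq_sq_iff_eq_or_eq_neg.mp h6 with h7 | h7
      · exact ⟨_, h7⟩
      · exact ⟨-_, by rw [h7, Complex.ofReal_neg]⟩
    rw [hr]; exact Complex.conj_ofReal r
  have h6 : g (ξ : L) = ξ := w.embedding.injective (by rw [hg.eq, h5])
  have h7 : ∀ n : ℤ, (g ^ n) (ξ : L) = ξ := by
    intro n
    have : g ∈ MulAction.stabilizer Gal(L/K) (ξ : L) := h6
    exact Subgroup.zpow_mem _ this n
  have : Fact p.Prime := ⟨h.prime⟩
  obtain ⟨n, hn⟩ : σ ∈ Subgroup.zpowers g := mem_zpowers_of_prime_card h.card_gal hg1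
  have h8 := h.galU_eq
  have h9 : galU σ ξ = ξ := by
    ext
    have := h7 n
    simp only at hn
    rw [hn] at this
    simpa using this
  rw [h9, eq_comm, mul_eq_right, map_eq_one_iff] at h8
  · exact h.prim.ne_one h.prime.one_lt h8
  · intro a b hab
    ext
    exact (algebraMap K L).injective (congrArg Units.val hab)

/-- Vanishing of `Ĥ⁻¹` for `S`-units. -/
theorem exists_div_of_normU_eq_one (h : IsKummer p ζ x ξ σ)
    {S : Finset (HeightOneSpectrum (𝓞 K))}
    (hS : ∀ v ∉ S, ∃ c : Kˣ, ordv v c = 1 ∧ ∀ u, u ∉ S → u ≠ v → ordv u c = 0)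
    (hζ : ∀ v ∉ S, v.valuation K (1 - (ζ : K)) = 1) (hx : ∀ v ∉ S, ordv v x = 0)
    {y : Lˣ} (hy : y ∈ sUnits (placesOver L S)) (hy1 : normU K L y = 1) :
    ∃ z ∈ sUnits (placesOver L S), y = z / galU σ z := by
  have := h.isGalois
  have : IsCyclic Gal(L/K) := ⟨σ, h.mem_zpowers⟩
  obtain ⟨z, hz⟩ := groupCohomology.exists_div_of_norm_eq_one (x := (y : L)) h.mem_zpowers
    (by simpa using congrArg Units.val hy1)
  have hz : z = y * galU σ z := by
    ext
    rw [div_eq_iff (by simp)] at hz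
    simpa using hz
  have hinv : ∀ P : HeightOneSpectrum (𝓞 L), placeBelow K P ∉ S → ∀ τ : Gal(L/K),
      ordv P (galU τ z) = ordv P z := by
    intro P hP τ
    obtain ⟨n, rfl⟩ := (mem_powers_iff_mem_zpowers.mpr (h.mem_zpowers τ))
    induction n with
    | zero =>
      have : galU (σ ^ 0) z = z := by ext; simp
      exact congrArg _ this
    | succ n ih =>
      have hmem := galU_mem_sUnits (σ ^ n) hy P (by simpa using hP)
      have e := congrArg (fun t => ordv P (galU (σ ^ n) t)) hz
      simp only [map_mul, ordv_mul, ← galU_mul_apply, ← pow_succ] at e ih ⊢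
      lia
  choose P hP using fun v : HeightOneSpectrum (𝓞 K) => exists_placeBelow_eq (L := L) v
  have hPv : ∀ Q, placeBelow K Q ∉ S → ordv Q z = ordv (P (placeBelow K Q)) z := by
    intro Q hQ
    obtain ⟨τ, hτ⟩ := exists_galU_of_placeBelow_eq (P := P (placeBelow K Q)) (Q := Q) (hP _).symm
    rw [hτ z]
    exact hinv _ (by rwa [hP]) τ
  obtain ⟨c, hc⟩ := exists_ordv_eq_of_finite hS (fun v => ordv (P v) z) (by
    refine ((finite_ordv_ne_zero z).image (placeBelow K)).subset ?_
    rintro v ⟨_, hv⟩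
    exact ⟨P v, hv, hP v⟩)
  refine ⟨z / unitsIncl K L c, ?_, ?_⟩
  · intro Q hQ
    rw [mem_placesOver] at hQ
    have he : ramK K Q = 1 := h.ramK_eq_one (hζ _ hQ) (by rw [hx _ hQ]; exact dvd_zero _) rfl
    rw [div_eq_mul_inv, ordv_mul, ordv_inv, ordv_unitsIncl, he, hc _ hQ, hPv _ hQ]
    simp
  · rw [map_div, galU_unitsIncl, div_div_div_cancel_right, eq_div_iff_mul_eq', mul_comm]
    rw [mul_comm]; exact hz.symm

end IsKummer
end

end

section

open IsDedekindDomain NumberField WithZero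

section
variable {K L : Type} [Field K] [NumberField K] [Field L] [NumberField L] [Algebra K L]

/-- The action of a Galois automorphism on `S`-units. -/
noncomputable def galSUnits [IsGalois K L] (S : Finset (HeightOneSpectrum (𝓞 K))) (σ : Gal(L/K)) :
    Module.End ℤ (Additive (sUnits (placesOver L S))) :=
  (MonoidHom.toAdditive (((galU σ).comp (Subgroup.subtype _)).codRestrict
    (sUnits (placesOver L S)) fun y => galU_mem_sUnits σ y.2)).toIntLinearMap

theorem galSUnits_apply [IsGalois K L] (S : Finset (HeightOneSpectrum (𝓞 K))) (σ : Gal(L/K))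
    (y : Additive (sUnits (placesOver L S))) :
    (((galSUnits S σ y).toMul : sUnits (placesOver L S)) : Lˣ) = galU σ (y.toMul : Lˣ) := rfl

theorem galSUnits_pow_apply [IsGalois K L] (S : Finset (HeightOneSpectrum (𝓞 K))) (σ : Gal(L/K))
    (n : ℕ) (y : Additive (sUnits (placesOver L S))) :
    ((((galSUnits S σ ^ n) y).toMul : sUnits (placesOver L S)) : Lˣ) =
      galU (σ ^ n) (y.toMul : Lˣ) := by
  induction n with
  | zero => ext; simp
  | succ n ih => rw [pow_succ', Module.End.mul_apply, galSUnits_apply, ih, pow_succ',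
      galU_mul_apply]

namespace IsKummer
variable {p : ℕ} {ζ x : Kˣ} {ξ : Lˣ} {σ : Gal(L/K)}

theorem sum_galSUnits_apply [IsGalois K L] (h : IsKummer p ζ x ξ σ)
    (S : Finset (HeightOneSpectrum (𝓞 K))) (y : Additive (sUnits (placesOver L S))) :
    ((((∑ i ∈ Finset.range p, galSUnits S σ ^ i) y).toMul : sUnits (placesOver L S)) : Lˣ) =
      unitsIncl K L (normU K L (y.toMul : Lˣ)) := by
  rw [← h.prod_galU, LinearMap.sum_apply, toMul_sum, Subgroup.val_finsetProd]
  exact Finset.prod_congr rfl fun i _ => galSUnits_pow_apply S σ i y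

theorem exists_of_galU_eq (h : IsKummer p ζ x ξ σ) {y : Lˣ} (hy : galU σ y = y) :
    ∃ z : Kˣ, unitsIncl K L z = y := by
  have := h.isGalois
  have h1 : ∀ τ : Gal(L/K), τ (y : L) = y := by
    intro τ
    obtain ⟨n, rfl⟩ := h.mem_zpowers τ
    have : σ ∈ MulAction.stabilizer Gal(L/K) (y : L) := by
      have := congrArg Units.val hy
      exact this
    exact Subgroup.zpow_mem _ this n
  obtain ⟨z, hz⟩ := (IsGalois.mem_range_algebraMap_iff_fixed (F := K) (y : L)).mpr h1
  have hz0 : z ≠ 0 := by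
    rintro rfl
    exact y.ne_zero (by rw [← hz, map_zero])
  exact ⟨Units.mk0 z hz0, by ext; exact hz⟩

theorem unitsIncl_injective : Function.Injective (unitsIncl K L) := fun _ _ hab =>
  Units.ext ((algebraMap K L).injective (congrArg Units.val hab))

theorem finrank_ker [IsGalois K L] (h : IsKummer p ζ x ξ σ)
    (S : Finset (HeightOneSpectrum (𝓞 K))) :
    Module.finrank ℤ (LinearMap.ker (1 - galSUnits (L := L) S σ)) =
      Module.finrank ℤ (Additive (sUnits S)) := by
  let f : Additive (sUnits S) →ₗ[ℤ] Additive (sUnits (placesOver L S)) :=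
    (MonoidHom.toAdditive (((unitsIncl K L).comp (Subgroup.subtype _)).codRestrict
      (sUnits (placesOver L S)) fun y => unitsIncl_mem_sUnits_iff.mpr y.2)).toIntLinearMap
  have hf : Function.Injective f := by
    intro a b hab
    have h1 : unitsIncl K L (a.toMul : Kˣ) = unitsIncl K L (b.toMul : Kˣ) :=
      congrArg (fun t => ((Additive.toMul t : sUnits (placesOver L S)) : Lˣ)) hab
    exact Additive.toMul.injective (Subtype.ext (unitsIncl_injective h1))
  have hr : LinearMap.range f = LinearMap.ker (1 - galSUnits (L := L) S σ) := by
    ext y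
    rw [LinearMap.mem_range, LinearMap.mem_ker, LinearMap.sub_apply, sub_eq_zero]
    constructor
    · rintro ⟨z, rfl⟩
      apply Additive.toMul.injective
      apply Subtype.ext
      rw [galSUnits_apply]
      exact (galU_unitsIncl σ _).symm
    · intro hy
      have hy' : galU σ (y.toMul : Lˣ) = (y.toMul : Lˣ) := by
        rw [← galSUnits_apply, ← hy]; rfl
      obtain ⟨z, hz⟩ := h.exists_of_galU_eq hy'
      have hzS : z ∈ sUnits S := unitsIncl_mem_sUnits_iff.mp (hz ▸ y.toMul.2)
      exact ⟨Additive.ofMul ⟨z, hzS⟩, Additive.toMul.injective (Subtype.ext hz)⟩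
  rw [← hr, LinearMap.finrank_range_of_inj hf]

open Classical in
/-- The index of the norms among the `S`-units of a Kummer extension of prime degree. -/
theorem relIndex_norm_sUnits (h : IsKummer p ζ x ξ σ)
    {S : Finset (HeightOneSpectrum (𝓞 K))}
    (hS : ∀ v ∉ S, ∃ c : Kˣ, ordv v c = 1 ∧ ∀ u, u ∉ S → u ≠ v → ordv u c = 0)
    (hζ : ∀ v ∉ S, v.valuation K (1 - (ζ : K)) = 1) (hx : ∀ v ∉ S, ordv v x = 0)
    (hpos : ∀ τ : K →+* ℝ, 0 < τ x) :
    (normU K L).range.relIndex (sUnits S) ≠ 0 ∧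
    p * (normU K L).range.relIndex (sUnits S) ≤ p ^ (S.filter (IsNonsplit L)).card := by
  have := h.isGalois
  have := h.isUnramifiedAtInfinitePlaces hpos
  set E := Additive (sUnits (placesOver L S))
  set s : Module.End ℤ E := galSUnits S σ with hs
  have hp := h.prime
  have hsp : s ^ p = 1 := by
    refine LinearMap.ext fun y => Additive.toMul.injective (Subtype.ext ?_)
    rw [galSUnits_pow_apply, ← h.orderOf_eq, pow_orderOf_eq_one]
    ext; simp
  have key := relIndex_range_norm_pow hp s hsp (by
    intro y hy
    have h1 := h.sum_galSUnits_apply S y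
    rw [hy] at h1
    have h2 : normU K L (y.toMul : Lˣ) = 1 := unitsIncl_injective (by rw [← h1, map_one]; rfl)
    obtain ⟨z, hz, hz'⟩ := h.exists_div_of_normU_eq_one hS hζ hx y.toMul.2 h2
    exact ⟨Additive.ofMul ⟨z, hz⟩, Additive.toMul.injective (Subtype.ext hz')⟩)
  rw [h.finrank_ker S] at key
  have r1 := finrank_sUnits S
  have r2 := finrank_sUnits (placesOver L S)
  have r3 := card_placesOver (L := L) hp h.finrank_eq S
  have r4 := IsUnramifiedAtInfinitePlaces.card_infinitePlace K L
  rw [h.finrank_eq] at r4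
  set N : AddSubgroup E := ((∑ i ∈ Finset.range p, s ^ i : Module.End ℤ E) : E →+ E).range
  set Z : AddSubgroup E := ((1 - s : Module.End ℤ E) : E →+ E).ker
  set R := N.relIndex Z
  set s2 := (S.filter (IsNonsplit L)).card
  set rE := Module.finrank ℤ E
  set rK := Module.finrank ℤ (Additive (sUnits S))
  have hp1 := hp.one_lt
  have e : p * rK + (p - 1) = rE + (p - 1) * s2 := by
    have e1 : p * rK + p = p * Fintype.card (InfinitePlace K) + p * S.card := by
      rw [← mul_add, ← r1]; ring
    have : p - 1 + 1 = p := by lia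
    nlinarith
  have hpR : p * R = p ^ s2 := by
    have h1 : (p * R) ^ (p - 1) = (p ^ s2) ^ (p - 1) := by
      have h2 : (p * R) ^ (p - 1) * p ^ rE = (p ^ s2) ^ (p - 1) * p ^ rE := by
        calc (p * R) ^ (p - 1) * p ^ rE = p ^ (p - 1) * (R ^ (p - 1) * p ^ rE) := by ring
          _ = p ^ (p * rK + (p - 1)) := by rw [key]; ring
          _ = _ := by rw [e, ← pow_mul]; ring
      exact Nat.eq_of_mul_eq_mul_right (by positivity) h2
    exact Nat.pow_left_injective (by lia) h1
  have hR0 : R ≠ 0 := by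
    rintro h0
    rw [h0, mul_zero] at hpR
    exact (pow_ne_zero s2 hp.ne_zero) hpR.symm
  have hfin : Finite (Z ⧸ N.addSubgroupOf Z) := by
    have : (N.addSubgroupOf Z).FiniteIndex := ⟨hR0⟩
    infer_instance
  have hcl : ∀ u : Kˣ, u ∈ sUnits S → unitsIncl K L u ∈ sUnits (placesOver L S) := fun u hu =>
    unitsIncl_mem_sUnits_iff.mpr hu
  have hZ : ∀ (u : Kˣ) (hu : u ∈ sUnits S), (Additive.ofMul ⟨unitsIncl K L u, hcl u hu⟩ : E) ∈ Z := by
    intro u hu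
    change (1 - s : Module.End ℤ E) _ = 0
    rw [LinearMap.sub_apply, sub_eq_zero]
    apply Additive.toMul.injective
    apply Subtype.ext
    rw [galSUnits_apply]
    exact (galU_unitsIncl σ _).symm
  have := relIndex_le_card_of (normU K L).range (sUnits S)
    (fun u => if hu : u ∈ sUnits S then (QuotientAddGroup.mk (⟨_, hZ u hu⟩ : Z) :
      Z ⧸ N.addSubgroupOf Z) else 0) (by
    intro u hu w hw huw
    simp only [dif_pos hu, dif_pos hw] at huw
    rw [QuotientAddGroup.eq, AddSubgroup.mem_addSubgroupOf] at huw
    obtain ⟨y, hy⟩ := huw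
    refine ⟨y.toMul, ?_⟩
    apply unitsIncl_injective (L := L)
    rw [← h.sum_galSUnits_apply S y]
    refine (congrArg (fun t => ((Additive.toMul t : sUnits (placesOver L S)) : Lˣ)) hy).trans ?_
    rw [map_mul, map_inv]
    rfl)
  refine ⟨this.1, ?_⟩
  rw [← hpR]
  exact Nat.mul_le_mul_left _ this.2

end IsKummer
end

end

section

open IsDedekindDomain NumberField

section
open scoped ENNReal

/-- The formal Euler product `∏ (1 - w x)⁻¹`, expanded as a sum over monomials. -/
noncomputable def eulerSum {X : Type*} (w : X → ℝ≥0∞) : ℝ≥0∞ :=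
  ∑' f : X →₀ ℕ, f.prod fun x n => w x ^ n

theorem eulerSum_comp_le {X Y : Type*} (w : Y → ℝ≥0∞) {g : X → Y} (hg : Function.Injective g) :
    eulerSum (w ∘ g) ≤ eulerSum w := by
  have h : ∀ f : X →₀ ℕ, (f.prod fun x n => (w ∘ g) x ^ n) =
      (Finsupp.mapDomain g f).prod fun x n => w x ^ n := fun f =>
    (Finsupp.prod_mapDomain_index_inj (h := fun x n => w x ^ n) hg).symm
  unfold eulerSum
  simp_rw [h]
  exact ENNReal.tsum_comp_le_tsum_of_injective (Finsupp.mapDomain_injective hg) _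

theorem eulerSum_comp_equiv {X Y : Type*} (w : Y → ℝ≥0∞) (e : X ≃ Y) :
    eulerSum (w ∘ e) = eulerSum w := by
  refine le_antisymm (eulerSum_comp_le w e.injective) ?_
  have := eulerSum_comp_le (w ∘ e) e.symm.injective
  rwa [Function.comp_assoc, Equiv.self_comp_symm, Function.comp_id] at this

theorem eulerSum_sum {X Y : Type*} (w : X → ℝ≥0∞) (u : Y → ℝ≥0∞) :
    eulerSum (Sum.elim w u) = eulerSum w * eulerSum u := by
  unfold eulerSum
  rw [← Finsupp.sumFinsuppEquivProdFinsupp.symm.tsum_eq, ENNReal.tsum_prod']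
  simp_rw [← ENNReal.tsum_mul_right, ← ENNReal.tsum_mul_left]
  refine tsum_congr fun a => tsum_congr fun b => ?_
  exact Finsupp.prod_sumElim a b (fun x n => Sum.elim w u x ^ n)

theorem eulerSum_punit (w : PUnit → ℝ≥0∞) : eulerSum w = (1 - w PUnit.unit)⁻¹ := by
  unfold eulerSum
  rw [← ENNReal.tsum_geometric, ← (Finsupp.uniqueEquiv PUnit.unit).symm.tsum_eq]
  refine tsum_congr fun n => ?_
  have : (Finsupp.uniqueEquiv PUnit.unit).symm n = Finsupp.single PUnit.unit n := by
    rw [Equiv.symm_apply_eq]; simp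
  rw [this, Finsupp.prod_single_index (h := fun x n => w x ^ n) (pow_zero _)]

theorem eulerSum_le_two_pow {X : Type*} [Finite X] (w : X → ℝ≥0∞) (hw : ∀ x, w x ≤ 2⁻¹) :
    eulerSum w ≤ 2 ^ Nat.card X := by
  induction X using Finite.induction_empty_option with
  | of_equiv e ih =>
    rw [← eulerSum_comp_equiv w e, ← Nat.card_congr e]
    exact ih _ fun x => hw _
  | h_empty =>
    unfold eulerSum
    rw [tsum_eq_single 0 fun b hb => (hb (Subsingleton.elim _ _)).elim]
    simp
  | h_option ih =>
    rename_i X _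
    have e := eulerSum_comp_equiv w (Equiv.optionEquivSumPUnit.{0, _} X).symm
    have h2 : w ∘ (Equiv.optionEquivSumPUnit.{0, _} X).symm =
        Sum.elim (fun x => w (some x)) (fun _ => w none) := by
      ext (x | x) <;> simp
    rw [h2, eulerSum_sum, eulerSum_punit] at e
    rw [← e, Finite.card_option, pow_succ]
    refine mul_le_mul' (ih _ fun x => hw _) ?_
    rw [ENNReal.inv_le_iff_inv_le]
    exact ENNReal.le_sub_of_add_le_left ((hw none).trans_lt (by simp)).ne ((add_le_add (hw none) le_rfl).trans
      (by rw [ENNReal.inv_two_add_inv_two]))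

variable (K : Type*) [Field K] [NumberField K]

/-- The weight `N(I)⁻ˢ` of an ideal. -/
noncomputable def idealWeight (s : ℝ) : Ideal (𝓞 K) →* ℝ≥0∞ where
  toFun I := ENNReal.ofReal ((Ideal.absNorm I : ℝ) ^ (-s))
  map_one' := by simp
  map_mul' I J := by
    rw [map_mul, Nat.cast_mul, Real.mul_rpow (by positivity) (by positivity),
      ENNReal.ofReal_mul (by positivity)]

theorem idealWeight_apply (s : ℝ) (I : Ideal (𝓞 K)) :
    idealWeight K s I = ENNReal.ofReal ((Ideal.absNorm I : ℝ) ^ (-s)) := rfl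

/-- Unique factorization of ideals. -/
noncomputable def idealOfFinsupp (f : HeightOneSpectrum (𝓞 K) →₀ ℕ) :
    {I : Ideal (𝓞 K) // I ≠ ⊥} :=
  ⟨((Finsupp.toMultiset f).map HeightOneSpectrum.asIdeal).prod, by
    apply Multiset.prod_ne_zero
    intro h
    obtain ⟨v, _, hv⟩ := Multiset.mem_map.mp h
    exact v.ne_bot hv⟩

theorem idealOfFinsupp_bijective : Function.Bijective (idealOfFinsupp K) := by
  constructor
  · intro f g h
    have h1 : ∀ f : HeightOneSpectrum (𝓞 K) →₀ ℕ, ∀ I ∈ (Finsupp.toMultiset f).map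
        HeightOneSpectrum.asIdeal, Prime I := by
      intro f I hI
      obtain ⟨v, _, rfl⟩ := Multiset.mem_map.mp hI
      exact v.prime
    have h2 := UniqueFactorizationMonoid.normalizedFactors_prod_of_prime (h1 f)
    have h3 := UniqueFactorizationMonoid.normalizedFactors_prod_of_prime (h1 g)
    have h4 := congrArg Subtype.val h
    simp only [idealOfFinsupp] at h4
    rw [h4, h3] at h2
    classical
    exact Multiset.toFinsupp.symm.injective (Multiset.map_injective asIdeal_injective h2).symm
  · rintro ⟨I, hI⟩
    have : ∀ m : Multiset (Ideal (𝓞 K)), (∀ P ∈ m, Prime P) →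
        ∃ m' : Multiset (HeightOneSpectrum (𝓞 K)), m'.map HeightOneSpectrum.asIdeal = m := by
      intro m
      induction m using Multiset.induction_on with
      | empty => exact fun _ => ⟨0, rfl⟩
      | cons P m ih =>
        intro h
        obtain ⟨m', hm'⟩ := ih fun Q hQ => h Q (Multiset.mem_cons_of_mem hQ)
        have hP := h P (Multiset.mem_cons_self _ _)
        exact ⟨⟨P, Ideal.isPrime_of_prime hP, hP.ne_zero⟩ ::ₘ m', by
          rw [Multiset.map_cons, hm']⟩
    obtain ⟨m, hm⟩ := this (UniqueFactorizationMonoid.normalizedFactors I)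
      fun P hP => UniqueFactorizationMonoid.prime_of_normalized_factor P hP
    classical
    refine ⟨Multiset.toFinsupp m, Subtype.ext ?_⟩
    simp only [idealOfFinsupp, Multiset.toFinsupp_toMultiset]
    rw [hm]
    exact associated_iff_eq.mp (UniqueFactorizationMonoid.prod_normalizedFactors hI)

theorem eulerSum_eq_tsum_ideal (s : ℝ) :
    eulerSum (fun v : HeightOneSpectrum (𝓞 K) => idealWeight K s v.asIdeal) =
      ∑' I : {I : Ideal (𝓞 K) // I ≠ ⊥}, idealWeight K s I := by
  unfold eulerSum
  rw [← (Equiv.ofBijective _ (idealOfFinsupp_bijective K)).tsum_eq]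
  refine tsum_congr fun f => ?_
  simp only [Equiv.ofBijective_apply, idealOfFinsupp]
  rw [map_multiset_prod, Multiset.map_map, Finsupp.toMultiset_map, Finsupp.prod_toMultiset,
    Finsupp.prod_mapDomain_index (fun _ => pow_zero _) (fun _ _ _ => pow_add _ _ _)]
  rfl

theorem eulerSum_eq_tsum_nat (s : ℝ) :
    eulerSum (fun v : HeightOneSpectrum (𝓞 K) => idealWeight K s v.asIdeal) =
      ∑' n : ℕ, ENNReal.ofReal (if n = 0 then 0 else
        (Nat.card {I : Ideal (𝓞 K) // Ideal.absNorm I = n} : ℝ) * (n : ℝ) ^ (-s)) := by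
  rw [eulerSum_eq_tsum_ideal, ← (Equiv.sigmaFiberEquiv
    (fun I : {I : Ideal (𝓞 K) // I ≠ ⊥} => Ideal.absNorm I.1)).tsum_eq, ENNReal.tsum_sigma']
  refine tsum_congr fun n => ?_
  have h1 : ∀ I : {I : {I : Ideal (𝓞 K) // I ≠ ⊥} // Ideal.absNorm I.1 = n},
      idealWeight K s ((Equiv.sigmaFiberEquiv
        (fun I : {I : Ideal (𝓞 K) // I ≠ ⊥} => Ideal.absNorm I.1)) ⟨n, I⟩) =
      ENNReal.ofReal ((n : ℝ) ^ (-s)) := by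
    intro I
    rw [idealWeight_apply]
    congr
    exact I.2
  rw [tsum_congr h1, ENNReal.tsum_const]
  rcases eq_or_ne n 0 with rfl | hn
  · have : IsEmpty {I : {I : Ideal (𝓞 K) // I ≠ ⊥} // Ideal.absNorm I.1 = 0} :=
      ⟨fun I => I.1.2 (Ideal.absNorm_eq_zero_iff.mp I.2)⟩
    rw [ENat.card_eq_zero_iff_empty _ |>.mpr this]
    simp
  · rw [if_neg hn]
    let e : {I : {I : Ideal (𝓞 K) // I ≠ ⊥} // Ideal.absNorm I.1 = n} ≃
        {I : Ideal (𝓞 K) // Ideal.absNorm I = n} :=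
      { toFun := fun I => ⟨I.1.1, I.2⟩
        invFun := fun I => ⟨⟨I.1, fun h => hn (by rw [← I.2, h]; simp)⟩, I.2⟩
        left_inv := fun _ => rfl
        right_inv := fun _ => rfl }
    have : Finite {I : Ideal (𝓞 K) // Ideal.absNorm I = n} :=
      (Ideal.finite_setOfPred_absNorm_eq n).to_subtype
    rw [ENat.card_congr e, ENat.card_eq_coe_natCard, ENNReal.ofReal_mul (by positivity),
      ENNReal.ofReal_natCast]
    rfl

theorem dedekindZeta_eq_of_ne_zero {s : ℝ} (h : dedekindZeta K s ≠ 0) :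
    eulerSum (fun v : HeightOneSpectrum (𝓞 K) => idealWeight K s v.asIdeal) ≠ ⊤ ∧
    dedekindZeta K s = ((eulerSum (fun v : HeightOneSpectrum (𝓞 K) =>
      idealWeight K s v.asIdeal)).toReal : ℂ) := by
  rw [eulerSum_eq_tsum_nat]
  set r : ℕ → ℝ := fun n => if n = 0 then 0 else
        (Nat.card {I : Ideal (𝓞 K) // Ideal.absNorm I = n} : ℝ) * (n : ℝ) ^ (-s) with hr
  have hr0 : ∀ n, 0 ≤ r n := by
    intro n
    simp only [hr]
    split_ifs
    · exact le_rfl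
    · positivity
  have hterm : ∀ n, LSeries.term (fun n ↦ (Nat.card {I : Ideal (𝓞 K) // Ideal.absNorm I = n} : ℂ))
      (s : ℂ) n = ((r n : ℝ) : ℂ) := by
    intro n
    rw [LSeries.term_def]
    simp only [hr]
    split_ifs
    · simp
    · rw [Complex.ofReal_mul, Complex.ofReal_cpow (by positivity), Complex.ofReal_neg,
        Complex.cpow_neg, div_eq_mul_inv]
      simp
  have hz : dedekindZeta K s = ∑' n, ((r n : ℝ) : ℂ) := by
    rw [dedekindZeta, LSeries]
    exact tsum_congr hterm
  have hs : Summable r := by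
    by_contra hns
    rw [hz, tsum_eq_zero_of_not_summable] at h
    · exact h rfl
    · rwa [Complex.summable_ofReal]
  rw [← ENNReal.ofReal_tsum_of_nonneg hr0 hs]
  refine ⟨ENNReal.ofReal_ne_top, ?_⟩
  rw [ENNReal.toReal_ofReal (tsum_nonneg hr0), hz, Complex.ofReal_tsum]

theorem idealWeight_le_half {s : ℝ} (hs : 1 ≤ s) (v : HeightOneSpectrum (𝓞 K)) :
    idealWeight K s v.asIdeal ≤ 2⁻¹ := by
  have h2 : 2 ≤ Ideal.absNorm v.asIdeal := by
    have h0 : Ideal.absNorm v.asIdeal ≠ 0 := fun h => v.ne_bot (Ideal.absNorm_eq_zero_iff.mp h)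
    have h1 : Ideal.absNorm v.asIdeal ≠ 1 := fun h =>
      v.isPrime.ne_top (Ideal.absNorm_eq_one_iff.mp h)
    lia
  have h2' : (2 : ℝ) ≤ Ideal.absNorm v.asIdeal := by exact_mod_cast h2
  have h3 : ((Ideal.absNorm v.asIdeal : ℝ) ^ (-s)) ≤ 2⁻¹ := by
    rw [Real.rpow_neg (by positivity)]
    refine inv_anti₀ (by norm_num) (h2'.trans ?_)
    calc (Ideal.absNorm v.asIdeal : ℝ) = (Ideal.absNorm v.asIdeal : ℝ) ^ (1 : ℝ) := by simp
      _ ≤ _ := Real.rpow_le_rpow_of_exponent_le (by linarith) hs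
  rw [idealWeight_apply]
  refine (ENNReal.ofReal_le_ofReal h3).trans ?_
  rw [ENNReal.ofReal_inv_of_pos (by norm_num)]
  simp

theorem eulerSum_sq_le {F M : Type*} [Field F] [NumberField F] [Field M]
    [NumberField M] [Algebra F M] (S : Finset (HeightOneSpectrum (𝓞 F)))
    (P Q : ∀ v ∉ S, HeightOneSpectrum (𝓞 M)) (hPQ : ∀ v hv, P v hv ≠ Q v hv)
    (hP : ∀ v hv, placeBelow F (P v hv) = v) (hQ : ∀ v hv, placeBelow F (Q v hv) = v)
    (hPn : ∀ v hv, Ideal.absNorm (P v hv).asIdeal = Ideal.absNorm v.asIdeal)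
    (hQn : ∀ v hv, Ideal.absNorm (Q v hv).asIdeal = Ideal.absNorm v.asIdeal)
    {s : ℝ} (hs : 1 ≤ s) :
    eulerSum (fun v : HeightOneSpectrum (𝓞 F) => idealWeight F s v.asIdeal) ^ 2 ≤
      (2 ^ S.card) ^ 2 *
        eulerSum (fun v : HeightOneSpectrum (𝓞 M) => idealWeight M s v.asIdeal) := by
  set ZF : ℝ → ℝ≥0∞ := fun s => eulerSum (fun v : HeightOneSpectrum (𝓞 F) =>
    idealWeight F s v.asIdeal) with hZF
  set ZM : ℝ → ℝ≥0∞ := fun s => eulerSum (fun v : HeightOneSpectrum (𝓞 M) =>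
    idealWeight M s v.asIdeal) with hZM
  change ZF s ^ 2 ≤ _ * ZM s
  set w := fun v : HeightOneSpectrum (𝓞 F) => idealWeight F s v.asIdeal with hw
  set ZN := eulerSum (fun v : {v // v ∉ S} => w v) with hZN
  have h1 : ZF s ≤ 2 ^ S.card * ZN := by
    classical
    have e := eulerSum_comp_equiv w (Equiv.sumCompl (· ∈ S))
    have e2 : w ∘ (Equiv.sumCompl (· ∈ S)) = Sum.elim (fun v : {v // v ∈ S} => w v)
        (fun v : {v // v ∉ S} => w v) := by
      ext (v | v) <;> rfl
    rw [e2, eulerSum_sum] at e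
    rw [hZF]
    dsimp only
    rw [← e]
    refine mul_le_mul' ?_ le_rfl
    refine (eulerSum_le_two_pow _ fun v => idealWeight_le_half F hs _).trans ?_
    rw [Nat.card_eq_fintype_card, Fintype.card_coe]
  have h2 : ZN ^ 2 ≤ ZM s := by
    rw [pow_two, hZN, ← eulerSum_sum]
    let g : {v // v ∉ S} ⊕ {v // v ∉ S} → HeightOneSpectrum (𝓞 M) :=
      Sum.elim (fun v => P v.1 v.2) (fun v => Q v.1 v.2)
    have hg : Function.Injective g := by
      rintro (⟨v, hv⟩ | ⟨v, hv⟩) (⟨u, hu⟩ | ⟨u, hu⟩) h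
      · have h' : P v hv = P u hu := h
        have : v = u := by rw [← hP v hv, ← hP u hu, h']
        subst this; rfl
      · exfalso
        have h' : P v hv = Q u hu := h
        have : v = u := by rw [← hP v hv, ← hQ u hu, h']
        subst this
        exact hPQ _ _ h'
      · exfalso
        have h' : Q v hv = P u hu := h
        have : v = u := by rw [← hQ v hv, ← hP u hu, h']
        subst this
        exact hPQ _ _ h'.symm
      · have h' : Q v hv = Q u hu := h
        have : v = u := by rw [← hQ v hv, ← hQ u hu, h']
        subst this; rfl
    have e : Sum.elim (fun v : {v // v ∉ S} => w v) (fun v : {v // v ∉ S} => w v) =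
        (fun v : HeightOneSpectrum (𝓞 M) => idealWeight M s v.asIdeal) ∘ g := by
      ext (⟨v, hv⟩ | ⟨v, hv⟩)
      · simp [hw, g, idealWeight_apply, hPn]
      · simp [hw, g, idealWeight_apply, hQn]
    rw [e]
    exact eulerSum_comp_le _ hg
  calc ZF s ^ 2 ≤ (2 ^ S.card * ZN) ^ 2 := pow_le_pow_left' h1 2
    _ = (2 ^ S.card) ^ 2 * ZN ^ 2 := mul_pow _ _ _
    _ ≤ _ := mul_le_mul' le_rfl h2

open Filter Topology in
theorem eventually_dedekindZeta_ne_zero (N : Type*) [Field N] [NumberField N] :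
    ∀ᶠ s : ℝ in 𝓝[>] 1, dedekindZeta N s ≠ 0 := by
  have hne : (dedekindZeta_residue N : ℂ) ≠ 0 := by
    exact_mod_cast dedekindZeta_residue_ne_zero N
  filter_upwards [(tendsto_sub_one_mul_dedekindZeta_nhdsGT N).eventually
    (isOpen_ne.mem_nhds hne)] with s (hs : _ ≠ 0) h0
  rw [h0, mul_zero] at hs
  exact hs rfl

open Filter Topology in
/-- Almost all primes cannot have two distinct primes of the same norm above them. -/
theorem exists_not_two_primes_above (F M : Type*) [Field F] [NumberField F] [Field M]
    [NumberField M] [Algebra F M] (S : Finset (HeightOneSpectrum (𝓞 F))) :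
    ∃ v ∉ S, ¬ ∃ P Q : HeightOneSpectrum (𝓞 M), P ≠ Q ∧ placeBelow F P = v ∧
      placeBelow F Q = v ∧ Ideal.absNorm P.asIdeal = Ideal.absNorm v.asIdeal ∧
      Ideal.absNorm Q.asIdeal = Ideal.absNorm v.asIdeal := by
  by_contra! hcon
  choose P Q hPQ hP hQ hPn hQn using hcon
  set ZF : ℝ → ℝ≥0∞ := fun s => eulerSum (fun v : HeightOneSpectrum (𝓞 F) =>
    idealWeight F s v.asIdeal) with hZF
  set ZM : ℝ → ℝ≥0∞ := fun s => eulerSum (fun v : HeightOneSpectrum (𝓞 M) =>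
    idealWeight M s v.asIdeal) with hZM
  have hle : ∀ s : ℝ, 1 ≤ s → ZF s ^ 2 ≤ (2 ^ S.card) ^ 2 * ZM s := fun s hs =>
    eulerSum_sq_le S P Q hPQ hP hQ hPn hQn hs
  have tF := tendsto_sub_one_mul_dedekindZeta_nhdsGT F
  have tM := tendsto_sub_one_mul_dedekindZeta_nhdsGT M
  have tF2 : Tendsto (fun s : ℝ => ((s - 1) * (ZF s).toReal) ^ 2) (𝓝[>] 1)
      (𝓝 (dedekindZeta_residue F ^ 2)) := by
    refine Tendsto.pow ?_ 2
    rw [← tendsto_ofReal_iff]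
    refine tF.congr' ?_
    filter_upwards [eventually_dedekindZeta_ne_zero F] with s hs
    rw [(dedekindZeta_eq_of_ne_zero F hs).2]
    push_cast; rfl
  have tM2 : Tendsto (fun s : ℝ => (2 ^ S.card) ^ 2 * ((s - 1) * ((s - 1) * (ZM s).toReal)))
      (𝓝[>] 1) (𝓝 ((2 ^ S.card) ^ 2 * (0 * dedekindZeta_residue M))) := by
    refine Tendsto.const_mul _ (Tendsto.mul ?_ ?_)
    · have : Tendsto (fun s : ℝ => s - 1) (𝓝 1) (𝓝 (1 - 1)) := tendsto_id.sub_const 1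
      rw [sub_self] at this
      exact this.mono_left nhdsWithin_le_nhds
    · rw [← tendsto_ofReal_iff]
      refine tM.congr' ?_
      filter_upwards [eventually_dedekindZeta_ne_zero M] with s hs
      rw [(dedekindZeta_eq_of_ne_zero M hs).2]
      push_cast; rfl
  have hfin := le_of_tendsto_of_tendsto tF2 tM2 (by
    filter_upwards [eventually_dedekindZeta_ne_zero F, eventually_dedekindZeta_ne_zero M, self_mem_nhdsWithin] with s h1 h2 (h3 : 1 < s)
    have hF := (dedekindZeta_eq_of_ne_zero F h1).1
    have hM := (dedekindZeta_eq_of_ne_zero M h2).1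
    have h4 := ENNReal.toReal_mono (ENNReal.mul_ne_top (by simp) hM) (hle s h3.le)
    rw [ENNReal.toReal_pow, ENNReal.toReal_mul, ENNReal.toReal_pow, ENNReal.toReal_pow,
      ENNReal.toReal_ofNat] at h4
    have h5 := mul_le_mul_of_nonneg_left h4 (sq_nonneg (s - 1))
    linarith)
  rw [zero_mul, mul_zero] at hfin
  have := dedekindZeta_residue_pos F
  nlinarith
end

end

section

open IsDedekindDomain NumberField WithZero

section
variable {K : Type} [Field K] [NumberField K] {p : ℕ} {ζ : Kˣ}

theorem exists_isKummer (hp : p.Prime) (hζ : IsPrimitiveRoot ζ p) {x : Kˣ}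
    (hx : ∀ y : Kˣ, y ^ p ≠ x) :
    ∃ (L : Type) (_ : Field L) (_ : NumberField L) (_ : Algebra K L) (ξ : Lˣ) (σ : Gal(L/K)),
      IsKummer p ζ x ξ σ := by
  have H : Irreducible (Polynomial.X ^ p - Polynomial.C (x : K)) := by
    refine X_pow_sub_C_irreducible_of_prime hp fun b hb => ?_
    have hb0 : b ≠ 0 := by
      rintro rfl
      rw [zero_pow hp.ne_zero] at hb
      exact x.ne_zero hb.symm
    exact hx (Units.mk0 b hb0) (Units.ext hb)
  have hζ' : IsPrimitiveRoot (ζ : K) p := IsPrimitiveRoot.coe_units_iff.mpr hζ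
  have hne : (primitiveRoots p K).Nonempty := ⟨ζ, (mem_primitiveRoots hp.pos).mpr hζ'⟩
  have := Fact.mk H
  have : NeZero p := ⟨hp.ne_zero⟩
  let L := AdjoinRoot (Polynomial.X ^ p - Polynomial.C (x : K))
  have hsp : Polynomial.IsSplittingField K L (Polynomial.X ^ p - Polynomial.C (x : K)) :=
    isSplittingField_AdjoinRoot_X_pow_sub_C hne H
  have hfd : FiniteDimensional K L := Polynomial.IsSplittingField.finiteDimensional L
    (Polynomial.X ^ p - Polynomial.C (x : K))
  have hcz : CharZero L := charZero_of_injective_algebraMap (algebraMap K L).injective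
  have hnf : NumberField L := NumberField.of_module_finite K L
  have hroot : (AdjoinRoot.root (Polynomial.X ^ p - Polynomial.C (x : K)) : L) ^ p =
      algebraMap K L x := root_X_pow_sub_C_pow p (x : K)
  have hr0 : (AdjoinRoot.root (Polynomial.X ^ p - Polynomial.C (x : K)) : L) ≠ 0 := by
    intro h0
    rw [h0, zero_pow hp.ne_zero] at hroot
    exact x.ne_zero ((algebraMap K L).injective (by rw [← hroot, map_zero]))
  refine ⟨L, inferInstance, hnf, inferInstance, Units.mk0 _ hr0,
    (autEquivZmod H L hζ').symm (Multiplicative.ofAdd ((1 : ℕ) : ZMod p)), hp, hζ, ?_, ?_,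
    finrank_of_isSplittingField_X_pow_sub_C hne H L,
    isGalois_of_isSplittingField_X_pow_sub_C hne H L⟩
  · ext; exact hroot
  · ext
    have := autEquivZmod_symm_apply_natCast H L hroot hζ' 1
    rw [pow_one, Algebra.smul_def] at this
    exact this

namespace IsKummer
variable {L : Type} [Field L] [NumberField L] [Algebra K L]
    {x : Kˣ} {ξ : Lˣ} {σ : Gal(L/K)}

theorem prim_unitsIncl (h : IsKummer p ζ x ξ σ) : IsPrimitiveRoot (unitsIncl K L ζ) p :=
  h.prim.map_of_injective unitsIncl_injective

/-- Kummer theory: an element becoming a `p`-th power in `K(x^{1/p})` is a power of `x` up to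
`p`-th powers. -/
theorem exists_of_unitsIncl_eq_pow (h : IsKummer p ζ x ξ σ) {y : Kˣ} {z : Lˣ}
    (hz : unitsIncl K L y = z ^ p) : ∃ (i : ℕ) (k : Kˣ), y = x ^ i * k ^ p := by
  have : NeZero p := ⟨h.prime.ne_zero⟩
  have h1 : (galU σ z * z⁻¹) ^ p = 1 := by
    rw [mul_pow, ← map_pow, inv_pow, ← hz, galU_unitsIncl, mul_inv_cancel]
  have h2 : ((galU σ z * z⁻¹ : Lˣ) : L) ^ p = 1 := by
    rw [← Units.val_pow_eq_pow_val, h1]; rfl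
  obtain ⟨i, _, hi⟩ := (IsPrimitiveRoot.coe_units_iff.mpr h.prim_unitsIncl).eq_pow_of_pow_eq_one h2
  have h3 : galU σ z = unitsIncl K L ζ ^ i * z := by
    rw [← mul_inv_eq_iff_eq_mul]
    exact Units.ext (by rw [← hi]; simp)
  have h4 : galU σ (z * (ξ ^ i)⁻¹) = z * (ξ ^ i)⁻¹ := by
    rw [map_mul, map_inv, map_pow, h.galU_eq, h3, mul_pow, mul_inv]
    rw [mul_mul_mul_comm, mul_inv_cancel, one_mul]
  obtain ⟨k, hk⟩ := h.exists_of_galU_eq h4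
  refine ⟨i, k, unitsIncl_injective (L := L) ?_⟩
  rw [hz, map_mul, map_pow, map_pow, hk, ← h.pow_eq, mul_pow, inv_pow, ← pow_mul, ← pow_mul,
    mul_comm i p]
  simp

end IsKummer

/-- An element that is not a `p`-th power fails to be a local `p`-th power at some place outside
a given finite set. -/
theorem exists_notMem_locPow_notMem (hp : p.Prime) (hζ : IsPrimitiveRoot ζ p) {x : Kˣ}
    (hx : ∀ y : Kˣ, y ^ p ≠ x) (S : Finset (HeightOneSpectrum (𝓞 K))) :
    ∃ v ∉ S, x ∉ locPow p ζ v := by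
  obtain ⟨L, _, _, _, ξ, σ, h⟩ := exists_isKummer hp hζ hx
  have := h.isGalois
  obtain ⟨v, hv, hno⟩ := exists_not_two_primes_above K L S
  refine ⟨v, hv, fun hxv => ?_⟩
  have hns := h.not_isNonsplit_of_mem_locPow hxv
  rcases prime_degree_cases h.prime h.finrank_eq v with ⟨_, h1⟩ | ⟨h1, _⟩
  · simp only [IsNonsplit, not_forall] at hns
    obtain ⟨P, Q, hP, hQ, hPQ⟩ := hns
    refine hno ⟨P, Q, hPQ, hP, hQ, ?_, ?_⟩
    · rw [card_quotient_eq (K := K), (h1 P hP).2, pow_one, hP]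
    · rw [card_quotient_eq (K := K), (h1 Q hQ).2, pow_one, hQ]
  · exact hns h1

theorem finite_valuation_one_sub_ne_one (hp : p.Prime) (hζ : IsPrimitiveRoot ζ p) :
    {v : HeightOneSpectrum (𝓞 K) | v.valuation K (1 - (ζ : K)) ≠ 1}.Finite := by
  have h0 : 1 - (ζ : K) ≠ 0 := by
    rw [sub_ne_zero]
    exact fun h1 => hζ.ne_one hp.one_lt (Units.ext h1.symm)
  refine (finite_ordv_ne_zero (Units.mk0 _ h0)).subset fun v hv => ?_
  simp only [Set.mem_ofPred_eq] at hv ⊢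
  rwa [Ne, ordv_eq_zero_iff]

theorem IsKummer.exists_mem_locPow_notMem_locPow {L : Type} [Field L] [NumberField L]
    [Algebra K L] {b : Kˣ} {ξ : Lˣ} {σ : Gal(L/K)} (h : IsKummer p ζ b ξ σ) {x : Kˣ}
    (hx : ∀ (i : ℕ) (k : Kˣ), x ≠ b ^ i * k ^ p) (S : Finset (HeightOneSpectrum (𝓞 K))) :
    ∃ w ∉ S, b ∈ locPow p ζ w ∧ x ∉ locPow p ζ w := by
  classical
  have := h.isGalois
  set S' := S ∪ (finite_valuation_one_sub_ne_one h.prime h.prim).toFinset ∪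
    (finite_ordv_ne_zero x).toFinset ∪ (finite_ordv_ne_zero b).toFinset with hS'
  obtain ⟨P, hP, hxP⟩ := exists_notMem_locPow_notMem h.prime h.prim_unitsIncl
    (x := unitsIncl K L x) (fun z hz => by
      obtain ⟨i, k, hik⟩ := h.exists_of_unitsIncl_eq_pow hz.symm
      exact hx i k hik) (placesOver L S')
  rw [mem_placesOver] at hP
  set w := placeBelow K P with hw
  simp only [hS', Finset.mem_union, not_or, Set.Finite.mem_toFinset, Set.mem_ofPred_eq,
    not_not] at hP
  obtain ⟨⟨⟨h1, h2⟩, h3⟩, h4⟩ := hP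
  refine ⟨w, h1, ?_, fun hxw => hxP (unitsIncl_mem_locPow hw.symm h2 hxw)⟩
  by_contra hb
  have hf : inertK K P ≠ 1 := fun hf => hb (h.mem_locPow_of_inertK_eq_one h2 h4 hw.symm hf)
  have hf' : inertK K P = p := by
    rcases prime_degree_cases h.prime h.finrank_eq w with ⟨_, h5⟩ | ⟨_, h5⟩
    · exact absurd (h5 P hw.symm).2 hf
    · rcases h5 P hw.symm with h6 | h6
      · exact absurd h6.2 hf
      · exact h6.2
  exact hxP (unitsIncl_mem_locPow_of_inertK_eq h.prime h.prim h2 h3 hw.symm hf')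

end

end

section

open IsDedekindDomain NumberField WithZero

section
variable {G : Type*} [CommGroup G]

theorem relIndex_range_pow_zpowers (p : ℕ) (hp : p ≠ 0) (b : G) :
    (powMonoidHom p : G →* G).range.relIndex (Subgroup.zpowers b) ≠ 0 ∧
    (powMonoidHom p : G →* G).range.relIndex (Subgroup.zpowers b) ≤ p := by
  classical
  have : NeZero p := ⟨hp⟩
  have h := relIndex_le_card_of (powMonoidHom p : G →* G).range (Subgroup.zpowers b)
    (fun x => if h : ∃ i : ℤ, b ^ i = x then ((h.choose : ℤ) : ZMod p) else 0) (by
      rintro x ⟨i, hi⟩ y ⟨j, hj⟩ hxy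
      have hi' : ∃ i : ℤ, b ^ i = x := ⟨i, hi⟩
      have hj' : ∃ i : ℤ, b ^ i = y := ⟨j, hj⟩
      simp only [hi', hj', dif_pos] at hxy
      rw [ZMod.intCast_eq_intCast_iff_dvd_sub] at hxy
      obtain ⟨c, hc⟩ := hxy
      refine ⟨b ^ c, ?_⟩
      rw [powMonoidHom_apply, ← hi'.choose_spec, ← hj'.choose_spec, ← zpow_neg, ← zpow_add,
        ← zpow_natCast, ← zpow_mul, mul_comm c, ← hc]
      congr 1
      ring)
  rwa [Nat.card_zmod] at h

theorem relIndex_le_relIndex_of_inf_le {H H' L : Subgroup G} (h : H ⊓ L ≤ H')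
    (h0 : H.relIndex L ≠ 0) : H'.relIndex L ≤ H.relIndex L := by
  rw [← Subgroup.inf_relIndex_right H L] at h0 ⊢
  exact Subgroup.relIndex_le_of_le_left h h0

end

section
variable {K : Type} [Field K] [NumberField K] {p : ℕ} {ζ : Kˣ}

theorem relIndex_range_pow_sUnits (hp : p.Prime) (hζ : IsPrimitiveRoot ζ p)
    (S : Finset (HeightOneSpectrum (𝓞 K))) :
    (powMonoidHom p : Kˣ →* Kˣ).range.relIndex (sUnits S) =
      p ^ (Fintype.card (InfinitePlace K) + S.card) := by
  have : NeZero p := ⟨hp.ne_zero⟩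
  have h1 := index_range_nsmul_eq (A := Additive (sUnits S)) hp.ne_zero
  have h2 : Nat.card (nsmulAddMonoidHom (α := Additive (sUnits S)) p).ker = p := by
    have h3 := (IsPrimitiveRoot.coe_units_iff.mpr hζ).card_rootsOfUnity
    have h5 : ∀ y : rootsOfUnity p K, (y : Kˣ) ∈ sUnits S := fun y => by
      refine mem_sUnits_of_pow hp.ne_zero ?_
      rw [(mem_rootsOfUnity _ _).mp y.2]
      exact one_mem _
    refine (Nat.card_eq_of_bijective (β := rootsOfUnity p K)
      (fun y : (nsmulAddMonoidHom (α := Additive (sUnits S)) p).ker =>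
        ⟨((y.1.toMul : sUnits S) : Kˣ),
          congrArg (fun z : Additive (sUnits S) => ((z.toMul : sUnits S) : Kˣ)) y.2⟩)
      ⟨fun y z hyz => ?_, fun y => ⟨⟨Additive.ofMul ⟨y.1, h5 y⟩, ?_⟩, rfl⟩⟩).trans h3
    · have h6 : ((y.1.toMul : sUnits S) : Kˣ) = (z.1.toMul : sUnits S) :=
        congrArg (fun q : rootsOfUnity p K => (q : Kˣ)) hyz
      exact Subtype.ext (Additive.toMul.injective (Subtype.ext h6))
    · rw [AddMonoidHom.mem_ker]
      exact Additive.toMul.injective (Subtype.ext ((mem_rootsOfUnity _ _).mp y.2))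
  rw [h2, ← pow_succ, finrank_sUnits] at h1
  rw [← h1]
  change ((powMonoidHom p : Kˣ →* Kˣ).range.subgroupOf (sUnits S)).index = _
  have h4 : (powMonoidHom p : Kˣ →* Kˣ).range.subgroupOf (sUnits S) =
      (powMonoidHom p : sUnits S →* sUnits S).range := by
    ext ⟨x, hx⟩
    rw [Subgroup.mem_subgroupOf]
    constructor
    · rintro ⟨y, hy⟩
      have hy' : y ^ p = x := hy
      exact ⟨⟨y, mem_sUnits_of_pow hp.ne_zero (by rwa [hy'])⟩, Subtype.ext hy⟩
    · rintro ⟨y, hy⟩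
      exact ⟨y, congrArg Subtype.val hy⟩
  rw [h4, ← Subgroup.index_toAddSubgroup]
  rfl

theorem range_pow_le_locPow (v : HeightOneSpectrum (𝓞 K)) :
    (powMonoidHom p : Kˣ →* Kˣ).range ≤ locPow p ζ v := by
  rintro _ ⟨y, rfl⟩
  exact pow_mem_locPow ζ v y

theorem range_pow_le_iInf_locPow (T : Finset (HeightOneSpectrum (𝓞 K))) :
    (powMonoidHom p : Kˣ →* Kˣ).range ≤ ⨅ w ∈ T, locPow p ζ w :=
  le_iInf₂ fun w _ => range_pow_le_locPow w

theorem relIndex_ne_zero_of_range_pow_le (hp : p.Prime) (hζ : IsPrimitiveRoot ζ p)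
    (S : Finset (HeightOneSpectrum (𝓞 K))) {H : Subgroup Kˣ}
    (hH : (powMonoidHom p : Kˣ →* Kˣ).range ≤ H) : H.relIndex (sUnits S) ≠ 0 := by
  intro h
  have h1 := Subgroup.relIndex_eq_zero_of_le_left hH h
  rw [relIndex_range_pow_sUnits hp hζ] at h1
  exact pow_ne_zero _ hp.ne_zero h1

theorem sUnits_le_unitsAt {S : Finset (HeightOneSpectrum (𝓞 K))} {w : HeightOneSpectrum (𝓞 K)}
    (hw : w ∉ S) : sUnits S ≤ unitsAt w := fun _ hx => hx w hw

theorem relIndex_iInf_locPow_le (hp : p.Prime) (hζ : IsPrimitiveRoot ζ p)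
    {S : Finset (HeightOneSpectrum (𝓞 K))} (hS : ∀ v ∉ S, v.valuation K (1 - (ζ : K)) = 1)
    (T : Finset (HeightOneSpectrum (𝓞 K))) (hT : ∀ w ∈ T, w ∉ S) :
    (⨅ w ∈ T, locPow p ζ w).relIndex (sUnits S) ≤ p ^ T.card := by
  classical
  induction T using Finset.induction_on with
  | empty => simp
  | insert w T hw ih =>
    rw [Finset.iInf_insert, Finset.card_insert_of_notMem hw, pow_succ']
    refine (Subgroup.relIndex_inf_le).trans
      (Nat.mul_le_mul ?_ (ih fun u hu => hT u (Finset.mem_insert_of_mem hu)))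
    have h1 := hT w (Finset.mem_insert_self _ _)
    have h2 := relIndex_locPow_unitsAt hp hζ w (k := 0) (by rw [hS w h1]; simp)
    refine (Subgroup.relIndex_le_of_le_right (sUnits_le_unitsAt h1) h2.1).trans ?_
    simpa using h2.2

/-- Auxiliary places at which `b` is a local `p`-th power and at which the `S`-units are as
independent as possible. -/
theorem IsKummer.exists_finset_places {L : Type} [Field L] [NumberField L]
    [Algebra K L] {b : Kˣ} {ξ : Lˣ} {σ : Gal(L/K)} (h : IsKummer p ζ b ξ σ)
    {S : Finset (HeightOneSpectrum (𝓞 K))} (hS : ∀ v ∉ S, v.valuation K (1 - (ζ : K)) = 1)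
    (n : ℕ) (hn : n + 1 ≤ Fintype.card (InfinitePlace K) + S.card) :
    ∃ T : Finset (HeightOneSpectrum (𝓞 K)), T.card = n ∧ (∀ w ∈ T, w ∉ S) ∧
      (∀ w ∈ T, b ∈ locPow p ζ w) ∧
      ∀ R ⊆ T, p ^ R.card ≤ (⨅ w ∈ R, locPow p ζ w).relIndex (sUnits S) := by
  classical
  have hp := h.prime
  have hζ := h.prim
  induction n with
  | zero => exact ⟨∅, by simp⟩
  | succ n ih =>
    obtain ⟨T, hTn, hTS, hTb, hT⟩ := ih (by lia)
    set s := Fintype.card (InfinitePlace K) + S.card with hs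
    set R := (powMonoidHom p : Kˣ →* Kˣ).range with hR
    set B := Subgroup.zpowers b ⊔ R with hB
    have hx : ∃ x ∈ sUnits S, x ∈ (⨅ w ∈ T, locPow p ζ w) ∧ x ∉ B := by
      by_contra! hcon
      have h1 : B.relIndex (sUnits S) ≤ p ^ n := by
        refine (relIndex_le_relIndex_of_inf_le (fun x hx => hcon x hx.2 hx.1)
          (relIndex_ne_zero_of_range_pow_le hp hζ S (range_pow_le_iInf_locPow T))).trans ?_
        rw [← hTn]
        exact relIndex_iInf_locPow_le hp hζ hS T hTS
      have h2 := Subgroup.relIndex_inf_mul_relIndex R B (sUnits S)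
      rw [inf_eq_left.mpr (le_sup_right : R ≤ B), hR, relIndex_range_pow_sUnits hp hζ] at h2
      have h3 := relIndex_range_pow_zpowers p hp.ne_zero b
      rw [← Subgroup.relIndex_sup_right] at h3
      have h4 := (Subgroup.relIndex_le_of_le_right (inf_le_left : B ⊓ sUnits S ≤ B) h3.1).trans h3.2
      have h5 : p ^ s ≤ p * p ^ n := by
        rw [← h2]
        exact Nat.mul_le_mul h4 h1
      rw [← pow_succ', Nat.pow_le_pow_iff_right hp.one_lt] at h5
      lia
    obtain ⟨x, hxS, hxT, hxB⟩ := hx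
    obtain ⟨w, hw, hbw, hxw⟩ := h.exists_mem_locPow_notMem_locPow (x := x) (fun i k hik => hxB (by
      rw [hik]
      exact mul_mem (Subgroup.mem_sup_left (Subgroup.pow_mem _ (Subgroup.mem_zpowers b) i))
        (Subgroup.mem_sup_right ⟨k, rfl⟩))) (S ∪ T)
    rw [Finset.mem_union, not_or] at hw
    refine ⟨insert w T, by rw [Finset.card_insert_of_notMem hw.2, hTn], ?_, ?_, ?_⟩
    · intro u hu
      rcases Finset.mem_insert.mp hu with rfl | hu
      exacts [hw.1, hTS u hu]
    · intro u hu
      rcases Finset.mem_insert.mp hu with rfl | hu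
      exacts [hbw, hTb u hu]
    · intro Q hQ
      by_cases hwQ : w ∈ Q
      · obtain ⟨Q', hwQ', rfl⟩ : ∃ Q', w ∉ Q' ∧ insert w Q' = Q :=
          ⟨Q.erase w, Finset.notMem_erase _ _, Finset.insert_erase hwQ⟩
        have hQ' : Q' ⊆ T := fun u hu => (Finset.mem_insert.mp
          (hQ (Finset.mem_insert_of_mem hu))).resolve_left (by rintro rfl; exact hwQ' hu)
        rw [Finset.iInf_insert, Finset.card_insert_of_notMem hwQ', pow_succ',
          ← Subgroup.relIndex_inf_mul_relIndex]
        refine Nat.mul_le_mul (le_relIndex_of_pow_mem hp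
          (fun y _ => pow_mem_locPow ζ w y) (x := x) ⟨?_, hxS⟩ hxw ?_) (hT Q' hQ')
        · exact biInf_mono (f := fun w => locPow p ζ w) (fun u hu => hQ' hu) hxT
        · intro h0
          exact relIndex_ne_zero_of_range_pow_le hp hζ S (range_pow_le_locPow w)
            (Subgroup.relIndex_eq_zero_of_le_right inf_le_right h0)
      · exact hT Q fun u hu => (Finset.mem_insert.mp (hQ hu)).resolve_left (by
          rintro rfl; exact hwQ hu)

end

end

section

open IsDedekindDomain NumberField WithZero

section
variable {K : Type} [Field K] [NumberField K] {p : ℕ} {ζ : Kˣ}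

/-- The elements whose valuation is divisible by `p`. -/
def dvdOrdAt (p : ℕ) (v : HeightOneSpectrum (𝓞 K)) : Subgroup Kˣ where
  carrier := {x | (p : ℤ) ∣ ordv v x}
  mul_mem' {a b} ha hb := by
    change (p : ℤ) ∣ _
    rw [ordv_mul]
    exact dvd_add ha hb
  one_mem' := by
    change (p : ℤ) ∣ _
    rw [ordv_one]; exact dvd_zero _
  inv_mem' {a} ha := by
    change (p : ℤ) ∣ _
    rw [ordv_inv]; exact (dvd_neg).mpr ha

theorem mem_dvdOrdAt {v : HeightOneSpectrum (𝓞 K)} {x : Kˣ} :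
    x ∈ dvdOrdAt p v ↔ (p : ℤ) ∣ ordv v x := Iff.rfl

theorem range_pow_le_dvdOrdAt (v : HeightOneSpectrum (𝓞 K)) :
    (powMonoidHom p : Kˣ →* Kˣ).range ≤ dvdOrdAt p v := by
  rintro _ ⟨y, rfl⟩
  rw [mem_dvdOrdAt, powMonoidHom_apply, ordv_pow]
  exact Dvd.intro _ rfl

theorem exists_pow_eq_of_mem_locPowOn (hp : p.Prime) (hζ : IsPrimitiveRoot ζ p)
    {S T : Finset (HeightOneSpectrum (𝓞 K))} [DecidableEq (HeightOneSpectrum (𝓞 K))]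
    (hS : ∀ v ∉ S, ∃ c : Kˣ, ordv v c = 1 ∧ ∀ u, u ∉ S → u ≠ v → ordv u c = 0)
    (hSζ : ∀ v ∉ S, v.valuation K (1 - (ζ : K)) = 1) (hTS : ∀ w ∈ T, w ∉ S)
    (hT : ∀ R ⊆ T, p ^ R.card ≤ (⨅ w ∈ R, locPow p ζ w).relIndex (sUnits S))
    {x : Kˣ} (hx : x ∈ sUnits (S ∪ T)) (hxW : x ∈ locPowOn p ζ S) : ∃ y : Kˣ, y ^ p = x := by
  classical
  by_contra! hcon
  obtain ⟨M, _, _, _, ξ, σ, h⟩ := exists_isKummer hp hζ hcon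
  rw [mem_locPowOn] at hxW
  set U := sUnits (S ∪ T) with hU
  have hSU : sUnits S ≤ U := sUnits_mono Finset.subset_union_left
  set N := (normU K M).range with hN
  obtain ⟨hN0, hNle⟩ := h.relIndex_norm_sUnits (S := S ∪ T) (fun v hv => by
    rw [Finset.mem_union, not_or] at hv
    obtain ⟨c, hc, hc'⟩ := hS v hv.1
    exact ⟨c, hc, fun u hu huv => hc' u (fun h => hu (Finset.mem_union_left _ h)) huv⟩)
    (fun v hv => hSζ v fun h => hv (Finset.mem_union_left _ h)) hx hxW.2
  set Z := (S ∪ T).filter (IsNonsplit M) with hZ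
  have hZT : ∀ w ∈ Z, w ∈ T ∧ IsNonsplit M w := by
    intro w hw
    obtain ⟨h1, h2⟩ := Finset.mem_filter.mp hw
    refine ⟨(Finset.mem_union.mp h1).resolve_left fun h3 => ?_, h2⟩
    exact h.not_isNonsplit_of_mem_locPow (hxW.1 w h3) h2
  set Zi := Z.filter (fun w => (p : ℤ) ∣ ordv w x) with hZi
  set Zr := Z.filter (fun w => ¬ (p : ℤ) ∣ ordv w x) with hZr
  have hcard : Zi.card + Zr.card = Z.card := Finset.card_filter_add_card_filter_not _
  set A := ⨅ w ∈ Zi, dvdOrdAt p w with hA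
  have hRA : (powMonoidHom p : Kˣ →* Kˣ).range ≤ A :=
    le_iInf₂ fun w _ => range_pow_le_dvdOrdAt w
  have hA1 : p ^ Zi.card ≤ A.relIndex U := by
    refine pow_card_le_relIndex_iInf hp Zi _ U
      (fun i _ y _ => range_pow_le_dvdOrdAt i ⟨y, rfl⟩)
      (relIndex_ne_zero_of_range_pow_le hp hζ _ hRA) fun w hw => ?_
    have hwT := (hZT w (Finset.mem_filter.mp hw).1).1
    obtain ⟨c, hc, hc'⟩ := hS w (hTS w hwT)
    refine ⟨c, fun u hu => ?_, ?_, fun u hu huw => ?_⟩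
    · rw [Finset.mem_union, not_or] at hu
      exact hc' u hu.1 (by rintro rfl; exact hu.2 hwT)
    · rw [mem_dvdOrdAt, hc]
      exact fun h1 => hp.one_lt.ne' (by exact_mod_cast Int.eq_one_of_dvd_one (by positivity) h1)
    · rw [mem_dvdOrdAt, hc' u (hTS u (hZT u (Finset.mem_filter.mp hu).1).1) huw]
      exact dvd_zero _
  have hNl : ∀ w, N ≤ normLoc p ζ M w := fun w => le_sup_right
  have hNA : N ≤ A := by
    refine le_iInf₂ fun w hw y hy => ?_
    obtain ⟨h1, h2⟩ := Finset.mem_filter.mp hw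
    obtain ⟨h3, h4⟩ := hZT w h1
    exact h.dvd_ordv_of_mem_normLoc (hSζ w (hTS w h3)) h2 h4 (hNl w hy)
  have hSA : sUnits S ≤ A ⊓ U := by
    refine le_inf (le_iInf₂ fun w hw y hy => ?_) hSU
    rw [mem_dvdOrdAt, hy w (hTS w (hZT w (Finset.mem_filter.mp hw).1).1)]
    exact dvd_zero _
  have h1 := Subgroup.relIndex_inf_mul_relIndex N A U
  rw [inf_eq_left.mpr hNA] at h1
  have h2 : N.relIndex (A ⊓ U) ≠ 0 := fun h0 => hN0 (by rw [← h1, h0, zero_mul])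
  have h3 : N.relIndex (sUnits S) ≠ 0 := fun h0 =>
    h2 (Subgroup.relIndex_eq_zero_of_le_right hSA h0)
  have h4 : p ^ Zr.card ≤ N.relIndex (sUnits S) := by
    refine (hT Zr fun w hw => (hZT w (Finset.mem_filter.mp hw).1).1).trans
      (relIndex_le_relIndex_of_inf_le ?_ h3)
    refine le_iInf₂ fun w hw y hy => ?_
    obtain ⟨h5, h6⟩ := Finset.mem_filter.mp hw
    obtain ⟨h7, h8⟩ := hZT w h5
    refine h.mem_locPow_of_mem_normLoc (hSζ w (hTS w h7)) h6 h8 (hNl w hy.1) ?_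
    rw [hy.2 w (hTS w h7)]
    exact dvd_zero _
  have h5 := h4.trans (Subgroup.relIndex_le_of_le_right hSA h2)
  have h6 : p ^ Z.card ≤ N.relIndex U := by
    rw [← h1, ← hcard, add_comm, pow_add]
    exact Nat.mul_le_mul h5 hA1
  have h7 : p * p ^ Z.card ≤ p ^ Z.card := (Nat.mul_le_mul le_rfl h6).trans hNle
  rw [← pow_succ', Nat.pow_le_pow_iff_right hp.one_lt] at h7
  lia

end

end

section

open IsDedekindDomain NumberField WithZero

section
variable {K : Type*} [Field K] [NumberField K]

/-- The absolute value attached to a real embedding. -/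
noncomputable def realAbv (σ : K →+* ℝ) : AbsoluteValue K ℝ :=
  AbsoluteValue.abs.comp σ.injective

theorem realAbv_apply (σ : K →+* ℝ) (x : K) : realAbv σ x = |σ x| := rfl

theorem one_lt_realAbv_two (σ : K →+* ℝ) : 1 < realAbv σ 2 := by
  rw [realAbv_apply, map_ofNat]; norm_num

theorem realAbv_not_isEquiv {σ τ : K →+* ℝ} (h : σ ≠ τ) : ¬ (realAbv σ).IsEquiv (realAbv τ) := by
  have key (ρ : K →+* ℝ) : (InfinitePlace.mk (Complex.ofRealHom.comp ρ)).1 = realAbv ρ := by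
    ext x
    change ‖((ρ x : ℝ) : ℂ)‖ = |ρ x|
    rw [Complex.norm_real, Real.norm_eq_abs]
  intro he
  rw [← key, ← key, ← InfinitePlace.eq_iff_isEquiv, InfinitePlace.mk_eq_iff] at he
  apply h
  ext x
  rcases he with he | he
  · exact Complex.ofReal_injective (RingHom.congr_fun he x)
  · have := RingHom.congr_fun he x
    simp only [ComplexEmbedding.conjugate_coe_eq, RingHom.comp_apply, Complex.ofRealHom_eq_coe,
      Complex.conj_ofReal] at this
    exact_mod_cast this

theorem adicAbv_lt_iff (v : HeightOneSpectrum (𝓞 K)) (x : K) (γ : ℤᵐ⁰) :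
    HeightOneSpectrum.adicAbv K v x <
      WithZeroMulInt.toNNReal (HeightOneSpectrum.absNorm_ne_zero v) γ ↔
      v.valuation K x < γ := by
  rw [HeightOneSpectrum.adicAbv_def, NNReal.coe_lt_coe]
  exact (WithZeroMulInt.toNNReal_strictMono (HeightOneSpectrum.one_lt_absNorm_nnreal v)).lt_iff_lt

theorem adicAbv_lt_one_iff (v : HeightOneSpectrum (𝓞 K)) (x : K) :
    HeightOneSpectrum.adicAbv K v x < 1 ↔ v.valuation K x < 1 := by
  have := adicAbv_lt_iff v x 1
  rwa [map_one] at this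

theorem adicAbv_not_isEquiv {v w : HeightOneSpectrum (𝓞 K)} (h : v ≠ w) :
    ¬ (HeightOneSpectrum.adicAbv K v).IsEquiv (HeightOneSpectrum.adicAbv K w) := by
  intro he
  have h1 : ∀ x : 𝓞 K, x ∈ v.asIdeal ↔ x ∈ w.asIdeal := fun x => by
    rw [← HeightOneSpectrum.valuation_lt_one_iff_mem (K := K),
      ← HeightOneSpectrum.valuation_lt_one_iff_mem (K := K), ← adicAbv_lt_one_iff,
      ← adicAbv_lt_one_iff, he.lt_one_iff]
  exact h (HeightOneSpectrum.ext (Ideal.ext h1))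

/-- Weak approximation at finitely many finite places and at all real embeddings. -/
theorem weak_approximation (S : Finset (HeightOneSpectrum (𝓞 K)))
    (t : HeightOneSpectrum (𝓞 K) → K) (γ : HeightOneSpectrum (𝓞 K) → ℤᵐ⁰) (hγ : ∀ v, γ v ≠ 0)
    (τ : (K →+* ℝ) → ℝ) {ε : ℝ} (hε : 0 < ε) :
    ∃ y : K, (∀ v ∈ S, v.valuation K (y - t v) < γ v) ∧ ∀ σ : K →+* ℝ, |σ y - τ σ| < ε := by
  classical
  let V : (K →+* ℝ) ⊕ S → AbsoluteValue K ℝ :=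
    Sum.elim realAbv (fun v => HeightOneSpectrum.adicAbv K v.1)
  have hnt : ∀ i, (V i).IsNontrivial := by
    rintro (σ | v)
    · exact ⟨2, two_ne_zero, (one_lt_realAbv_two σ).ne'⟩
    · obtain ⟨x, hx⟩ := exists_ordv_eq_one v.1
      refine ⟨x, x.ne_zero, ne_of_lt ?_⟩
      change HeightOneSpectrum.adicAbv K v.1 x < 1
      rw [adicAbv_lt_one_iff, valuation_eq_exp_ordv, hx, ← exp_zero, exp_lt_exp]
      norm_num
  have hne (σ : K →+* ℝ) (v : S) : ¬ (realAbv σ).IsEquiv (HeightOneSpectrum.adicAbv K v.1) := by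
    intro he
    have h1 := (he.one_lt_iff (x := 2)).mp (one_lt_realAbv_two σ)
    have h2 := HeightOneSpectrum.adicAbv_natCast_le_one K v.1 2
    push_cast at h2
    exact absurd h1 (not_lt.mpr h2)
  have hpw : Pairwise fun i j ↦ ¬(V i).IsEquiv (V j) := by
    rintro (σ | v) (σ' | v') hij
    · exact realAbv_not_isEquiv fun h => hij (congrArg _ h)
    · exact hne σ v'
    · exact fun he => hne σ' v he.symm
    · exact adicAbv_not_isEquiv fun h => hij (congrArg _ (Subtype.ext h))
  have hd := AbsoluteValue.denseRange_algebraMap_pi hnt hpw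
  have hq (σ : K →+* ℝ) : ∃ q : ℚ, |(q : ℝ) - τ σ| < ε / 2 := by
    obtain ⟨q, hq1, hq2⟩ := exists_rat_btwn (show τ σ - ε / 2 < τ σ + ε / 2 by linarith)
    exact ⟨q, abs_lt.mpr ⟨by linarith, by linarith⟩⟩
  choose q hq using hq
  let z : (i : (K →+* ℝ) ⊕ S) → WithAbs (V i) := fun i =>
    WithAbs.toAbs (V i) (Sum.elim (fun σ => ((q σ : ℚ) : K)) (fun v => t v.1) i)
  let δ : (K →+* ℝ) ⊕ S → ℝ := Sum.elim (fun _ => ε / 2) (fun v =>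
    (WithZeroMulInt.toNNReal (HeightOneSpectrum.absNorm_ne_zero v.1) (γ v.1) : ℝ))
  have hδ : ∀ i, 0 < δ i := by
    rintro (σ | v)
    · exact half_pos hε
    · change (0 : ℝ) < (WithZeroMulInt.toNNReal (HeightOneSpectrum.absNorm_ne_zero v.1) (γ v.1) : ℝ)
      exact NNReal.coe_pos.mpr (WithZeroMulInt.toNNReal_pos _ (hγ v.1))
  obtain ⟨r, hr0, hr⟩ : ∃ r > 0, ∀ i, r ≤ δ i := by
    cases isEmpty_or_nonempty ((K →+* ℝ) ⊕ S)
    · exact ⟨1, one_pos, isEmptyElim⟩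
    · obtain ⟨i, hi⟩ := Finite.exists_min δ
      exact ⟨δ i, hδ i, hi⟩
  obtain ⟨y, hy⟩ := hd.exists_dist_lt z hr0
  have hy' (i) : V i (y - (z i).ofAbs) < δ i := by
    refine lt_of_le_of_lt ?_ (lt_of_lt_of_le hy (hr i))
    rw [dist_comm]
    refine le_trans ?_ (dist_le_pi_dist _ _ i)
    rw [dist_eq_norm]
    exact le_of_eq rfl
  refine ⟨y, fun v hv => ?_, fun σ => ?_⟩
  · exact (adicAbv_lt_iff v _ _).mp (hy' (Sum.inr ⟨v, hv⟩))
  · have h1 : |σ (y - ((q σ : ℚ) : K))| < ε / 2 := hy' (Sum.inl σ)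
    rw [map_sub, map_ratCast] at h1
    calc |σ y - τ σ| = |(σ y - q σ) + (q σ - τ σ)| := by ring_nf
      _ ≤ _ := abs_add_le _ _
      _ < ε := by linarith [hq σ]

/-- Weak approximation for units, with prescribed signs at the real embeddings. -/
theorem weak_approximation_units (S : Finset (HeightOneSpectrum (𝓞 K)))
    (y : HeightOneSpectrum (𝓞 K) → Kˣ) (r : HeightOneSpectrum (𝓞 K) → ℤᵐ⁰) (hr : ∀ v, r v ≠ 0)
    (τ : (K →+* ℝ) → ℝ) (hτ : ∀ σ, τ σ ≠ 0) :
    ∃ x : Kˣ, (∀ v ∈ S, x / y v ∈ unitBall v (r v)) ∧ ∀ σ : K →+* ℝ, 0 < σ x * τ σ := by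
  have hy0 (v : HeightOneSpectrum (𝓞 K)) : v.valuation K (y v : K) ≠ 0 := by simp
  obtain ⟨x, hx, hx'⟩ := weak_approximation S (fun v => (y v : K))
    (fun v => v.valuation K (y v : K) * min 1 (r v))
    (fun v => mul_ne_zero (hy0 v) (by
      rcases min_choice 1 (r v) with h | h <;> rw [h]
      exacts [one_ne_zero, hr v])) (fun σ => SignType.sign (τ σ)) one_pos
  have hsgn : ∀ σ : K →+* ℝ, 0 < σ x * τ σ := fun σ => by
    have h1 := abs_lt.mp (hx' σ)
    rcases lt_or_gt_of_ne (hτ σ) with h | h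
    · rw [sign_neg h] at h1
      simp only [SignType.coe_neg, SignType.coe_one] at h1
      exact mul_pos_of_neg_of_neg (by linarith) h
    · rw [sign_pos h] at h1
      simp only [SignType.coe_one] at h1
      exact mul_pos (by linarith) h
  have hball : ∀ v ∈ S, v.valuation K (x / y v - 1) < min 1 (r v) := fun v hv => by
    have h1 : x / (y v : K) - 1 = (x - y v) / y v := by
      rw [sub_div, div_self (y v).ne_zero]
    rw [h1, map_div₀, div_lt_iff₀ (zero_lt_iff.mpr (hy0 v)), mul_comm]
    exact hx v hv
  by_cases hx0 : x = 0
  · refine ⟨1, fun v hv => ?_, fun σ => ?_⟩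
    · have := hball v hv
      rw [hx0, zero_div, zero_sub, Valuation.map_neg, map_one] at this
      exact absurd this (not_lt.mpr (min_le_left _ _))
    · have := hsgn σ
      rw [hx0, map_zero, zero_mul] at this
      exact absurd this (lt_irrefl _)
  · refine ⟨Units.mk0 x hx0, fun v hv => ?_, hsgn⟩
    left
    push_cast
    exact lt_min_iff.mp (hball v hv)

end

end

section

open IsDedekindDomain NumberField WithZero

section
variable {K : Type} [Field K] [NumberField K] {p : ℕ} {ζ : Kˣ}
  {L : Type} [Field L] [NumberField L] [Algebra K L] {a b : Kˣ} {ξ : Lˣ} {σ : Gal(L/K)}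

theorem locPow_le_normLoc (v : HeightOneSpectrum (𝓞 K)) : locPow p ζ v ≤ normLoc p ζ L v :=
  le_sup_left

theorem range_normU_le_normLoc (v : HeightOneSpectrum (𝓞 K)) :
    (normU K L).range ≤ normLoc p ζ L v :=
  le_sup_right

theorem locPowOn_le_iInf_normLoc {S R : Finset (HeightOneSpectrum (𝓞 K))} (hR : R ⊆ S) :
    locPowOn p ζ S ≤ ⨅ v ∈ R, normLoc p ζ L v :=
  le_iInf₂ fun v hv _ hx => locPow_le_normLoc v ((mem_locPowOn.mp hx).1 v (hR hv))

namespace IsKummer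

theorem pow_card_le_index_iInf_normLoc (h : IsKummer p ζ b ξ σ)
    {R : Finset (HeightOneSpectrum (𝓞 K))} (hR : ∀ v ∈ R, v.valuation K (1 - (ζ : K)) = 1)
    (hns : ∀ v ∈ R, IsNonsplit L v) : (⨅ v ∈ R, normLoc p ζ L v).index ≠ 0 ∧
      p ^ R.card ≤ (⨅ v ∈ R, normLoc p ζ L v).index := by
  classical
  have h0 : (⨅ v ∈ R, normLoc p ζ L v).index ≠ 0 := fun h0 =>
    (index_locPowOn h.prime h.prim R).1 (by
      have := Subgroup.index_dvd_of_le (locPowOn_le_iInf_normLoc (p := p) (ζ := ζ) (L := L)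
        (le_refl R))
      rw [h0] at this
      exact zero_dvd_iff.mp this)
  refine ⟨h0, ?_⟩
  rw [← Subgroup.relIndex_top_right] at h0 ⊢
  refine pow_card_le_relIndex_iInf h.prime R (fun v => normLoc p ζ L v) ⊤
    (fun v _ x _ => locPow_le_normLoc v (pow_mem_locPow ζ v x)) h0 fun v hv => ?_
  obtain ⟨y, hy⟩ := h.normLoc_ne_top (hR v hv) (hns v hv)
  obtain ⟨x, hx, -⟩ := weak_approximation_units R (fun u => if u = v then y else 1)
    (fun u => u.valuation K (1 - (ζ : K)) ^ p)
    (fun u => pow_ne_zero _ (h.valuation_one_sub_ne_zero u)) (fun _ => 1) (fun _ => one_ne_zero)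
  have hx' (u) (hu : u ∈ R) : x / (if u = v then y else 1) ∈ normLoc p ζ L u :=
    locPow_le_normLoc u (Subgroup.mem_sup_left (hx u hu))
  refine ⟨x, Subgroup.mem_top _, fun hxv => hy ?_, fun u hu huv => ?_⟩
  · have := hx' v hv
    rw [if_pos rfl] at this
    exact ((normLoc p ζ L v).div_mem_comm_iff.mp this |> fun h1 => by
      simpa using (normLoc p ζ L v).mul_mem h1 hxv)
  · have := hx' u hu
    rwa [if_neg huv, div_one] at this

/-- An element that is a local norm at every nonsplit place is a norm, for a Kummer extension that
splits above the degree and at the real places. -/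
theorem mem_range_normU (h : IsKummer p ζ b ξ σ)
    (hb : ∀ v : HeightOneSpectrum (𝓞 K), v.valuation K (1 - (ζ : K)) ≠ 1 → b ∈ locPow p ζ v)
    (hpos : ∀ τ : K →+* ℝ, 0 < τ b)
    (ha : ∀ v : HeightOneSpectrum (𝓞 K), v.valuation K (1 - (ζ : K)) = 1 → IsNonsplit L v →
      a ∈ normLoc p ζ L v) : a ∈ (normU K L).range := by
  classical
  have hp := h.prime
  have hζ := h.prim
  obtain ⟨S₀, hS₀⟩ := exists_finset_class_trivial K
  let S : Finset (HeightOneSpectrum (𝓞 K)) := S₀ ∪ (finite_valuation_one_sub_ne_one hp hζ).toFinset ∪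
    (finite_ordv_ne_zero a).toFinset ∪ (finite_ordv_ne_zero b).toFinset
  have hS : ∀ v ∉ S, v ∉ S₀ ∧ v.valuation K (1 - (ζ : K)) = 1 ∧ ordv v a = 0 ∧ ordv v b = 0 :=
    fun v hv => by
    simp only [S, Finset.mem_union, Set.Finite.mem_toFinset, not_or, Set.mem_ofPred_eq,
      not_not] at hv
    tauto
  have hcl : ∀ S' : Finset (HeightOneSpectrum (𝓞 K)), S ⊆ S' → ∀ v ∉ S', ∃ c : Kˣ, ordv v c = 1 ∧
      ∀ u, u ∉ S' → u ≠ v → ordv u c = 0 := fun S' hSS v hv => by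
    obtain ⟨c, hc, hc'⟩ := hS₀ v (hS v fun h => hv (hSS h)).1
    exact ⟨c, hc, fun u hu => hc' u (hS u fun h => hu (hSS h)).1⟩
  set s := Fintype.card (InfinitePlace K) + S.card with hs
  have hs1 : 1 ≤ s := by
    have : 0 < Fintype.card (InfinitePlace K) := Fintype.card_pos
    lia
  obtain ⟨T, hTn, hTS, hTb, hT⟩ := h.exists_finset_places (S := S) (fun v hv => (hS v hv).2.1)
    (s - 1) (by lia)
  set U := sUnits (S ∪ T) with hU
  set W := locPowOn p ζ S with hW
  obtain ⟨hW0, hWle⟩ := index_locPowOn hp hζ S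
  have hWU0 : W.relIndex U ≠ 0 := fun h0 => hW0 (by
    have := Subgroup.relIndex_dvd_index_of_normal W U
    rw [h0] at this
    exact zero_dvd_iff.mp this)
  have h1 : p ^ (2 * s - 1) ≤ W.relIndex U := by
    have h2 := relIndex_range_pow_sUnits hp hζ (S ∪ T)
    rw [Finset.card_union_of_disjoint (Finset.disjoint_right.mpr hTS), hTn] at h2
    rw [show 2 * s - 1 = Fintype.card (InfinitePlace K) + (S.card + (s - 1)) by lia, ← h2]
    refine relIndex_le_relIndex_of_inf_le (fun x hx => ?_) hWU0
    exact exists_pow_eq_of_mem_locPowOn hp hζ (hcl S subset_rfl) (fun v hv => (hS v hv).2.1) hTS hT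
      hx.2 hx.1
  have h2 : (W ⊔ U).index ≤ p := by
    have h3 := Subgroup.relIndex_mul_index (le_sup_left : W ≤ W ⊔ U)
    rw [Subgroup.relIndex_sup_left] at h3
    have h4 : p ^ (2 * s - 1) * (W ⊔ U).index ≤ p ^ (2 * s - 1) * p := by
      rw [← pow_succ, show 2 * s - 1 + 1 = 2 * s by lia]
      exact (Nat.mul_le_mul_right _ h1).trans (h3.trans_le hWle)
    exact Nat.le_of_mul_le_mul_left h4 (pow_pos hp.pos _)
  have hWU0' : (W ⊔ U).index ≠ 0 := fun h0 => hW0 (by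
    have := Subgroup.index_dvd_of_le (le_sup_left : W ≤ W ⊔ U)
    rw [h0] at this
    exact zero_dvd_iff.mp this)
  set R := S.filter (IsNonsplit L) with hR
  have hRns : ∀ v ∈ R, IsNonsplit L v := fun v hv => (Finset.mem_filter.mp hv).2
  have hRv : ∀ v ∈ R, v.valuation K (1 - (ζ : K)) = 1 := fun v hv => by
    by_contra hv1
    exact h.not_isNonsplit_of_mem_locPow (hb v hv1) (hRns v hv)
  set N := ⨅ v ∈ R, normLoc p ζ L v with hN
  obtain ⟨hN0, hNle⟩ := h.pow_card_le_index_iInf_normLoc hRv hRns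
  have hWN : W ≤ N := locPowOn_le_iInf_normLoc (Finset.filter_subset _ _)
  have h3 : p ^ R.card ≤ p * N.relIndex U := by
    have h4 := Subgroup.relIndex_mul_index (le_sup_left : N ≤ N ⊔ U)
    rw [Subgroup.relIndex_sup_left] at h4
    have h5 : (N ⊔ U).index ≤ p := (Nat.le_of_dvd (Nat.pos_of_ne_zero hWU0')
      (Subgroup.index_dvd_of_le (sup_le_sup_right hWN U))).trans h2
    rw [mul_comm]
    exact hNle.trans (h4 ▸ Nat.mul_le_mul_left _ h5)
  obtain ⟨hH0, hH⟩ := h.relIndex_norm_sUnits (S := S ∪ T)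
    (hcl _ Finset.subset_union_left)
    (fun v hv => (hS v fun h => hv (Finset.mem_union_left _ h)).2.1)
    (fun v hv => (hS v fun h => hv (Finset.mem_union_left _ h)).2.2.2) hpos
  have h4 : (S ∪ T).filter (IsNonsplit L) = R := by
    rw [Finset.filter_union, Finset.filter_eq_empty_iff.mpr fun v hv =>
      h.not_isNonsplit_of_mem_locPow (hTb v hv), Finset.union_empty]
  have hNN : (normU K L).range ≤ N := le_iInf₂ fun v _ => range_normU_le_normLoc v
  have h5 : (normU K L).range.relIndex U ≤ N.relIndex U := by
    rw [h4] at hH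
    exact Nat.le_of_mul_le_mul_left (hH.trans h3) hp.pos
  have h6 := Subgroup.relIndex_inf_mul_relIndex (normU K L).range N U
  rw [inf_eq_left.mpr hNN] at h6
  have h7 : (normU K L).range.relIndex (N ⊓ U) = 1 := by
    have hpos' : 0 < N.relIndex U := Nat.pos_of_ne_zero fun h0 => hH0 (by rw [← h6, h0, mul_zero])
    have h8 : (normU K L).range.relIndex (N ⊓ U) ≠ 0 := fun h0 => hH0 (by rw [← h6, h0, zero_mul])
    have h9 : (normU K L).range.relIndex (N ⊓ U) * N.relIndex U ≤ 1 * N.relIndex U := by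
      rw [h6, one_mul]; exact h5
    have := Nat.le_of_mul_le_mul_right h9 hpos'
    lia
  refine Subgroup.relIndex_eq_one.mp h7 ⟨?_, ?_⟩
  · rw [hN]
    exact Subgroup.mem_iInf.mpr fun v => Subgroup.mem_iInf.mpr fun hv =>
      ha v (hRv v hv) (hRns v hv)
  · exact fun v hv => (hS v fun h => hv (Finset.mem_union_left _ h)).2.2.1

end IsKummer
end

end

section

open IsDedekindDomain NumberField WithZero

section
open Polynomial
variable {R : Type*} [CommRing R]

/-- The product of the twists `y(ζ^j X)` for `j < n`. -/
noncomputable def twistProd (n : ℕ) (ζ : R) (y : R[X]) : R[X] :=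
  ∏ j ∈ Finset.range n, y.comp (C (ζ ^ j) * X)

/-- The norm of `y(α)` for a formal `p`-th root `α` of `a`. -/
noncomputable def normForm (p : ℕ) (ζ a : R) (y : R[X]) : R :=
  (contract p (twistProd p ζ y)).eval a

theorem comp_C_pow_comp_C (ζ : R) (y : R[X]) (j : ℕ) :
    (y.comp (C (ζ ^ j) * X)).comp (C ζ * X) = y.comp (C (ζ ^ (j + 1)) * X) := by
  rw [comp_assoc]; congr 1
  simp only [mul_comp, C_comp, X_comp, ← mul_assoc, ← C_mul, pow_succ]

theorem twistProd_comp (n : ℕ) (ζ : R) (y : R[X]) :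
    (twistProd n ζ y).comp (C ζ * X) = ∏ j ∈ Finset.range n, y.comp (C (ζ ^ (j + 1)) * X) := by
  simp only [twistProd, prod_comp, comp_C_pow_comp_C]

theorem twistProd_succ (n : ℕ) (ζ : R) (y : R[X]) :
    twistProd (n + 1) ζ y = (twistProd n ζ y).comp (C ζ * X) * y := by
  rw [twistProd_comp, twistProd, Finset.prod_range_succ']
  simp

theorem twistProd_comp_self {p : ℕ} {ζ : R} (hζ : ζ ^ p = 1) (y : R[X]) :
    (twistProd p ζ y).comp (C ζ * X) = twistProd p ζ y := by
  rcases p with _ | p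
  · simp [twistProd]
  · rw [twistProd_comp, Finset.prod_range_succ, hζ, twistProd, Finset.prod_range_succ']
    simp

theorem expand_contract_twistProd [IsDomain R] {p : ℕ} (hp : p ≠ 0) {ζ : R}
    (hζ : IsPrimitiveRoot ζ p) (y : R[X]) :
    expand R p (contract p (twistProd p ζ y)) = twistProd p ζ y := by
  ext n
  rw [coeff_expand (Nat.pos_of_ne_zero hp)]
  split_ifs with h
  · rw [coeff_contract hp, Nat.div_mul_cancel h]
  · have h1 := congr_arg (fun f => f.coeff n) (twistProd_comp_self hζ.pow_eq_one y)
    simp only [comp_C_mul_X_coeff] at h1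
    have h2 : (twistProd p ζ y).coeff n * (ζ ^ n - 1) = 0 := by rw [mul_sub, h1]; ring
    rcases mul_eq_zero.1 h2 with h3 | h3
    · exact h3.symm
    · exact absurd ((hζ.pow_eq_one_iff_dvd n).1 (sub_eq_zero.1 h3)) h

theorem aeval_twistProd [IsDomain R] {D : Type*} [Ring D] [Algebra R D] {p : ℕ} (hp : p ≠ 0)
    {ζ : R} (hζ : IsPrimitiveRoot ζ p) (y : R[X]) {a : R} {α : D}
    (hα : α ^ p = algebraMap R D a) :
    aeval α (twistProd p ζ y) = algebraMap R D (normForm p ζ a y) := by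
  rw [← expand_contract_twistProd hp hζ, expand_aeval, hα, normForm, aeval_algebraMap_apply,
    aeval_def, Algebra.algebraMap_self, eval₂_id]

theorem map_twistProd {S : Type*} [CommRing S] (φ : R →+* S) (n : ℕ) (ζ : R) (y : R[X]) :
    (twistProd n ζ y).map φ = twistProd n (φ ζ) (y.map φ) := by
  simp [twistProd, Polynomial.map_prod, map_comp]

theorem map_normForm {S : Type*} [CommRing S] (φ : R →+* S) {p : ℕ} (hp : p ≠ 0) (ζ a : R)
    (y : R[X]) : φ (normForm p ζ a y) = normForm p (φ ζ) (φ a) (y.map φ) := by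
  rw [normForm, normForm, ← map_twistProd, ← map_contract hp, eval_map_apply]

section ring
variable {D : Type*} [Ring D] [Algebra R D] {ζ : R} {A B : D}

theorem mul_aeval_of_twist (h : B * A = ζ • (A * B)) (f : R[X]) :
    B * aeval A f = aeval A (f.comp (C ζ * X)) * B := by
  induction f using Polynomial.induction_on' with
  | add f g hf hg => simp [mul_add, add_mul, hf, hg]
  | monomial n r =>
    have : B * A ^ n = ζ ^ n • (A ^ n * B) := by
      induction n with
      | zero => simp
      | succ n ih =>
        rw [pow_succ, ← mul_assoc, ih, smul_mul_assoc, mul_assoc, h, mul_smul_comm, smul_smul,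
          mul_assoc, pow_succ]
    simp only [aeval_monomial, monomial_comp, mul_pow, map_mul, map_pow, aeval_C, aeval_X]
    rw [← mul_assoc, ← Algebra.commutes, mul_assoc, this, mul_assoc, mul_assoc,
      Algebra.smul_def, map_pow]

theorem aeval_mul_pow_of_twist (h : B * A = ζ • (A * B)) (y : R[X]) (n : ℕ) :
    (aeval A y * B) ^ n = aeval A (twistProd n ζ y) * B ^ n := by
  induction n with
  | zero => simp [twistProd]
  | succ n ih =>
    rw [pow_succ', ih, twistProd_succ, mul_assoc, ← mul_assoc B, mul_aeval_of_twist h, pow_succ',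
      map_mul, ← mul_assoc, ← mul_assoc, ← mul_assoc, ← map_mul, ← map_mul, mul_comm y]

end ring

theorem exists_twist {k : Type*} [Field k] {D : Type*} [DivisionRing D] [Algebra k D] {p : ℕ}
    (hp : p ≠ 0) {ζ : k} (hζ : IsPrimitiveRoot ζ p) {A B : D} {a b : k} (y : k[X])
    (h : B * A = ζ • (A * B))
    (hA : A ^ p = algebraMap k D a) (hB : B ^ p = algebraMap k D b) (hn : normForm p ζ a y ≠ 0) :
    ∃ B' : D, B' * A = ζ • (A * B') ∧ B' ^ p = algebraMap k D (b / normForm p ζ a y) := by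
  have h0 : aeval A y ≠ 0 := by
    intro h0
    have := aeval_twistProd hp hζ y hA
    obtain ⟨q, rfl⟩ := Nat.exists_eq_succ_of_ne_zero hp
    rw [twistProd_succ, map_mul, h0, mul_zero] at this
    exact hn ((map_eq_zero _).1 this.symm)
  have hc : (aeval A y)⁻¹ * A = A * (aeval A y)⁻¹ := by
    have : Commute (aeval A y) A := by
      have := (Commute.all y X).map (aeval A)
      simpa using this
    exact this.inv_left₀
  have h' : ((aeval A y)⁻¹ * B) * A = ζ • (A * ((aeval A y)⁻¹ * B)) := by
    rw [mul_assoc, h, mul_smul_comm, ← mul_assoc, hc, mul_assoc]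
  refine ⟨(aeval A y)⁻¹ * B, h', ?_⟩
  have h2 := aeval_mul_pow_of_twist h' y p
  rw [mul_inv_cancel_left₀ h0, hB, aeval_twistProd hp hζ y hA] at h2
  have h3 : algebraMap k D (normForm p ζ a y) ≠ 0 := by simpa using hn
  apply mul_left_cancel₀ h3
  rw [← h2, ← map_mul, mul_div_cancel₀ _ hn]

theorem exists_normForm_eq_of_end {k V : Type*} [Field k] [AddCommGroup V] [Module k V] {p : ℕ}
    (hp : p.Prime) {ζ : k} (hζ : IsPrimitiveRoot ζ p) (hV : Module.finrank k V = p)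
    {A B : Module.End k V} {a b : k} (h : B * A = ζ • (A * B))
    (hA : A ^ p = algebraMap k _ a) (hB : B ^ p = algebraMap k _ b) (ha : a ≠ 0) :
    ∃ y : k[X], y.degree < p ∧ normForm p ζ a y = b := by
  classical
  by_cases hc : ∃ c : k, c ^ p = a
  · obtain ⟨c, rfl⟩ := hc
    have hc0 : c ≠ 0 := fun h => ha (by rw [h, zero_pow hp.ne_zero])
    have hinj : Set.InjOn (fun j => ζ ^ j * c) (Finset.range p : Set ℕ) := by
      intro i hi j hj hij
      exact hζ.pow_inj (by simpa using hi) (by simpa using hj) (mul_right_cancel₀ hc0 hij)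
    have hd := Lagrange.degree_interpolate_lt (fun j => if j = 0 then b else 1) hinj
    have he := fun i hi => Lagrange.eval_interpolate_at_node
      (fun j => if j = 0 then b else 1) hinj (i := i) hi
    generalize Lagrange.interpolate (Finset.range p) (fun j => ζ ^ j * c)
      (fun j => if j = 0 then b else 1) = y at he hd
    refine ⟨y, by simpa using hd, ?_⟩
    have h1 := aeval_twistProd hp.ne_zero hζ y (α := c) (a := c ^ p) rfl
    simp only [Algebra.algebraMap_self, RingHom.id_apply, aeval_def, eval₂_id] at h1
    rw [← h1, twistProd, eval_prod]
    simp only [eval_comp, eval_mul, eval_C, eval_X]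
    rw [Finset.prod_congr rfl he]
    simp [hp.pos]
  · push Not at hc
    have hirr := (X_pow_sub_C_irreducible_iff_of_prime hp (a := a)).2 hc
    have : Nontrivial V := Module.nontrivial_of_finrank_pos (R := k) (hV ▸ hp.pos)
    have : FiniteDimensional k V := .of_finrank_pos (hV ▸ hp.pos)
    obtain ⟨v, hv⟩ := exists_ne (0 : V)
    let g : k[X] →ₗ[k] V := (LinearMap.applyₗ v) ∘ₗ (aeval A).toLinearMap
    have hg : ∀ f, g f = aeval A f v := fun f => rfl
    let g' := g ∘ₗ (degreeLT k p).subtype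
    have hA0 : aeval A (X ^ p - C a) = 0 := by simp [hA]
    have hinj : Function.Injective g' := by
      rw [injective_iff_map_eq_zero]
      rintro ⟨f, hf⟩ h0
      by_contra hf0
      have hf0 : f ≠ 0 := fun h => hf0 (by ext1; exact h)
      have hnd : ¬ (X ^ p - C a) ∣ f := fun hd => by
        have := degree_le_of_dvd hd hf0
        rw [degree_X_pow_sub_C hp.pos] at this
        exact absurd (mem_degreeLT.1 hf) (not_lt.2 this)
      obtain ⟨u, w, huw⟩ := ((hirr.coprime_iff_not_dvd).2 hnd)
      have := congr_arg (fun q => aeval A q v) huw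
      have h0 : aeval A f v = 0 := h0
      simp only [map_add, map_mul, hA0, mul_zero, zero_add, map_one, Module.End.mul_apply,
        h0, map_zero, Module.End.one_apply] at this
      exact hv this.symm
    have hdim : Module.finrank k (degreeLT k p) = Module.finrank k V := by
      rw [hV, (degreeLTEquiv k p).finrank_eq]; simp
    have : FiniteDimensional k (degreeLT k p) := .of_finrank_pos (by rw [hdim, hV]; exact hp.pos)
    obtain ⟨⟨y, hy⟩, hyv⟩ :=
      (LinearMap.injective_iff_surjective_of_finrank_eq_finrank hdim).1 hinj (B v)
    refine ⟨y, mem_degreeLT.1 hy, ?_⟩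
    have hyv : aeval A y v = B v := hyv
    have hn : ∀ n, (B ^ n) v = aeval A (twistProd n ζ y) v := by
      intro n
      induction n with
      | zero => simp [twistProd]
      | succ n ih =>
        rw [pow_succ', Module.End.mul_apply, ih, ← Module.End.mul_apply, mul_aeval_of_twist h,
          twistProd_succ, map_mul, Module.End.mul_apply, Module.End.mul_apply, hyv]
    have h1 := hn p
    rw [aeval_twistProd hp.ne_zero hζ y hA, hB, Module.algebraMap_end_apply,
      Module.algebraMap_end_apply] at h1
    exact (smul_left_injective k hv h1).symm

theorem exists_normForm_eq_of_matrix {k : Type*} [Field k] {p : ℕ}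
    (hp : p.Prime) {ζ : k} (hζ : IsPrimitiveRoot ζ p)
    {A B : Matrix (Fin p) (Fin p) k} {a b : k} (h : B * A = ζ • (A * B))
    (hA : A ^ p = algebraMap k _ a) (hB : B ^ p = algebraMap k _ b) (ha : a ≠ 0) :
    ∃ y : k[X], y.degree < p ∧ normForm p ζ a y = b := by
  let e := Matrix.toLinAlgEquiv' (R := k) (n := Fin p)
  refine exists_normForm_eq_of_end (V := Fin p → k) hp hζ (by simp) (A := e A) (B := e B) ?_ ?_ ?_ ha
  · rw [← map_mul, h, map_smul, map_mul]
  · rw [← map_pow, hA, AlgEquiv.commutes]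
  · rw [← map_pow, hB, AlgEquiv.commutes]

theorem exists_aeval_eq_zero_of_prod {k : Type*} [CommRing k] {D : Type*} [Ring D]
    [NoZeroDivisors D] [Nontrivial D] [Algebra k D] (w : D) {ι : Type*} (s : Finset ι) (f : ι → k[X])
    (h : aeval w (∏ i ∈ s, f i) = 0) : ∃ i ∈ s, aeval w (f i) = 0 := by
  classical
  induction s using Finset.induction_on with
  | empty => simp at h
  | insert i s hi ih =>
    rw [Finset.prod_insert hi, map_mul, mul_eq_zero] at h
    rcases h with h | h
    · exact ⟨i, Finset.mem_insert_self _ _, h⟩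
    · obtain ⟨j, hj, h⟩ := ih h
      exact ⟨j, Finset.mem_insert_of_mem hj, h⟩

/-- A `p`-th root in a division algebra of a `p`-th power of a scalar is a scalar. -/
theorem exists_eq_algebraMap_of_pow_eq {k : Type*} [Field k] {D : Type*} [DivisionRing D]
    [Algebra k D] {p : ℕ} (hp : p ≠ 0) {ζ : k} (hζ : IsPrimitiveRoot ζ p) {w : D} {c : k}
    (hc : c ≠ 0) (hw : w ^ p = algebraMap k D (c ^ p)) :
    ∃ d : k, d ^ p = c ^ p ∧ w = algebraMap k D d := by
  have h2 : aeval (c⁻¹ • w) (X ^ p - 1 : k[X]) = 0 := by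
    simp only [map_sub, map_pow, aeval_X, map_one]
    rw [_root_.smul_pow, hw, Algebra.smul_def, ← map_mul, inv_pow, inv_mul_cancel₀ (pow_ne_zero _ hc)]
    simp
  rw [X_pow_sub_one_eq_prod (Nat.pos_of_ne_zero hp) hζ] at h2
  obtain ⟨μ, hμ, h⟩ := exists_aeval_eq_zero_of_prod _ _ _ h2
  rw [mem_nthRootsFinset (Nat.pos_of_ne_zero hp)] at hμ
  refine ⟨c * μ, by rw [mul_pow, hμ, mul_one], ?_⟩
  simp only [map_sub, aeval_X, aeval_C, sub_eq_zero] at h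
  rw [map_mul, ← h, ← Algebra.smul_def, smul_smul, mul_inv_cancel₀ hc, one_smul]

end

end

section

open IsDedekindDomain NumberField WithZero

section
open Polynomial Topology
variable {K : Type*} [Field K] [NumberField K]

theorem valued_algebraMap_adicCompletion (v : HeightOneSpectrum (𝓞 K)) (x : K) :
    Valued.v (algebraMap K (v.adicCompletion K) x) = v.valuation K x := by
  rw [HeightOneSpectrum.algebraMap_adicCompletion]
  exact HeightOneSpectrum.valuedAdicCompletion_eq_valuation' v x

theorem exists_ball_subset {v : HeightOneSpectrum (𝓞 K)} {x : v.adicCompletion K}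
    {s : Set (v.adicCompletion K)} (hs : s ∈ 𝓝 x) :
    ∃ γ : ℤᵐ⁰, γ ≠ 0 ∧ ∀ y, Valued.v (y - x) < γ → y ∈ s := by
  obtain ⟨γ, hγ⟩ := Valued.mem_nhds.1 hs
  refine ⟨MonoidWithZeroHom.ValueGroup₀.embedding γ.1, by simp, fun y hy => hγ ?_⟩
  exact (Valuation.restrict_lt_iff_lt_embedding _).2 hy

theorem ball_mem_nhds_adic {v : HeightOneSpectrum (𝓞 K)} (x : v.adicCompletion K)
    {γ : ℤᵐ⁰} (hγ : γ ≠ 0) : {y | Valued.v (y - x) < γ} ∈ 𝓝 x := by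
  obtain ⟨r, rfl⟩ := HeightOneSpectrum.valuedAdicCompletion_surjective K v γ
  rw [Valued.mem_nhds]
  refine ⟨Units.mk0 (Valued.v.restrict r) (by simpa using hγ), fun y hy => ?_⟩
  exact (Valuation.restrict_lt_iff _).1 hy

/-- The polynomial with given coefficients. -/
noncomputable def polyOf {R : Type*} [CommRing R] {n : ℕ} (t : Fin n → R) : R[X] :=
  ∑ i, C (t i) * X ^ (i : ℕ)

theorem map_polyOf {R S : Type*} [CommRing R] [CommRing S] (φ : R →+* S) {n : ℕ}
    (t : Fin n → R) : (polyOf t).map φ = polyOf fun i => φ (t i) := by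
  simp [polyOf, Polynomial.map_sum]

theorem polyOf_coeff {R : Type*} [CommRing R] {n : ℕ} {y : R[X]} (hy : y.degree < n) :
    polyOf (fun i : Fin n => y.coeff i) = y := by
  rw [polyOf, Fin.sum_univ_eq_sum_range (fun i => C (y.coeff i) * X ^ i)]
  by_cases h0 : y = 0
  · simp [h0]
  · exact (as_sum_range_C_mul_X_pow' y ((natDegree_lt_iff_degree_lt h0).2 hy)).symm

theorem continuous_normForm_polyOf {R : Type*} [CommRing R] [TopologicalSpace R]
    [IsTopologicalRing R] {p : ℕ} (hp : p ≠ 0) (n : ℕ) (ζ a : R) :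
    Continuous fun t : Fin n → R => normForm p ζ a (polyOf t) := by
  let P : MvPolynomial (Fin n) R :=
    normForm p (MvPolynomial.C ζ) (MvPolynomial.C a) (polyOf MvPolynomial.X)
  convert MvPolynomial.continuous_eval P with t
  rw [map_normForm _ hp, map_polyOf]
  simp

theorem exists_approx_normForm_adic (v : HeightOneSpectrum (𝓞 K)) {p : ℕ} (hp : p ≠ 0) {n : ℕ}
    (ζ a b : K)
    (t : Fin n → v.adicCompletion K)
    (ht : normForm p (algebraMap K _ ζ) (algebraMap K _ a) (polyOf t) = algebraMap K _ b)
    {r : ℤᵐ⁰} (hr : r ≠ 0) :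
    ∃ (t' : Fin n → K) (γ : ℤᵐ⁰), γ ≠ 0 ∧ ∀ s : Fin n → K,
      (∀ i, v.valuation K (s i - t' i) < γ) →
        v.valuation K (normForm p ζ a (polyOf s) - b) < r := by
  have hc := continuous_normForm_polyOf (n := n) hp (algebraMap K (v.adicCompletion K) ζ)
    (algebraMap K _ a)
  have h1 := hc.continuousAt.preimage_mem_nhds (x := t) (by
    rw [ht]; exact ball_mem_nhds_adic (algebraMap K (v.adicCompletion K) b) hr)
  rw [nhds_pi, Filter.mem_pi'] at h1
  obtain ⟨I, s, hs, hI⟩ := h1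
  choose γ hγ0 hγ using fun i => exists_ball_subset (hs i)
  obtain ⟨γ', hγ'0, hγ'⟩ : ∃ γ' : ℤᵐ⁰, γ' ≠ 0 ∧ ∀ i, γ' ≤ γ i := by
    rcases isEmpty_or_nonempty (Fin n) with h | h
    · exact ⟨1, one_ne_zero, fun i => h.elim i⟩
    · obtain ⟨i, hi⟩ := Finite.exists_min γ
      exact ⟨γ i, hγ0 i, hi⟩
  choose t' ht' using fun i =>
    (HeightOneSpectrum.denseRange_algebraMap K v).exists_mem_open
      (s := interior {y | Valued.v (y - t i) < γ'}) isOpen_interior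
      ⟨t i, mem_interior_iff_mem_nhds.2 (ball_mem_nhds_adic _ hγ'0)⟩
  refine ⟨t', γ', hγ'0, fun u hu => ?_⟩
  have h2 : (fun i => algebraMap K (v.adicCompletion K) (u i)) ∈ (I : Set (Fin n)).pi s := by
    intro i _
    refine hγ i _ (lt_of_lt_of_le ?_ (hγ' i))
    have h3 := interior_subset (ht' i)
    have h4 := hu i
    rw [← valued_algebraMap_adicCompletion, map_sub] at h4
    have := Valuation.map_add_lt _ h4 h3
    simpa using this
  have h5 := hI h2
  rw [Set.mem_preimage, ← map_polyOf, ← map_normForm _ hp] at h5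
  have h5 : Valued.v (algebraMap K (v.adicCompletion K) (normForm p ζ a (polyOf u)) -
    algebraMap K _ b) < r := h5
  rwa [← map_sub, valued_algebraMap_adicCompletion] at h5

theorem exists_approx_normForm_real (σ : K →+* ℝ) {p : ℕ} (hp : p ≠ 0) {n : ℕ} (ζ a b : K)
    (t : Fin n → ℝ) (ht : normForm p (σ ζ) (σ a) (polyOf t) = σ b) {r : ℝ} (hr : 0 < r) :
    ∃ ε > 0, ∀ s : Fin n → K, (∀ i, |σ (s i) - t i| < ε) →
        |σ (normForm p ζ a (polyOf s)) - σ b| < r := by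
  have hc := continuous_normForm_polyOf (n := n) hp (σ ζ) (σ a)
  obtain ⟨ε, hε, h⟩ := Metric.continuousAt_iff.1 (hc.continuousAt (x := t)) r hr
  refine ⟨ε, hε, fun s hs => ?_⟩
  have := @h (fun i => σ (s i)) ((dist_pi_lt_iff hε).2 hs)
  rwa [ht, ← map_polyOf, ← map_normForm _ hp] at this

theorem exists_approx_normForm (S : Finset (HeightOneSpectrum (𝓞 K))) {p : ℕ} (hp : p ≠ 0)
    (ζ a b : K)
    (hfin : ∀ v ∈ S, ∃ y : (v.adicCompletion K)[X], y.degree < p ∧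
      normForm p (algebraMap K _ ζ) (algebraMap K _ a) y = algebraMap K _ b)
    (hreal : ∀ σ : K →+* ℝ, ∃ y : ℝ[X], y.degree < p ∧ normForm p (σ ζ) (σ a) y = σ b)
    (r : HeightOneSpectrum (𝓞 K) → ℤᵐ⁰) (hr : ∀ v, r v ≠ 0) {ε : ℝ} (hε : 0 < ε) :
    ∃ y : K[X], (∀ v ∈ S, v.valuation K (normForm p ζ a y - b) < r v) ∧
      ∀ σ : K →+* ℝ, |σ (normForm p ζ a y) - σ b| < ε := by
  classical
  have h1 : ∀ v, ∃ (t' : Fin p → K) (γ : ℤᵐ⁰), γ ≠ 0 ∧ (v ∈ S → ∀ s : Fin p → K,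
      (∀ i, v.valuation K (s i - t' i) < γ) →
        v.valuation K (normForm p ζ a (polyOf s) - b) < r v) := by
    intro v
    by_cases hv : v ∈ S
    · obtain ⟨y, hy, hyn⟩ := hfin v hv
      obtain ⟨t', γ, hγ, h⟩ := exists_approx_normForm_adic v hp ζ a b (fun i : Fin p => y.coeff i)
        (by rwa [polyOf_coeff hy]) (hr v)
      exact ⟨t', γ, hγ, fun _ => h⟩
    · exact ⟨0, 1, one_ne_zero, fun h => absurd h hv⟩
  choose t γ hγ ht using h1
  have h2 : ∀ σ : K →+* ℝ, ∃ (t : Fin p → ℝ), ∃ ε' > 0, ∀ s : Fin p → K,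
      (∀ i, |σ (s i) - t i| < ε') → |σ (normForm p ζ a (polyOf s)) - σ b| < ε := by
    intro σ
    obtain ⟨y, hy, hyn⟩ := hreal σ
    exact ⟨_, exists_approx_normForm_real σ hp ζ a b (fun i : Fin p => y.coeff i)
        (by rwa [polyOf_coeff hy]) hε⟩
  choose τ δ hδ hτ using h2
  obtain ⟨δ', hδ'0, hδ'⟩ : ∃ δ' > 0, ∀ σ, δ' ≤ δ σ := by
    rcases isEmpty_or_nonempty (K →+* ℝ) with h | h
    · exact ⟨1, one_pos, fun σ => h.elim σ⟩
    · obtain ⟨σ, hσ⟩ := Finite.exists_min δ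
      exact ⟨δ σ, hδ σ, hσ⟩
  choose s hs hs' using fun i : Fin p => weak_approximation S (fun v => t v i) γ hγ
    (fun σ => τ σ i) hδ'0
  exact ⟨polyOf s, fun v hv => ht v hv s fun i => hs i v hv,
    fun σ => hτ σ s fun i => (hs' i σ).trans_le (hδ' σ)⟩

end

end

section

open IsDedekindDomain NumberField WithZero

/-- The `K`-algebra `A` has an `n`-dimensional matrix representation over `k`, semilinear
along `φ : K → k`. -/
def HasRep {K k : Type*} [Field K] [Field k] (φ : K →+* k) (A : Type*) [Ring A] [Algebra K A]
    (n : ℕ) : Prop :=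
  ∃ f : A →+* Matrix (Fin n) (Fin n) k, ∀ c : K, f (algebraMap K A c) = algebraMap k _ (φ c)

/-- Representations of dimension `n` exist over all completions. -/
def LocSplit (K : Type*) [Field K] [NumberField K] (A : Type*) [Ring A] [Algebra K A]
    (n : ℕ) : Prop :=
  (∀ v : HeightOneSpectrum (𝓞 K), HasRep (algebraMap K (v.adicCompletion K)) A n) ∧
    ∀ σ : K →+* ℝ, HasRep σ A n

section
open Polynomial

theorem HasRep.exists_normForm_eq {K k : Type*} [Field K] [Field k] {φ : K →+* k} {A : Type*}
    [Ring A] [Algebra K A] {p : ℕ} (h : HasRep φ A p) (hp : p.Prime) {ζ : K}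
    (hζ : IsPrimitiveRoot ζ p) {α β : A} {a b : K} (hαβ : β * α = ζ • (α * β))
    (hα : α ^ p = algebraMap K A a) (hβ : β ^ p = algebraMap K A b) (ha : a ≠ 0) :
    ∃ y : k[X], y.degree < p ∧ normForm p (φ ζ) (φ a) y = φ b := by
  obtain ⟨f, hf⟩ := h
  refine exists_normForm_eq_of_matrix hp (hζ.map_of_injective φ.injective) (A := f α) (B := f β)
    ?_ ?_ ?_ (by simpa using ha)
  · rw [← map_mul, hαβ, Algebra.smul_def, map_mul, hf, map_mul, ← Algebra.smul_def]
  · rw [← map_pow, hα, hf]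
  · rw [← map_pow, hβ, hf]

variable {K : Type} [Field K] [NumberField K] {p : ℕ} {ζ : Kˣ}
  {L : Type} [Field L] [NumberField L] [Algebra K L] {b : Kˣ} {ξ : Lˣ} {σ : Gal(L/K)}

theorem IsKummer.val_pow_eq (h : IsKummer p ζ b ξ σ) : (ξ : L) ^ p = algebraMap K L b :=
  congrArg Units.val h.pow_eq

theorem IsKummer.exists_aeval_eq (h : IsKummer p ζ b ξ σ) (z : L) : ∃ s : K[X], aeval (ξ : L) s = z := by
  have := Subalgebra.isSimpleOrder_of_finrank_prime K L (h.finrank_eq ▸ h.prime)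
  rcases eq_bot_or_eq_top (aeval (R := K) (ξ : L)).range with h1 | h1
  · exfalso
    have h2 : (ξ : L) ∈ (aeval (R := K) (ξ : L)).range := ⟨X, by simp⟩
    rw [h1, Algebra.mem_bot] at h2
    obtain ⟨c, hc⟩ := h2
    have h3 := congrArg Units.val h.galU_eq
    have h4 : σ (ξ : L) = algebraMap K L ζ * ξ := h3
    rw [← hc, AlgEquiv.commutes, ← map_mul] at h4
    have h5 := (algebraMap K L).injective h4
    have hc0 : c ≠ 0 := by rintro rfl; exact ξ.ne_zero (by rw [← hc, map_zero])
    exact h.prim.ne_one h.prime.one_lt (Units.ext (mul_right_cancel₀ hc0 (by rw [← h5]; simp)))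
  · have h2 : z ∈ (aeval (R := K) (ξ : L)).range := h1 ▸ Algebra.mem_top
    exact h2

/-- The value of the norm form is the norm. -/
theorem IsKummer.normForm_eq (h : IsKummer p ζ b ξ σ) {s : K[X]} {z : Lˣ}
    (hz : aeval (ξ : L) s = z) : normForm p (ζ : K) b s = (normU K L z : Kˣ) := by
  have hζ : IsPrimitiveRoot (ζ : K) p := IsPrimitiveRoot.coe_units_iff.2 h.prim
  apply (algebraMap K L).injective
  rw [← aeval_twistProd h.prime.ne_zero hζ s h.val_pow_eq, twistProd, map_prod]
  have h1 := congrArg Units.val (h.prod_galU z)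
  rw [Units.coe_prod] at h1
  refine Eq.trans (Finset.prod_congr rfl fun i _ => ?_) h1
  have h2 : (σ ^ i) (ξ : L) = algebraMap K L (ζ ^ i : Kˣ) * ξ := congrArg Units.val (h.pow_galU i)
  rw [show ((galU (σ ^ i) z : Lˣ) : L) = (σ ^ i) (z : L) from rfl, ← hz, aeval_comp]
  have h3 : aeval ((σ ^ i) (ξ : L)) s = (σ ^ i) (aeval (ξ : L) s) :=
    aeval_algHom_apply ((σ ^ i : Gal(L/K)) : L →ₐ[K] L) _ _
  rw [← h3, h2]
  simp

end

section
open Polynomial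
variable {K : Type} [Field K] [NumberField K] {p : ℕ} {ζ : Kˣ}

instance nonempty_heightOneSpectrum : Nonempty (HeightOneSpectrum (𝓞 K)) := by
  obtain ⟨I, hI⟩ := Ideal.exists_maximal (𝓞 K)
  exact ⟨⟨I, hI.isPrime, Ring.ne_bot_of_isMaximal_of_not_isField hI (RingOfIntegers.not_isField K)⟩⟩

theorem valuation_one_sub_pow (hp : p.Prime) (hζ : IsPrimitiveRoot ζ p)
    (v : HeightOneSpectrum (𝓞 K)) :
    v.valuation K (1 - (ζ : K)) ^ p ≤ 1 ∧ v.valuation K (1 - (ζ : K)) ^ p ≠ 0 := by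
  constructor
  · refine pow_le_one' ((Valuation.map_sub _ _ _).trans ?_) p
    have h1 := ordv_pow v ζ p
    rw [hζ.pow_eq_one, ordv_one] at h1
    have := hp.ne_zero
    rw [ordv_eq_zero_iff.mp (show ordv v ζ = 0 by simpa [this] using h1)]
    simp
  · refine pow_ne_zero _ ?_
    rw [Valuation.ne_zero_iff, sub_ne_zero]
    exact fun h1 => hζ.ne_one hp.one_lt (Units.ext h1.symm)

/-- An element close to `b` differs from it by an element of a small unit ball. -/
theorem div_mem_unitBall {v : HeightOneSpectrum (𝓞 K)} {b c : Kˣ} {r : ℤᵐ⁰} (hr : r ≤ 1)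
    (hr0 : r ≠ 0) (h : v.valuation K ((c : K) - b) < v.valuation K (b : K) * r) :
    b / c ∈ unitBall v r := by
  have hb : v.valuation K (b : K) ≠ 0 := by simp
  have h1 : c / b ∈ unitBall v r := by
    rw [mem_unitBall hr hr0]
    have : ((c / b : Kˣ) : K) - 1 = (c - b) / b := by
      push_cast; field_simp
    rw [this, map_div₀]
    exact (div_lt_iff₀ (zero_lt_iff.2 hb)).2 (by rwa [mul_comm])
  have := (unitBall v r).inv_mem h1
  rwa [inv_div] at this

/-- A symbol algebra with division over a number field cannot be split at all completions. -/
theorem false_of_symbol_of_locSplit {D : Type*} [DivisionRing D] [Algebra K D] (hp : p.Prime)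
    (hζ : IsPrimitiveRoot ζ p) (hD : LocSplit K D p) {α β : D} {a b : Kˣ}
    (hαβ : β * α = (ζ : K) • (α * β)) (hα : α ^ p = algebraMap K D a)
    (hβ : β ^ p = algebraMap K D b) : False := by
  classical
  have hζ' : IsPrimitiveRoot (ζ : K) p := IsPrimitiveRoot.coe_units_iff.2 hζ
  have hne : ∀ {γ : D} {c : Kˣ}, γ ^ p = algebraMap K D c → γ ≠ 0 := by
    rintro γ c h rfl
    rw [zero_pow hp.ne_zero] at h
    exact c.ne_zero ((map_eq_zero _).1 h.symm)
  have hα0 := hne hα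
  have hscal : ∀ {A B : D}, A ≠ 0 → B ≠ 0 → B * A = (ζ : K) • (A * B) →
      ∀ d : K, B ≠ algebraMap K D d := by
    rintro A B hA hB h d rfl
    rw [← Algebra.commutes] at h
    have := smul_left_injective K (mul_ne_zero hB hA) ((one_smul K _).trans h)
    exact hζ'.ne_one hp.one_lt this.symm
  obtain ⟨v₀⟩ := nonempty_heightOneSpectrum (K := K)
  let S : Finset (HeightOneSpectrum (𝓞 K)) :=
    insert v₀ (finite_valuation_one_sub_ne_one hp hζ).toFinset
  obtain ⟨ε, hε0, hε⟩ : ∃ ε > 0, ∀ σ : K →+* ℝ, ε ≤ |σ b| := by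
    rcases isEmpty_or_nonempty (K →+* ℝ) with h | h
    · exact ⟨1, one_pos, fun σ => h.elim σ⟩
    · obtain ⟨σ, hσ⟩ := Finite.exists_min fun σ : K →+* ℝ => |σ b|
      exact ⟨|σ b|, by simp, hσ⟩
  obtain ⟨y, hy, hyσ⟩ := exists_approx_normForm S hp.ne_zero (ζ : K) a b
    (fun v _ => (hD.1 v).exists_normForm_eq hp hζ' hαβ hα hβ a.ne_zero)
    (fun σ => (hD.2 σ).exists_normForm_eq hp hζ' hαβ hα hβ a.ne_zero)
    (fun v => v.valuation K (b : K) * v.valuation K (1 - (ζ : K)) ^ p)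
    (fun v => mul_ne_zero (by simp) (valuation_one_sub_pow hp hζ v).2) hε0
  have hn : normForm p (ζ : K) a y ≠ 0 := by
    intro h0
    have h1 := hy v₀ (Finset.mem_insert_self _ _)
    rw [h0, zero_sub, Valuation.map_neg] at h1
    exact absurd h1 (not_lt.2 (mul_le_of_le_one_right' (valuation_one_sub_pow hp hζ v₀).1))
  obtain ⟨β', hβα, hβ'⟩ := exists_twist hp.ne_zero hζ' y hαβ hα hβ hn
  obtain ⟨c, hc⟩ : ∃ c : Kˣ, (c : K) = normForm p (ζ : K) a y := ⟨Units.mk0 _ hn, rfl⟩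
  rw [← hc, ← Units.val_div_eq_div_val] at hβ'
  rw [← hc] at hy hyσ
  have hβ0 := hne hβ'
  have hnp : ∀ e : Kˣ, e ^ p ≠ b / c := by
    intro e he
    rw [← he, Units.val_pow_eq_pow_val] at hβ'
    obtain ⟨d, -, hd⟩ := exists_eq_algebraMap_of_pow_eq hp.ne_zero hζ' e.ne_zero hβ'
    exact hscal hα0 hβ0 hβα d hd
  obtain ⟨L, _, _, _, ξ, σ, h⟩ := exists_isKummer hp hζ hnp
  have hB : α⁻¹ * β' = (ζ : K) • (β' * α⁻¹) := by
    have h1 := congrArg (fun t => α⁻¹ * t * α⁻¹) hβα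
    simp only [mul_smul_comm, smul_mul_assoc, mul_assoc, mul_inv_cancel₀ hα0, mul_one] at h1
    rw [h1, inv_mul_cancel_left₀ hα0]
  have hα' : α⁻¹ ^ p = algebraMap K D (a⁻¹ : Kˣ) := by
    rw [inv_pow, hα, Units.val_inv_eq_inv_val, map_inv₀]
  have key : a⁻¹ ∈ (normU K L).range := by
    refine h.mem_range_normU (fun v hv => ?_) (fun τ => ?_) fun v hv hns => ?_
    · refine Subgroup.mem_sup_left (div_mem_unitBall (valuation_one_sub_pow hp hζ v).1
        (valuation_one_sub_pow hp hζ v).2 (hy v ?_))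
      simp [S, hv]
    · have h1 := (hyσ τ).trans_le (hε τ)
      rw [Units.val_div_eq_div_val, map_div₀]
      have hb0 : τ b ≠ 0 := by simp
      rcases lt_or_gt_of_ne hb0 with h2 | h2
      · rw [abs_of_neg h2, abs_lt] at h1
        exact div_pos_of_neg_of_neg h2 (by linarith)
      · rw [abs_of_pos h2, abs_lt] at h1
        exact div_pos h2 (by linarith)
    · obtain ⟨s, hs, -⟩ := exists_approx_normForm {v} hp.ne_zero (ζ : K) (b / c : Kˣ) (a⁻¹ : Kˣ)
        (fun v _ => (hD.1 v).exists_normForm_eq hp hζ' hB hβ' hα' (Units.ne_zero _))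
        (fun σ => (hD.2 σ).exists_normForm_eq hp hζ' hB hβ' hα' (Units.ne_zero _))
        (fun v => v.valuation K ((a⁻¹ : Kˣ) : K) * v.valuation K (1 - (ζ : K)) ^ p)
        (fun v => mul_ne_zero (by simp) (valuation_one_sub_pow hp hζ v).2) one_pos
      have hs := hs v (Finset.mem_singleton_self v)
      have hn : normForm p (ζ : K) (b / c : Kˣ) s ≠ 0 := by
        intro h0
        rw [h0, zero_sub, Valuation.map_neg] at hs
        exact absurd hs (not_lt.2 (mul_le_of_le_one_right' (valuation_one_sub_pow hp hζ v).1))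
      have hz0 : aeval (ξ : L) s ≠ 0 := by
        intro h0
        have h1 := aeval_twistProd hp.ne_zero hζ' s h.val_pow_eq
        obtain ⟨q, rfl⟩ := Nat.exists_eq_succ_of_ne_zero hp.ne_zero
        rw [twistProd_succ, map_mul, h0, mul_zero] at h1
        exact hn ((map_eq_zero _).1 h1.symm)
      rw [h.normForm_eq (z := Units.mk0 _ hz0) rfl] at hs
      have h2 := div_mem_unitBall (valuation_one_sub_pow hp hζ v).1
        (valuation_one_sub_pow hp hζ v).2 hs
      rw [← div_mul_cancel a⁻¹ (normU K L (Units.mk0 _ hz0))]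
      exact mul_mem (locPow_le_normLoc v (Subgroup.mem_sup_left h2))
        (range_normU_le_normLoc v ⟨_, rfl⟩)
  obtain ⟨z, hz⟩ := key
  obtain ⟨s, hs⟩ := h.exists_aeval_eq z
  have hn := h.normForm_eq hs
  rw [hz] at hn
  obtain ⟨B', hB', hBp⟩ := exists_twist hp.ne_zero hζ' s hB hβ' hα' (by rw [hn]; simp)
  rw [hn, div_self (Units.ne_zero _)] at hBp
  obtain ⟨d, -, hd⟩ := exists_eq_algebraMap_of_pow_eq hp.ne_zero hζ' one_ne_zero (w := B')
    (by rw [hBp, one_pow])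
  exact hscal hβ0 (hne (c := 1) hBp) hB' d hd

end

end

section

open IsDedekindDomain NumberField WithZero
open scoped TensorProduct

namespace HasRep
variable {K k : Type*} [Field K] [Field k] {φ : K →+* k} {A : Type*} [Ring A] [Algebra K A] {n : ℕ}

theorem of_end {V : Type*} [AddCommGroup V] [Module k V] [Module.Finite k V]
    (hV : Module.finrank k V = n) (f : A →+* Module.End k V)
    (hf : ∀ c : K, f (algebraMap K A c) = algebraMap k _ (φ c)) : HasRep φ A n := by
  let e := LinearMap.toMatrixAlgEquiv (Module.finBasisOfFinrankEq k V hV)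
  refine ⟨(e : _ →+* _).comp f, fun c => ?_⟩
  rw [RingHom.comp_apply, hf]
  exact e.commutes _

theorem exists_end (h : HasRep φ A n) : ∃ f : A →+* Module.End k (Fin n → k),
    ∀ c : K, f (algebraMap K A c) = algebraMap k _ (φ c) := by
  obtain ⟨f, hf⟩ := h
  let e := Matrix.toLinAlgEquiv' (R := k) (n := Fin n)
  refine ⟨(e : _ →+* _).comp f, fun c => ?_⟩
  rw [RingHom.comp_apply, hf]
  exact e.commutes _

theorem comp (h : HasRep φ A n) {k' : Type*} [Field k'] (ψ : k →+* k') :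
    HasRep (ψ.comp φ) A n := by
  obtain ⟨f, hf⟩ := h
  refine ⟨ψ.mapMatrix.comp f, fun c => ?_⟩
  rw [RingHom.comp_apply, hf, Matrix.algebraMap_eq_diagonal, Matrix.algebraMap_eq_diagonal,
    RingHom.mapMatrix_apply, Matrix.diagonal_map (map_zero _)]
  rfl

theorem of_algHom (h : HasRep φ A n) {A' : Type*} [Ring A'] [Algebra K A'] (g : A' →ₐ[K] A) :
    HasRep φ A' n := by
  obtain ⟨f, hf⟩ := h
  exact ⟨f.comp g, fun c => by simpa using hf c⟩

theorem baseChange {F : Type*} [Field F] [Algebra K F] {ψ : F →+* k}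
    (h : HasRep (ψ.comp (algebraMap K F)) A n) : HasRep ψ (F ⊗[K] A) n := by
  obtain ⟨f, hf⟩ := h
  let _ : Algebra F k := ψ.toAlgebra
  let _ : Algebra K k := (ψ.comp (algebraMap K F)).toAlgebra
  have : IsScalarTower K F k := .of_algebraMap_eq fun _ => rfl
  let g : A →ₐ[K] Matrix (Fin n) (Fin n) k := { f with commutes' := hf }
  let l := Algebra.TensorProduct.lift (Algebra.ofId F (Matrix (Fin n) (Fin n) k)) g
    fun x y => Algebra.commutes x (g y)
  exact ⟨l, fun c => l.commutes c⟩

theorem of_baseChange {F : Type*} [Field F] [Algebra K F] {ψ : F →+* k}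
    (h : HasRep ψ (F ⊗[K] A) n) : HasRep (ψ.comp (algebraMap K F)) A n := by
  obtain ⟨f, hf⟩ := h
  refine ⟨f.comp (Algebra.TensorProduct.includeRight : A →ₐ[K] F ⊗[K] A), fun c => ?_⟩
  rw [RingHom.comp_apply, RingHom.comp_apply, ← hf]
  congr 1
  exact ((Algebra.TensorProduct.includeRight : A →ₐ[K] F ⊗[K] A).commutes c).trans
    (IsScalarTower.algebraMap_apply K F _ c)

end HasRep

section
variable {K : Type*} [Field K] {F : Type*} [Field F] [Algebra K F] [FiniteDimensional K F]
  {D : Type*} [DivisionRing D] [Algebra K D] {n : ℕ}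

theorem finrank_mul_of_hasRep (h : HasRep (algebraMap K F) D n) :
    Module.finrank K D ∣ Module.finrank K F * n := by
  obtain ⟨f, hf⟩ := h.exists_end
  let _ : Module D (Fin n → F) := Module.compHom (Fin n → F) f
  have : IsScalarTower K D (Fin n → F) := by
    refine ⟨fun c d v => ?_⟩
    change f (c • d) v = c • f d v
    rw [Algebra.smul_def, map_mul, hf, Module.End.mul_apply, Module.algebraMap_end_apply,
      algebraMap_smul]
  have h1 := Module.finrank_mul_finrank K D (Fin n → F)
  have h2 := Module.finrank_mul_finrank K F (Fin n → F)
  rw [← h1] at h2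
  exact ⟨_, by simpa using h2⟩

theorem dvd_finrank_of_hasRep (hn : n ≠ 0) (hD : Module.finrank K D = n ^ 2)
    (h : HasRep (algebraMap K F) D n) : n ∣ Module.finrank K F := by
  have := finrank_mul_of_hasRep h
  rw [hD, pow_two] at this
  exact Nat.dvd_of_mul_dvd_mul_right (Nat.pos_of_ne_zero hn) this

end

section
variable {K : Type*} [Field K] [NumberField K] {F : Type*} [Field F] [NumberField F] [Algebra K F]

open UniformSpace in
/-- The canonical map of completions. -/
theorem exists_adicCompletion_hom (w : HeightOneSpectrum (𝓞 F)) :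
    ∃ ψ : (placeBelow K w).adicCompletion K →+* w.adicCompletion F,
      ψ.comp (algebraMap K _) = (algebraMap F _).comp (algebraMap K F) := by
  have h := HeightOneSpectrum.uniformContinuous_algebraMap_liesOver K F (placeBelow K w) w
  let g := Completion.mapRingHom (algebraMap (WithVal ((placeBelow K w).valuation K))
    (WithVal (w.valuation F))) h.continuous
  refine ⟨((HeightOneSpectrum.adicCompletion.equiv F w).symm : _ →+* _).comp (g.comp
    (HeightOneSpectrum.adicCompletion.equiv K (placeBelow K w) : _ →+* _)), ?_⟩
  ext c
  rw [RingHom.comp_apply, RingHom.comp_apply (algebraMap F _),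
    HeightOneSpectrum.algebraMap_adicCompletion, HeightOneSpectrum.algebraMap_adicCompletion]
  exact Completion.mapRingHom_coe h.continuous _

theorem LocSplit.baseChange {A : Type*} [Ring A] [Algebra K A] {n : ℕ} (h : LocSplit K A n) :
    LocSplit F (F ⊗[K] A) n := by
  constructor
  · intro w
    obtain ⟨ψ, hψ⟩ := exists_adicCompletion_hom (K := K) w
    refine HasRep.baseChange ?_
    rw [← hψ]
    exact (h.1 _).comp ψ
  · exact fun σ => HasRep.baseChange (h.2 _)

end

end

section

open IsDedekindDomain NumberField WithZero
open scoped TensorProduct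

section
variable {K A B : Type*} [Field K] [Ring A] [Ring B] [Algebra K A] [Algebra K B]
  {ι : Type*} (b : Module.Basis ι K B)

theorem tensorBasis_repr_tmul_one_mul (a : A) (z : A ⊗[K] B) (i : ι) :
    (Algebra.TensorProduct.basis A b).repr (a ⊗ₜ 1 * z) i =
      a * (Algebra.TensorProduct.basis A b).repr z i := by
  induction z with
  | zero => simp
  | tmul x y => simp [Algebra.TensorProduct.basis_repr_tmul, mul_assoc]
  | add x y hx hy => simp [mul_add, hx, hy]

theorem tensorBasis_repr_mul_tmul_one (a : A) (z : A ⊗[K] B) (i : ι) :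
    (Algebra.TensorProduct.basis A b).repr (z * a ⊗ₜ 1) i =
      (Algebra.TensorProduct.basis A b).repr z i * a := by
  induction z with
  | zero => simp
  | tmul x y => simp [Algebra.TensorProduct.basis_repr_tmul, mul_assoc, Algebra.commutes]
  | add x y hx hy => simp [add_mul, hx, hy]

theorem exists_tmul_of_commute [Algebra.IsCentral K A] (z : A ⊗[K] B)
    (hz : ∀ a : A, a ⊗ₜ 1 * z = z * a ⊗ₜ 1) : ∃ y : B, z = 1 ⊗ₜ y := by
  let b := Module.Free.chooseBasis K B
  let r := (Algebra.TensorProduct.basis A b).repr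
  have h : ∀ i, ∃ c : K, r z i = algebraMap K A c := fun i => by
    rw [← Algebra.IsCentral.mem_center_iff, Subalgebra.mem_center_iff]
    intro a
    rw [← tensorBasis_repr_tmul_one_mul, hz, tensorBasis_repr_mul_tmul_one]
  choose c hc using h
  refine ⟨∑ i ∈ (r z).support, c i • b i, ?_⟩
  refine ((Algebra.TensorProduct.basis A b).linearCombination_repr z).symm.trans ?_
  rw [Finsupp.linearCombination_apply, Finsupp.sum, TensorProduct.tmul_sum]
  refine Finset.sum_congr rfl fun i _ => ?_
  change r z i • _ = _
  rw [hc, Algebra.TensorProduct.basis_apply, algebraMap_smul, TensorProduct.tmul_smul]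

theorem isCentral_tensorProduct [Algebra.IsCentral K A] [Algebra.IsCentral K B] [Nontrivial A] :
    Algebra.IsCentral K (A ⊗[K] B) := by
  constructor
  intro z hz
  rw [Subalgebra.mem_center_iff] at hz
  obtain ⟨y, rfl⟩ := exists_tmul_of_commute z fun a => hz _
  have hy : y ∈ Subalgebra.center K B := by
    rw [Subalgebra.mem_center_iff]
    intro x
    have := hz (1 ⊗ₜ x)
    rw [Algebra.TensorProduct.tmul_mul_tmul, Algebra.TensorProduct.tmul_mul_tmul, one_mul] at this
    exact Algebra.TensorProduct.includeRight_injective (R := K) (A := A) (B := B)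
      (algebraMap K A).injective this
  obtain ⟨c, rfl⟩ := Algebra.IsCentral.mem_center_iff K |>.1 hy
  exact ⟨c, ((Algebra.TensorProduct.includeRight : B →ₐ[K] A ⊗[K] B).commutes c).symm⟩

theorem isCentral_baseChange {F : Type*} [Field F] [Algebra K F] [Algebra.IsCentral K A] :
    Algebra.IsCentral F (F ⊗[K] A) := by
  constructor
  intro z hz
  rw [Subalgebra.mem_center_iff] at hz
  obtain ⟨y, hy⟩ := exists_tmul_of_commute (Algebra.TensorProduct.comm K F A z) fun a => by
    have := congrArg (Algebra.TensorProduct.comm K F A) (hz (1 ⊗ₜ a))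
    simpa using this
  have : z = y ⊗ₜ 1 := (Algebra.TensorProduct.comm K F A).injective (by simpa using hy)
  exact ⟨y, by simp [this, Algebra.TensorProduct.algebraMap_apply]⟩

theorem isSimpleRing_tensorProduct [Algebra.IsCentral K A] [IsSimpleRing A] [IsSimpleRing B] :
    IsSimpleRing (A ⊗[K] B) := by
  let b := Module.Free.chooseBasis K B
  let r := (Algebra.TensorProduct.basis A b).repr
  have : Nontrivial (A ⊗[K] B) := inferInstance
  have : Nontrivial (TwoSidedIdeal (A ⊗[K] B)) := inferInstance
  refine ⟨⟨fun I => or_iff_not_imp_left.2 fun hI => ?_⟩⟩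
  have hex : ∃ n : ℕ, ∃ z ∈ I, z ≠ 0 ∧ (r z).support.card = n := by
    by_contra! h
    apply hI
    rw [eq_bot_iff]
    intro z hz
    by_contra hz0
    exact h _ z hz (by simpa using hz0) rfl
  classical
  obtain ⟨z, hz, hz0, hn⟩ := Nat.find_spec hex
  have hmin : ∀ w ∈ I, (r w).support ⊂ (r z).support → w = 0 := fun w hw hlt => by
    by_contra h
    exact Nat.find_min hex (hn ▸ Finset.card_lt_card hlt) ⟨w, hw, h, rfl⟩
  obtain ⟨i, hi⟩ : ∃ i, i ∈ (r z).support := by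
    by_contra! h
    exact hz0 (r.map_eq_zero_iff.1 (Finsupp.support_eq_empty.1 (Finset.eq_empty_of_forall_notMem h)))
  let J : TwoSidedIdeal A := TwoSidedIdeal.mk'
    {c | ∃ w ∈ I, (∀ j, r z j = 0 → r w j = 0) ∧ r w i = c}
    ⟨0, I.zero_mem, by simp, by simp⟩
    (by
      rintro _ _ ⟨w, hw, h, rfl⟩ ⟨w', hw', h', rfl⟩
      exact ⟨w + w', I.add_mem hw hw', fun j hj => by simp [h j hj, h' j hj], by simp⟩)
    (by
      rintro _ ⟨w, hw, h, rfl⟩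
      exact ⟨-w, I.neg_mem hw, fun j hj => by simp [h j hj], by simp⟩)
    (by
      rintro x _ ⟨w, hw, h, rfl⟩
      exact ⟨x ⊗ₜ 1 * w, I.mul_mem_left _ _ hw,
        fun j hj => by simp [r, tensorBasis_repr_tmul_one_mul, h j hj],
        tensorBasis_repr_tmul_one_mul _ _ _ _⟩)
    (by
      rintro _ x ⟨w, hw, h, rfl⟩
      exact ⟨w * x ⊗ₜ 1, I.mul_mem_right _ _ hw,
        fun j hj => by simp [r, tensorBasis_repr_mul_tmul_one, h j hj],
        tensorBasis_repr_mul_tmul_one _ _ _ _⟩)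
  have hJ : J = ⊤ := by
    refine (eq_bot_or_eq_top J).resolve_left fun h => ?_
    have : r z i ∈ J := by
      rw [TwoSidedIdeal.mem_mk']
      exact ⟨z, hz, fun _ h => h, rfl⟩
    rw [h] at this
    exact Finsupp.mem_support_iff.1 hi (by simpa using this)
  obtain ⟨w, hw, hsupp, hwi⟩ : ∃ w ∈ I, (∀ j, r z j = 0 → r w j = 0) ∧ r w i = 1 := by
    have : (1 : A) ∈ J := by rw [hJ]; trivial
    rwa [TwoSidedIdeal.mem_mk'] at this
  obtain ⟨y, rfl⟩ := exists_tmul_of_commute w fun a => by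
    refine sub_eq_zero.1 (hmin _ (I.sub_mem (I.mul_mem_left _ _ hw) (I.mul_mem_right _ _ hw)) ?_)
    refine (Finset.ssubset_iff_of_subset fun j hj => ?_).2 ⟨i, hi, ?_⟩
    · rw [Finsupp.mem_support_iff] at hj ⊢
      intro h
      apply hj
      simp [r, tensorBasis_repr_tmul_one_mul, tensorBasis_repr_mul_tmul_one] at hsupp ⊢
      simp [hsupp j h]
    · simp [r, tensorBasis_repr_tmul_one_mul, tensorBasis_repr_mul_tmul_one] at hwi ⊢
      simp [hwi]
  let L := I.comap (Algebra.TensorProduct.includeRight : B →ₐ[K] A ⊗[K] B)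
  have hL : L = ⊤ := by
    refine (eq_bot_or_eq_top L).resolve_left fun h => ?_
    have : y ∈ L := (TwoSidedIdeal.mem_comap _).2 hw
    rw [h] at this
    have hy : y = 0 := by simpa using this
    simp [hy] at hwi
  have h1 : (1 : B) ∈ L := by rw [hL]; trivial
  rw [TwoSidedIdeal.mem_comap] at h1
  rw [← TwoSidedIdeal.one_mem_iff]
  exact h1

theorem isSimpleRing_baseChange {F : Type*} [Field F] [Algebra K F] [Algebra.IsCentral K A]
    [IsSimpleRing A] : IsSimpleRing (F ⊗[K] A) :=
  .of_ringEquiv (Algebra.TensorProduct.comm K A F).toRingEquiv isSimpleRing_tensorProduct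

end

end

section

open IsDedekindDomain NumberField WithZero
open scoped TensorProduct

namespace HasRep
variable {K k : Type*} [Field K] [Field k] {φ : K →+* k} {D : Type*} [Ring D] [Algebra K D]

theorem matrix {r m : ℕ} (h : HasRep φ D m) : HasRep φ (Matrix (Fin r) (Fin r) D) (r * m) := by
  obtain ⟨f, hf⟩ := h
  let _ : Algebra K k := φ.toAlgebra
  let f' : D →ₐ[K] Matrix (Fin m) (Fin m) k := { f with commutes' := hf }
  let g : Matrix (Fin r) (Fin r) D →ₐ[K] Matrix (Fin (r * m)) (Fin (r * m)) k :=
    (((Matrix.compAlgEquiv (Fin r) (Fin m) k K).trans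
      (Matrix.reindexAlgEquiv K k finProdFinEquiv)).toAlgHom).comp f'.mapMatrix
  exact ⟨g, fun c => g.commutes c⟩

theorem of_matrix {r m : ℕ} [NeZero r] (h : HasRep φ (Matrix (Fin r) (Fin r) D) (r * m)) :
    HasRep φ D m := by
  obtain ⟨g, hg⟩ := h.exists_end
  let W := LinearMap.range (g (Matrix.single 0 0 1))
  have hW : ∀ w ∈ W, g (Matrix.single 0 0 1) w = w := by
    rintro _ ⟨v, rfl⟩
    rw [← Module.End.mul_apply, ← map_mul, Matrix.single_mul_single_same, one_mul]
  have hmem : ∀ (i : Fin r) (d : D) v, g (Matrix.single 0 i d) v ∈ W := fun i d v =>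
    ⟨g (Matrix.single 0 i d) v, by
      rw [← Module.End.mul_apply, ← map_mul, Matrix.single_mul_single_same, one_mul]⟩
  have hsum : ∑ i : Fin r, Matrix.single i i (1 : D) = 1 := by
    ext a b
    rw [Matrix.sum_apply, Finset.sum_eq_single a]
    · simp [Matrix.single_apply, Matrix.one_apply]
    · intro c _ hc
      simp [hc]
    · simp
  let e : (Fin (r * m) → k) ≃ₗ[k] (Fin r → W) :=
    { toFun := fun v i => ⟨g (Matrix.single 0 i 1) v, hmem i 1 v⟩
      map_add' := fun v w => by ext i; simp
      map_smul' := fun c v => by ext i; simp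
      invFun := fun w => ∑ i, g (Matrix.single i 0 1) (w i)
      left_inv := fun v => by
        simp only [← Module.End.mul_apply, ← map_mul, Matrix.single_mul_single_same, one_mul]
        rw [← LinearMap.sum_apply, ← map_sum, hsum, map_one, Module.End.one_apply]
      right_inv := fun w => by
        ext1 i
        apply Subtype.ext
        change g (Matrix.single 0 i 1) (∑ j, g (Matrix.single j 0 1) (w j)) = w i
        rw [map_sum, Finset.sum_eq_single i]
        · rw [← Module.End.mul_apply, ← map_mul, Matrix.single_mul_single_same, one_mul,
            hW _ (w i).2]
        · intro j _ hj
          rw [← Module.End.mul_apply, ← map_mul, Matrix.single_mul_single_of_ne _ _ _ _ hj.symm,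
            map_zero, LinearMap.zero_apply]
        · simp }
  have hdim : Module.finrank k W = m := by
    have := e.finrank_eq
    rw [Module.finrank_fin_fun, Module.finrank_pi_fintype] at this
    simp only [Finset.sum_const, Finset.card_univ, Fintype.card_fin, smul_eq_mul] at this
    exact (Nat.eq_of_mul_eq_mul_left (Nat.pos_of_ne_zero (NeZero.ne r)) this).symm
  refine of_end hdim
    { toFun := fun d => (g (Matrix.single 0 0 d)).restrict (fun v _ => hmem 0 d v)
      map_zero' := by ext; simp
      map_one' := by
        ext1 w
        exact Subtype.ext (hW w w.2)
      map_add' := fun a b => by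
        ext1 w
        apply Subtype.ext
        simp [Matrix.single_add]
      map_mul' := fun a b => by
        ext1 w
        apply Subtype.ext
        change g (Matrix.single 0 0 (a * b)) w =
          g (Matrix.single 0 0 a) (g (Matrix.single 0 0 b) w)
        rw [← Module.End.mul_apply, ← map_mul, Matrix.single_mul_single_same] } fun c => ?_
  ext1 w
  apply Subtype.ext
  change g (Matrix.single 0 0 (algebraMap K D c)) w = φ c • (w : Fin (r * m) → k)
  have : Matrix.single 0 0 (algebraMap K D c) =
      algebraMap K (Matrix (Fin r) (Fin r) D) c * Matrix.single 0 0 1 := by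
    rw [← Algebra.smul_def, Matrix.smul_single, Algebra.algebraMap_eq_smul_one]
  rw [this, map_mul, Module.End.mul_apply, hW w w.2, hg, Module.algebraMap_end_apply]

end HasRep

/-- Locally split central simple algebras of degree `n` are split. -/
def LocSplitImpSplit (n : ℕ) : Prop :=
  ∀ (K : Type) [Field K] [NumberField K] (A : Type) [Ring A] [Algebra K A]
    [Algebra.IsCentral K A] [IsSimpleRing A] [FiniteDimensional K A],
    Module.finrank K A = n ^ 2 → LocSplit K A n → HasRep (RingHom.id K) A n

theorem isCentral_of_matrix {K D : Type*} [Field K] [Ring D] [Algebra K D] {r : ℕ} [NeZero r]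
    [h : Algebra.IsCentral K (Matrix (Fin r) (Fin r) D)] : Algebra.IsCentral K D := by
  constructor
  intro x hx
  have h1 : Matrix.scalarAlgHom (Fin r) K x ∈ Subalgebra.center K (Matrix (Fin r) (Fin r) D) := by
    rw [Matrix.subalgebraCenter_eq_scalarAlgHom_map]
    exact ⟨x, hx, rfl⟩
  obtain ⟨c, hc⟩ := (Algebra.IsCentral.mem_center_iff K).1 h1
  refine ⟨c, ?_⟩
  have := congrFun (congrFun hc 0) 0
  simpa [Matrix.algebraMap_matrix_apply] using this.symm

theorem isDomain_or_hasRep {n : ℕ} (ih : ∀ m < n, LocSplitImpSplit m) {K : Type} [Field K]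
    [NumberField K] {A : Type} [Ring A] [Algebra K A] [Algebra.IsCentral K A] [IsSimpleRing A]
    [FiniteDimensional K A] (hn : Module.finrank K A = n ^ 2) (h : LocSplit K A n) :
    IsDomain A ∨ HasRep (RingHom.id K) A n := by
  have : IsArtinianRing A := IsArtinianRing.of_finite K A
  obtain ⟨r, hr, D, _, _, _, ⟨e⟩⟩ := IsSimpleRing.exists_algEquiv_matrix_divisionRing_finite K A
  have hdim : n ^ 2 = r ^ 2 * Module.finrank K D := by
    rw [← hn, e.toLinearEquiv.finrank_eq, Module.finrank_matrix, Fintype.card_fin, pow_two]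
  obtain ⟨m, rfl⟩ : r ∣ n := (Nat.pow_dvd_pow_iff two_ne_zero).1 ⟨_, hdim⟩
  have hD : Module.finrank K D = m ^ 2 := by
    rw [mul_pow] at hdim
    exact (Nat.eq_of_mul_eq_mul_left (pow_pos (Nat.pos_of_ne_zero (NeZero.ne r)) 2) hdim).symm
  have : Algebra.IsCentral K (Matrix (Fin r) (Fin r) D) := .of_algEquiv K _ _ e
  have : Algebra.IsCentral K D := isCentral_of_matrix (r := r)
  obtain h1 | h1 := eq_or_ne r 1
  · left
    subst h1
    exact (e.toRingEquiv.trans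
      (Matrix.uniqueRingEquiv : Matrix (Fin 1) (Fin 1) D ≃+* D)).toMulEquiv.isDomain D
  · right
    have hm : m < r * m := by
      have : m ≠ 0 := by
        rintro rfl
        simp at hn
        exact Module.finrank_pos.ne' hn
      have hr0 := NeZero.ne r
      nlinarith [show 2 ≤ r by omega, Nat.pos_of_ne_zero this]
    have := ih m hm K D hD ⟨fun v => ((h.1 v).of_algHom (e.symm : _ →ₐ[K] _)).of_matrix,
      fun σ => ((h.2 σ).of_algHom (e.symm : _ →ₐ[K] _)).of_matrix⟩
    exact (this.matrix (r := r)).of_algHom (e : _ →ₐ[K] _)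

end

section

open IsDedekindDomain NumberField WithZero
open scoped TensorProduct

section
variable {E D : Type*} [Field E] [DivisionRing D] [Algebra E D]

open Polynomial in
theorem exists_apply_eq_smul_of_prod {V : Type*} [AddCommGroup V] [Module E V]
    (T : Module.End E V) (s : Finset E) {y : V} (hy : y ≠ 0)
    (h : aeval T (∏ μ ∈ s, (X - C μ)) y = 0) : ∃ μ ∈ s, ∃ z ≠ 0, T z = μ • z := by
  classical
  induction s using Finset.induction_on with
  | empty => simp at h; exact (hy h).elim
  | insert a s ha ih =>
    rw [Finset.prod_insert ha, map_mul, Module.End.mul_apply] at h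
    by_cases h0 : aeval T (∏ μ ∈ s, (X - C μ)) y = 0
    · obtain ⟨μ, hμ, z, hz⟩ := ih h0
      exact ⟨μ, Finset.mem_insert_of_mem hμ, z, hz⟩
    · refine ⟨a, Finset.mem_insert_self _ _, _, h0, ?_⟩
      rw [map_sub, aeval_X, aeval_C, LinearMap.sub_apply, Module.algebraMap_end_apply] at h
      exact sub_eq_zero.1 h

open Polynomial in
theorem exists_mul_eq_smul_mul {p : ℕ} (hp : p.Prime) {ζ : E} (hζ : IsPrimitiveRoot ζ p) {d x : D}
    {b : E} (hd : d ^ p = algebraMap E D b) (hx : d * x ≠ x * d) :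
    ∃ μ : E, IsPrimitiveRoot μ p ∧ ∃ z : D, z ≠ 0 ∧ d * z = μ • (z * d) := by
  classical
  have hd0 : d ≠ 0 := by
    rintro rfl
    simp at hx
  let T : Module.End E D := LinearMap.mulLeft E d * LinearMap.mulRight E d⁻¹
  have hT : ∀ (k : ℕ) z, (T ^ k) z = d ^ k * z * d⁻¹ ^ k := fun k => by
    induction k with
    | zero => simp
    | succ k ih =>
      intro z
      rw [pow_succ', Module.End.mul_apply, ih]
      simp only [T, Module.End.mul_apply, LinearMap.mulLeft_apply, LinearMap.mulRight_apply]
      rw [pow_succ' d, pow_succ d⁻¹]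
      simp only [mul_assoc]
  have hTp : T ^ p = 1 := by
    ext z
    rw [hT, hd, inv_pow, hd, Module.End.one_apply, Algebra.commutes b z, mul_assoc,
      mul_inv_cancel₀, mul_one]
    rw [← hd]
    exact pow_ne_zero _ hd0
  have hy : T x - x ≠ 0 := by
    intro h
    apply hx
    have := sub_eq_zero.1 h
    simp only [T, Module.End.mul_apply, LinearMap.mulLeft_apply, LinearMap.mulRight_apply] at this
    nth_rewrite 2 [← this]
    rw [mul_assoc, mul_assoc, inv_mul_cancel₀ hd0, mul_one]
  have h1 : (1 : E) ∈ nthRootsFinset p (1 : E) := one_mem_nthRootsFinset hp.pos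
  have hprod := X_pow_sub_one_eq_prod hp.pos hζ
  rw [← Finset.mul_prod_erase _ _ h1, mul_comm] at hprod
  have key : aeval T (∏ μ ∈ (nthRootsFinset p (1 : E)).erase 1, (X - C μ)) (T x - x) = 0 := by
    have := congrArg (fun q => aeval T q x) hprod
    simpa [-map_prod, hTp] using this.symm
  obtain ⟨μ, hμ, z, hz, hTz⟩ := exists_apply_eq_smul_of_prod T _ hy key
  rw [Finset.mem_erase, mem_nthRootsFinset hp.pos] at hμ
  refine ⟨μ, ?_, z, hz, ?_⟩
  · have := IsPrimitiveRoot.orderOf μ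
    rwa [orderOf_eq_prime (hp := ⟨hp⟩) hμ.2 hμ.1] at this
  · simp only [T, Module.End.mul_apply, LinearMap.mulLeft_apply, LinearMap.mulRight_apply] at hTz
    rw [← smul_mul_assoc, ← hTz, mul_assoc, mul_assoc, inv_mul_cancel₀ hd0, mul_one]

theorem exists_eq_algebraMap_of_commute {p : ℕ} (hp : p.Prime) [Algebra.IsCentral E D]
    [FiniteDimensional E D] (hD : Module.finrank E D = p ^ 2) {d z w : D} (hdz : d * z ≠ z * d)
    (hd : d * w = w * d) (hz : z * w = w * z) : ∃ a : E, w = algebraMap E D a := by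
  let Z := Subalgebra.centralizer E ({w} : Set D)
  have hmem : ∀ x, x ∈ Z ↔ w * x = x * w := fun x => by simp [Z, Subalgebra.mem_centralizer_iff]
  let _ : DivisionRing Z := divisionRingOfFiniteDimensional E Z
  have hmul : Module.finrank E Z * Module.finrank Z D = p ^ 2 := by
    rw [← hD]
    exact Module.finrank_mul_finrank E Z D
  obtain ⟨i, hi, hip⟩ := (Nat.dvd_prime_pow hp).1 ⟨_, hmul.symm⟩
  have hne : ¬ (⟨d, (hmem d).2 hd.symm⟩ * ⟨z, (hmem z).2 hz.symm⟩ : Z) =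
      ⟨z, (hmem z).2 hz.symm⟩ * ⟨d, (hmem d).2 hd.symm⟩ := fun h => hdz (congrArg Subtype.val h)
  have hbot : ∀ u v : Z, u ∈ (⊥ : Subalgebra E Z) → u * v = v * u := by
    rintro _ v ⟨c, rfl⟩
    exact Algebra.commutes c v
  interval_cases i
  · rw [pow_zero] at hip
    refine (hne (hbot _ _ ?_)).elim
    rw [Subalgebra.bot_eq_top_iff_finrank_eq_one.2 hip]
    trivial
  · rw [pow_one] at hip
    have := Subalgebra.isSimpleOrder_of_finrank_prime E Z (hip ▸ hp)
    obtain h | h := eq_bot_or_eq_top (Algebra.adjoin E {(⟨d, (hmem d).2 hd.symm⟩ : Z)})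
    · refine (hne (hbot _ _ ?_)).elim
      rw [← h]
      exact Algebra.self_mem_adjoin_singleton E _
    · refine (hne (Algebra.commute_of_mem_adjoin_self (R := E) ?_)).elim
      rw [h]
      trivial
  · have : Subalgebra.toSubmodule Z = ⊤ := Submodule.eq_top_of_finrank_eq (hip.trans hD.symm)
    refine (Algebra.IsCentral.mem_center_iff E).1 (Subalgebra.mem_center_iff.2 fun x => ?_)
    have hx : x ∈ Subalgebra.toSubmodule Z := by rw [this]; trivial
    exact ((hmem x).1 hx).symm

theorem false_of_hasRep_of_primitiveRoot {E : Type} [Field E] [NumberField E] {p : ℕ}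
    (hp : p.Prime) {ζ : E} (hζ : IsPrimitiveRoot ζ p) {E' : Type*} [Field E'] [Algebra E E']
    [FiniteDimensional E E'] [IsGalois E E'] (hdeg : Module.finrank E E' = p) {D : Type*}
    [DivisionRing D] [Algebra E D] [Algebra.IsCentral E D] [FiniteDimensional E D]
    (hD : Module.finrank E D = p ^ 2) (h : HasRep (algebraMap E E') D p) (hl : LocSplit E D p) :
    False := by
  have : Fact p.Prime := ⟨hp⟩
  have : IsCyclic Gal(E'/E) := isCyclic_of_prime_card (p := p)
    ((IsGalois.card_aut_eq_finrank E E').trans hdeg)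
  obtain ⟨β, ⟨b, hb⟩, htop⟩ := exists_root_adjoin_eq_top_of_isCyclic E E'
    ⟨ζ, by rwa [hdeg, mem_primitiveRoots hp.pos]⟩
  rw [hdeg] at hb
  obtain ⟨f, hf⟩ := h.exists_end
  let _ : Module D (Fin p → E') := Module.compHom (Fin p → E') f
  have hsmul : ∀ (c : D) (v : Fin p → E'), c • v = f c v := fun _ _ => rfl
  have : IsScalarTower E D (Fin p → E') := by
    refine ⟨fun c d v => ?_⟩
    change f (c • d) v = c • f d v
    rw [Algebra.smul_def, map_mul, hf, Module.End.mul_apply, Module.algebraMap_end_apply,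
      algebraMap_smul]
  have h1 : Module.finrank D (Fin p → E') = 1 := by
    have h1 := Module.finrank_mul_finrank E D (Fin p → E')
    have h2 := Module.finrank_mul_finrank E E' (Fin p → E')
    rw [← h2, hD, hdeg, Module.finrank_fin_fun, pow_two] at h1
    exact Nat.eq_of_mul_eq_mul_left (Nat.mul_pos hp.pos hp.pos) (by rw [h1, mul_one])
  obtain ⟨v, hv, hall⟩ := finrank_eq_one_iff'.1 h1
  obtain ⟨d, hd⟩ := hall (β • v)
  have hpow : ∀ k : ℕ, d ^ k • v = β ^ k • v := fun k => by
    induction k with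
    | zero => simp
    | succ k ih =>
      rw [pow_succ', mul_smul, ih, hsmul, map_smul, ← hsmul, hd, smul_smul, pow_succ]
  have hdp : d ^ p = algebraMap E D b := by
    refine smul_left_injective D hv ?_
    change d ^ p • v = algebraMap E D b • v
    rw [hpow, ← hb, algebraMap_smul, algebraMap_smul]
  have hdE : ¬ ∃ c, d = algebraMap E D c := by
    rintro ⟨c, rfl⟩
    rw [algebraMap_smul, ← algebraMap_smul E' c] at hd
    have hc := smul_left_injective E' hv hd
    rw [← hc] at htop
    have : (IntermediateField.adjoin E {algebraMap E E' c}) = ⊥ := by simp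
    rw [this, IntermediateField.bot_eq_top_iff_finrank_eq_one, hdeg] at htop
    exact hp.one_lt.ne' htop
  have hx : ∃ x, d * x ≠ x * d := by
    by_contra! h
    exact hdE ((Algebra.IsCentral.mem_center_iff E).1
      (Subalgebra.mem_center_iff.2 fun x => (h x).symm))
  obtain ⟨x, hx⟩ := hx
  obtain ⟨μ, hμ, z, hz, hdz⟩ := exists_mul_eq_smul_mul hp hζ hdp hx
  have hd0 : d ≠ 0 := by
    rintro rfl
    simp at hx
  have hne : d * z ≠ z * d := by
    intro h
    rw [hdz] at h
    refine hμ.ne_one hp.one_lt (smul_left_injective E (mul_ne_zero hz hd0) ?_)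
    simpa using h
  have hcomm : ∀ k : ℕ, d * z ^ k = μ ^ k • (z ^ k * d) := fun k => by
    induction k with
    | zero => simp
    | succ k ih =>
      rw [pow_succ, ← mul_assoc, ih, smul_mul_assoc, mul_assoc, hdz, mul_smul_comm, smul_smul,
        mul_assoc, pow_succ]
  obtain ⟨a, ha⟩ := exists_eq_algebraMap_of_commute hp hD hne (w := z ^ p)
    (by rw [hcomm, hμ.pow_eq_one, one_smul]) (by rw [← pow_succ, ← pow_succ'])
  have ha0 : a ≠ 0 := by
    rintro rfl
    rw [map_zero] at ha
    exact hz (pow_eq_zero_iff hp.ne_zero |>.1 ha)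
  have hb0 : b ≠ 0 := by
    rintro rfl
    rw [map_zero] at hdp
    exact hd0 (pow_eq_zero_iff hp.ne_zero |>.1 hdp)
  have hμ0 : μ ≠ 0 := hμ.ne_zero hp.ne_zero
  exact false_of_symbol_of_locSplit (ζ := Units.mk0 μ hμ0) (a := Units.mk0 a ha0)
    (b := Units.mk0 b hb0) hp (IsPrimitiveRoot.coe_units_iff.1 hμ) hl hdz ha hdp

end

end

section

open IsDedekindDomain NumberField WithZero
open scoped TensorProduct

theorem false_of_hasRep_of_finrank_eq_prime_pow {n p : ℕ} (hn : 1 < n) (hp : p.Prime)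
    (ih : ∀ m < n, LocSplitImpSplit m) (j : ℕ) :
    ∀ (E N D : Type) [Field E] [NumberField E] [Field N] [Algebra E N] [FiniteDimensional E N]
      [IsGalois E N] [Ring D] [IsDomain D] [Algebra E D] [Algebra.IsCentral E D]
      [FiniteDimensional E D] (ζ : E), IsPrimitiveRoot ζ p → Module.finrank E N = p ^ j →
      Module.finrank E D = n ^ 2 → LocSplit E D n → ¬ HasRep (algebraMap E N) D n := by
  have : Fact p.Prime := ⟨hp⟩
  induction j with
  | zero =>
    intro E N D _ _ _ _ _ _ _ _ _ _ _ ζ hζ hN hD hl h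
    let _ : DivisionRing D := divisionRingOfFiniteDimensional E D
    have := dvd_finrank_of_hasRep (by omega) hD h
    rw [hN, pow_zero, Nat.dvd_one] at this
    omega
  | succ j hj =>
    intro E N D _ _ _ _ _ _ _ _ _ _ _ ζ hζ hN hD hl h
    let _ : DivisionRing D := divisionRingOfFiniteDimensional E D
    have hcard : Nat.card Gal(N/E) = p ^ (j + 1) := (IsGalois.card_aut_eq_finrank E N).trans hN
    obtain ⟨H, hH⟩ := Sylow.exists_subgroup_card_pow_prime (G := Gal(N/E)) p (n := j)
      ⟨p, by rw [hcard, pow_succ]⟩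
    have hindex : H.index = p := by
      have := H.card_mul_index
      rw [hH, hcard, pow_succ] at this
      exact Nat.eq_of_mul_eq_mul_left (pow_pos hp.pos j) this
    have hnorm : H.Normal := Subgroup.normal_of_index_eq_minFac_card (by
      rw [hindex, hcard, Nat.Prime.pow_minFac hp (Nat.succ_ne_zero j)])
    let E' := IntermediateField.fixedField H
    have : NumberField E' := .of_module_finite E E'
    have : IsGalois E E' := IsGalois.of_fixedField_normal_subgroup H
    have hE'N : Module.finrank E' N = p ^ j :=
      (IntermediateField.finrank_fixedField_eq_card H).trans hH
    have hEE' : Module.finrank E E' = p := by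
      have := Module.finrank_mul_finrank E E' N
      rw [hN, hE'N, pow_succ'] at this
      exact Nat.eq_of_mul_eq_mul_right (pow_pos hp.pos j) this
    have : Algebra.IsCentral E' (E' ⊗[E] D) := isCentral_baseChange
    have : IsSimpleRing (E' ⊗[E] D) := isSimpleRing_baseChange
    have hdim : Module.finrank E' (E' ⊗[E] D) = n ^ 2 := Module.finrank_baseChange.trans hD
    obtain hdom | hrep := isDomain_or_hasRep ih hdim hl.baseChange
    · refine hj E' N (E' ⊗[E] D) (algebraMap E E' ζ)
        (hζ.map_of_injective (algebraMap E E').injective) hE'N hdim hl.baseChange ?_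
      refine HasRep.baseChange ?_
      rwa [← IsScalarTower.algebraMap_eq]
    · have hrep' : HasRep (algebraMap E E') D n := hrep.of_baseChange
      have hnp := dvd_finrank_of_hasRep (by omega) hD hrep'
      rw [hEE'] at hnp
      obtain rfl : n = p := ((Nat.dvd_prime hp).1 hnp).resolve_left (by omega)
      exact false_of_hasRep_of_primitiveRoot hp hζ hEE' hD hrep' hl

open Polynomial in
theorem exists_primitiveRoot_of_finrank_eq_prime_pow {F N : Type*} [Field F] [CharZero F] [Field N]
    [Algebra F N] [FiniteDimensional F N] {p j : ℕ} (hp : p.Prime)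
    (hN : Module.finrank F N = p ^ j)
    (hs : (X ^ p - 1 : N[X]).Splits) : ∃ ζ : F, IsPrimitiveRoot ζ p := by
  have : CharZero N := charZero_of_injective_algebraMap (algebraMap F N).injective
  have : NeZero (p : N) := ⟨Nat.cast_ne_zero.2 hp.ne_zero⟩
  have hc : (cyclotomic p N).Splits := hs.of_dvd (X_pow_sub_C_ne_zero hp.pos 1)
    (cyclotomic.dvd_X_pow_sub_one p N)
  obtain ⟨ζ, hζ⟩ := hc.exists_eval_eq_zero (degree_cyclotomic_pos p N hp.pos).ne'
  have hprim : IsPrimitiveRoot ζ p := isRoot_cyclotomic_iff.1 hζ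
  have hζi : IsIntegral F ζ := IsIntegral.of_finite F ζ
  obtain ⟨i, -, hi⟩ := (Nat.dvd_prime_pow hp).1 (hN ▸ minpoly.degree_dvd hζi)
  have hle : (minpoly F ζ).natDegree ≤ p - 1 := by
    rw [← Nat.totient_prime hp, ← natDegree_cyclotomic p F]
    refine natDegree_le_of_dvd (minpoly.dvd F ζ ?_) (cyclotomic_ne_zero p F)
    rw [aeval_def, eval₂_eq_eval_map, map_cyclotomic]
    exact hζ
  have hi0 : i = 0 := by
    by_contra h
    have := Nat.le_self_pow h p
    have := hp.pos
    omega
  rw [hi0, pow_zero, minpoly.natDegree_eq_one_iff] at hi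
  obtain ⟨ξ, rfl⟩ := hi
  exact ⟨ξ, hprim.of_map_of_injective (algebraMap F N).injective⟩

open Polynomial in
theorem mem_range_of_splits {K N D : Type*} [Field K] [Field N] [Algebra K N] [Ring D] [Algebra K D]
    [Algebra.IsCentral K D] [FiniteDimensional K D] [IsDomain (N ⊗[K] D)] (x : D)
    (hs : ((minpoly K x).map (algebraMap K N)).Splits) : ∃ c : K, x = algebraMap K D c := by
  let w : N ⊗[K] D := 1 ⊗ₜ x
  have hζi : IsIntegral N w := IsIntegral.of_finite N w
  have hdvd : minpoly N w ∣ (minpoly K x).map (algebraMap K N) := by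
    have h1 := minpoly.dvd_map_of_isScalarTower K N w
    have h2 : minpoly K w = minpoly K x :=
      minpoly.algHom_eq (Algebra.TensorProduct.includeRight : D →ₐ[K] N ⊗[K] D)
        (Algebra.TensorProduct.includeRight_injective (algebraMap K N).injective) x
    rwa [h2] at h1
  have hne : (minpoly K x).map (algebraMap K N) ≠ 0 :=
    Polynomial.map_ne_zero (minpoly.ne_zero (IsIntegral.of_finite K x))
  obtain ⟨c, hc⟩ := minpoly.mem_range_of_degree_eq_one N w
    ((hs.of_dvd hne hdvd).degree_eq_one_of_irreducible (minpoly.irreducible hζi))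
  refine (Algebra.IsCentral.mem_center_iff K).1 (Subalgebra.mem_center_iff.2 fun y => ?_)
  refine Algebra.TensorProduct.includeRight_injective (R := K) (A := N) (B := D)
    (algebraMap K N).injective ?_
  rw [map_mul, map_mul]
  change _ * w = w * _
  rw [← hc]
  exact (Algebra.commutes c _).symm

open Polynomial in
theorem not_isDomain_of_locSplit {n : ℕ} (hn : 1 < n) (ih : ∀ m < n, LocSplitImpSplit m)
    {K D : Type} [Field K] [NumberField K] [Ring D] [Algebra K D] [Algebra.IsCentral K D]
    [FiniteDimensional K D] (hD : Module.finrank K D = n ^ 2) (hl : LocSplit K D n) :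
    ¬ IsDomain D := by
  intro hdom
  let _ : DivisionRing D := divisionRingOfFiniteDimensional K D
  let p := n.minFac
  have hp : p.Prime := Nat.minFac_prime hn.ne'
  have : Fact p.Prime := ⟨hp⟩
  obtain ⟨x, hx⟩ : ∃ x : D, ¬ ∃ c : K, x = algebraMap K D c := by
    by_contra! h
    have h1 : (⊥ : Subalgebra K D) = ⊤ := by
      rw [eq_top_iff]
      rintro x -
      obtain ⟨c, rfl⟩ := h x
      exact ⟨c, rfl⟩
    rw [Subalgebra.bot_eq_top_iff_finrank_eq_one, hD] at h1
    nlinarith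
  let f : K[X] := minpoly K x * (X ^ p - 1)
  let N := f.SplittingField
  have hf : f ≠ 0 := mul_ne_zero (minpoly.ne_zero (IsIntegral.of_finite K x))
    (X_pow_sub_C_ne_zero hp.pos 1)
  have hsplit : (f.map (algebraMap K N)).Splits := SplittingField.splits f
  have hf' : f.map (algebraMap K N) ≠ 0 := Polynomial.map_ne_zero hf
  have hs1 : ((minpoly K x).map (algebraMap K N)).Splits :=
    hsplit.of_dvd hf' (Polynomial.map_dvd _ (dvd_mul_right _ _))
  have hs2 : (X ^ p - 1 : N[X]).Splits :=
    hsplit.of_dvd hf' (by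
      rw [Polynomial.map_mul, Polynomial.map_sub, Polynomial.map_pow, map_X, Polynomial.map_one]
      exact dvd_mul_left _ _)
  have : Normal K N := Normal.of_isSplittingField f
  have : IsGalois K N := {}
  have : NumberField N := .of_module_finite K N
  let P : Sylow p Gal(N/K) := default
  obtain ⟨j, hj⟩ := IsPGroup.iff_card.1 P.isPGroup'
  let F := IntermediateField.fixedField (P : Subgroup Gal(N/K))
  have : NumberField F := .of_module_finite K F
  have hFN : Module.finrank F N = p ^ j :=
    (IntermediateField.finrank_fixedField_eq_card (P : Subgroup Gal(N/K))).trans hj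
  have hKF : Module.finrank K F = (P : Subgroup Gal(N/K)).index := by
    have h1 := Module.finrank_mul_finrank K F N
    have h2 := (P : Subgroup Gal(N/K)).card_mul_index
    rw [IsGalois.card_aut_eq_finrank, ← h1, hj, hFN, mul_comm] at h2
    exact (Nat.eq_of_mul_eq_mul_right (pow_pos hp.pos j) h2).symm
  obtain ⟨ζ, hζ⟩ := exists_primitiveRoot_of_finrank_eq_prime_pow hp hFN hs2
  have : Algebra.IsCentral F (F ⊗[K] D) := isCentral_baseChange
  have : IsSimpleRing (F ⊗[K] D) := isSimpleRing_baseChange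
  have : Algebra.IsCentral N (N ⊗[K] D) := isCentral_baseChange
  have : IsSimpleRing (N ⊗[K] D) := isSimpleRing_baseChange
  have hFD : Module.finrank F (F ⊗[K] D) = n ^ 2 := Module.finrank_baseChange.trans hD
  have hND : Module.finrank N (N ⊗[K] D) = n ^ 2 := Module.finrank_baseChange.trans hD
  have hdomF : IsDomain (F ⊗[K] D) := by
    refine (isDomain_or_hasRep ih hFD hl.baseChange).resolve_right fun h => ?_
    have h' : HasRep (algebraMap K F) D n := h.of_baseChange
    have := dvd_finrank_of_hasRep (by omega) hD h'
    rw [hKF] at this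
    exact P.not_dvd_index ((Nat.minFac_dvd n).trans this)
  have hrep : HasRep (algebraMap K N) D n := by
    refine HasRep.of_baseChange (ψ := RingHom.id N) ?_
    refine (isDomain_or_hasRep ih hND hl.baseChange).resolve_left fun h => ?_
    exact hx (mem_range_of_splits (N := N) x hs1)
  refine false_of_hasRep_of_finrank_eq_prime_pow hn hp ih j F N (F ⊗[K] D) ζ hζ hFN hFD
    hl.baseChange (HasRep.baseChange ?_)
  rwa [← IsScalarTower.algebraMap_eq]

theorem locSplitImpSplit (n : ℕ) : LocSplitImpSplit n := by
  induction n using Nat.strong_induction_on with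
  | _ n ih =>
    intro K _ _ A _ _ _ _ _ hA hl
    obtain h0 | rfl | h1 : n = 0 ∨ n = 1 ∨ 1 < n := by omega
    · rw [h0] at hA
      exact (Module.finrank_pos.ne' hA).elim
    · refine HasRep.of_end (V := A) (by simpa using hA) (Algebra.lmul K A : A →+* _) fun c => ?_
      exact (Algebra.lmul K A).commutes c
    · exact (isDomain_or_hasRep ih hA hl).resolve_left (not_isDomain_of_locSplit h1 ih hA hl)

end

section

open IsDedekindDomain NumberField
open scoped TensorProduct MulOpposite

theorem IsSimpleRing.nonempty_linearEquiv_of_finrank_eq (K B V : Type*) [Field K] [Ring B]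
    [Algebra K B] [IsSimpleRing B] [FiniteDimensional K B] [AddCommGroup V] [Module K V]
    [Module B V] [IsScalarTower K B V] [FiniteDimensional K V]
    (h : Module.finrank K V = Module.finrank K B) : Nonempty (V ≃ₗ[B] B) := by
  have : IsArtinianRing B := IsArtinianRing.of_finite K B
  have : IsSemisimpleRing B := IsSimpleRing.isSemisimpleRing_iff_isArtinianRing.mpr ‹_›
  have : Module.Finite B V := Module.Finite.of_restrictScalars_finite K B V
  have hi := IsSimpleRing.isIsotypic B (B × V)
  obtain ⟨-, -, S, hS, -⟩ := hi.linearEquiv_fun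
  have : FiniteDimensional K S := Module.Finite.of_injective
    (S.subtype.restrictScalars K) S.subtype_injective
  have : Nontrivial S := IsSimpleModule.nontrivial B S
  obtain ⟨a, ⟨ea⟩⟩ := ((hi S).of_injective (LinearMap.inl B B V)
    LinearMap.inl_injective).linearEquiv_fun
  obtain ⟨b, ⟨eb⟩⟩ := ((hi S).of_injective (LinearMap.inr B B V)
    LinearMap.inr_injective).linearEquiv_fun
  have ha := (ea.restrictScalars K).finrank_eq
  have hb := (eb.restrictScalars K).finrank_eq
  rw [Module.finrank_pi_fintype, Finset.sum_const, Finset.card_univ, Fintype.card_fin,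
    smul_eq_mul] at ha hb
  have hab : b = a := Nat.eq_of_mul_eq_mul_right (Module.finrank_pos (R := K) (M := S))
    (by rw [← ha, ← hb, h])
  subst hab
  exact ⟨eb.trans ea.symm⟩

theorem nonempty_algHom_of_tensorProduct_op {K B B' V : Type*} [Field K] [Ring B] [Algebra K B]
    [IsSimpleRing B] [FiniteDimensional K B] [Ring B'] [Algebra K B'] [AddCommGroup V]
    [Module K V] [FiniteDimensional K V] (hV : Module.finrank K V = Module.finrank K B)
    (f : B ⊗[K] B'ᵐᵒᵖ →ₐ[K] Module.End K V) : Nonempty (B' →ₐ[K] B) := by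
  let g : B →ₐ[K] Module.End K V := f.comp Algebra.TensorProduct.includeLeft
  let g' : B'ᵐᵒᵖ →ₐ[K] Module.End K V := f.comp Algebra.TensorProduct.includeRight
  have hcomm (b : B) (c : B'ᵐᵒᵖ) (v : V) : g' c (g b v) = g b (g' c v) := by
    simp only [g, g', ← Module.End.mul_apply, AlgHom.comp_apply, ← map_mul]
    simp
  let _ : Module B V := Module.compHom V g.toRingHom
  have hsmul (b : B) (v : V) : b • v = g b v := rfl
  have : IsScalarTower K B V := ⟨fun c b v => by simp [hsmul]⟩
  obtain ⟨θ⟩ := IsSimpleRing.nonempty_linearEquiv_of_finrank_eq K B V hV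
  have key (c : B'ᵐᵒᵖ) (v : V) : θ (g' c v) = θ v * θ (g' c (θ.symm 1)) := by
    rw [← smul_eq_mul, ← map_smul, hsmul, ← hcomm, ← hsmul, ← map_smul, smul_eq_mul, mul_one,
      θ.symm_apply_apply]
  refine ⟨AlgHom.ofLinearMap
    ((θ.restrictScalars K).toLinearMap ∘ₗ LinearMap.applyₗ (θ.symm 1) ∘ₗ g'.toLinearMap ∘ₗ
      (MulOpposite.opLinearEquiv K).toLinearMap) ?_ fun x y => ?_⟩
  · simp
  · change θ (g' (.op (x * y)) (θ.symm 1)) = θ (g' (.op x) (θ.symm 1)) * θ (g' (.op y) (θ.symm 1))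
    rw [MulOpposite.op_mul, map_mul, Module.End.mul_apply, key]

theorem hasRep_tensorProduct_op {K k B B' : Type*} [Field K] [Field k] [Algebra K k] [Ring B]
    [Algebra K B] [Ring B'] [Algebra K B'] [FiniteDimensional K B']
    (e : (k ⊗[K] B) ≃ₐ[k] (k ⊗[K] B')) :
    HasRep (algebraMap K k) (B ⊗[K] B'ᵐᵒᵖ) (Module.finrank K B') := by
  let g : B →ₐ[K] Module.End k (k ⊗[K] B') :=
    ((Algebra.lmul k (k ⊗[K] B')).comp e.toAlgHom).restrictScalars K |>.comp
      Algebra.TensorProduct.includeRight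
  let g' : B'ᵐᵒᵖ →ₐ[K] Module.End k (k ⊗[K] B') :=
    ((Algebra.lsmul k k (k ⊗[K] B')).restrictScalars K : (k ⊗[K] B')ᵐᵒᵖ →ₐ[K] _).comp
      (AlgHom.op Algebra.TensorProduct.includeRight)
  let f := Algebra.TensorProduct.lift g g' fun b c => by
    ext1
    simp [g, g', LinearMap.ext_iff, mul_assoc]
  refine HasRep.of_end (Module.finrank_baseChange (R := k)) f.toRingHom fun c => ?_
  refine (f.commutes c).trans ?_
  rw [IsScalarTower.algebraMap_apply K k]

end

/-- (Local–global principle for central simple algebras.)  Two central simple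
algebras `B`, `B'` of the same dimension over a number field `K` that become isomorphic over
every completion at a finite place and over `ℝ` for every real embedding are isomorphic
over `K`. -/
theorem selectivity_stmt9
    (K : Type) [Field K] [NumberField K]
    (B : Type) [Ring B] [Algebra K B]
    [Algebra.IsCentral K B] [IsSimpleRing B] [FiniteDimensional K B]
    (B' : Type) [Ring B'] [Algebra K B']
    [Algebra.IsCentral K B'] [IsSimpleRing B'] [FiniteDimensional K B']
    (hdim : Module.finrank K B = Module.finrank K B')
    (hfin : ∀ v : HeightOneSpectrum (𝓞 K),
      Nonempty ((v.adicCompletion K ⊗[K] B) ≃ₐ[v.adicCompletion K]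
        (v.adicCompletion K ⊗[K] B')))
    (hreal : ∀ σ : K →+* ℝ,
      letI : Algebra K ℝ := σ.toAlgebra
      Nonempty ((ℝ ⊗[K] B) ≃ₐ[ℝ] (ℝ ⊗[K] B'))) :
    Nonempty (B ≃ₐ[K] B') := by
  have hV : Module.finrank K (B ⊗[K] B'ᵐᵒᵖ) = Module.finrank K B' ^ 2 := by
    rw [Module.finrank_tensorProduct, hdim, sq,
      (MulOpposite.opLinearEquiv K : B' ≃ₗ[K] B'ᵐᵒᵖ).finrank_eq]
  have : Algebra.IsCentral K (B ⊗[K] B'ᵐᵒᵖ) := isCentral_tensorProduct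
  have : IsSimpleRing (B ⊗[K] B'ᵐᵒᵖ) := isSimpleRing_tensorProduct
  obtain ⟨f, hf⟩ := (locSplitImpSplit _ K (B ⊗[K] B'ᵐᵒᵖ) hV
    ⟨fun v => hasRep_tensorProduct_op (hfin v).some, fun σ => by
      let _ : Algebra K ℝ := σ.toAlgebra
      exact hasRep_tensorProduct_op (hreal σ).some⟩).exists_end
  obtain ⟨φ⟩ := nonempty_algHom_of_tensorProduct_op
    (by rw [Module.finrank_fin_fun, hdim]) (⟨f, hf⟩ : _ →ₐ[K] Module.End K (Fin _ → K))
  have hφ : Function.Injective φ := φ.toRingHom.injective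
  exact ⟨(AlgEquiv.ofBijective φ ⟨hφ, (LinearMap.injective_iff_surjective_of_finrank_eq_finrank
    (f := φ.toLinearMap) hdim.symm).1 hφ⟩).symm⟩
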